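/- arXiv:2205.10777 — 7 statements merged into one kernel-verified Lean document; each statement's English description precedes it below -/
import Mathlib

section
/- Let 0 < α ≤ 3 − 2√2 and let f ∈ 𝒜 with f(z) ≠ 0 for z ∈ 𝔻 \ {0} satisfy z f'(z)/f(z) − 1 ≺ z/(1 − αz²) (i.e. f ∈ ℬ𝒮(α)). Then Re(f(z)/z) ≥ ((1 − √α)/(1 + √α))^{1/(2√α)} for all z ∈ 𝔻 \ {0}; in particular ℬ𝒮(α) ⊂ 𝒢₀. -/
open Complex Metric Set

noncomputable section

/-- The class 𝒜 : analytic functions on the unit disk normalized by f(0)=0, f'(0)=1. -/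
def memA (f : ℂ → ℂ) : Prop :=
  DifferentiableOn ℂ f (ball (0 : ℂ) 1) ∧ f 0 = 0 ∧ deriv f 0 = 1

/-- Subordination of analytic functions on the unit disk: g ≺ h iff there is an
analytic self-map ω of 𝔻 with ω(0) = 0 and g = h ∘ ω on 𝔻. -/
def subordinate (g h : ℂ → ℂ) : Prop :=
  ∃ ω : ℂ → ℂ, DifferentiableOn ℂ ω (ball (0 : ℂ) 1) ∧ ω 0 = 0 ∧
    (∀ z ∈ ball (0 : ℂ) 1, ω z ∈ ball (0 : ℂ) 1) ∧
    ∀ z ∈ ball (0 : ℂ) 1, g z = h (ω z)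

lemma aux_poly (s C S c σ : ℝ) (hs0 : 0 ≤ s) (hs1 : s ≤ 0.172) (hC : 0.1 ≤ C)
    (hCS : C ^ 2 + S ^ 2 = 1) (hcσ : c ^ 2 + σ ^ 2 = 1) :
    (1 - s) * ((1 - s) * c * C - (1 + s) * σ * S) ≤
      (1 - s + C * s) * ((1 - s) ^ 2 * c ^ 2 + (1 + s) ^ 2 * σ ^ 2) := by
  have hC1 : C ≤ 1 := by nlinarith [sq_nonneg S]
  set N : ℝ := 1 - s + C * s with hN
  have hN0 : 0 < N := by nlinarith
  set k : ℝ := 1 + 6 * s + s ^ 2 with hk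
  have hk0 : 0 < k := by positivity
  have hk1 : k ≤ 2 * (1 + C) := by nlinarith
  -- the discriminant inequality
  have h1 : 0 ≤ k * (N ^ 2 - C ^ 2) - (1 + s) ^ 2 * S ^ 2 := by
    have e : k * (N ^ 2 - C ^ 2) - (1 + s) ^ 2 * S ^ 2
        = (1 - C) * (2 * s) * (2 * (1 + C) - k) + k * s ^ 2 * (1 - C) ^ 2 := by
      have : S ^ 2 = 1 - C ^ 2 := by linarith
      rw [this, hN, hk]; ring
    rw [e]
    have a1 : 0 ≤ 1 - C := by linarith
    have a2 : 0 ≤ 2 * (1 + C) - k := by linarith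
    positivity
  have e2 : 2 * N * k * (N * ((1 - s) ^ 2 * c ^ 2 + (1 + s) ^ 2 * σ ^ 2)
      - (1 - s) * ((1 - s) * c * C - (1 + s) * σ * S))
      = k * (1 - s) ^ 2 * (N * c - C) ^ 2 + (N * k * σ + (1 - s) * (1 + s) * S) ^ 2
        + (1 - s) ^ 2 * (k * (N ^ 2 - C ^ 2) - (1 + s) ^ 2 * S ^ 2)
        + N ^ 2 * k * (1 - s) ^ 2 * (c ^ 2 + σ ^ 2 - 1) := by
    rw [hk]; ring
  have h3 : 0 ≤ 2 * N * k * (N * ((1 - s) ^ 2 * c ^ 2 + (1 + s) ^ 2 * σ ^ 2)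
      - (1 - s) * ((1 - s) * c * C - (1 + s) * σ * S)) := by
    rw [e2, hcσ]
    have := mul_nonneg (sq_nonneg (1 - s)) h1
    have := mul_nonneg (mul_nonneg hk0.le (sq_nonneg (1 - s))) (sq_nonneg (N * c - C))
    have := sq_nonneg (N * k * σ + (1 - s) * (1 + s) * S)
    linarith
  have := nonneg_of_mul_nonneg_right h3 (by positivity)
  linarith

lemma aux_key (α t C S : ℝ) (w : ℂ) (hα0 : 0 < α) (hα1 : α ≤ 0.172) (ht0 : 0 ≤ t) (ht1 : t ≤ 1)
    (hw : ‖w‖ ≤ t) (hC : 0.1 ≤ C) (hCS : C ^ 2 + S ^ 2 = 1) :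
    -(t * (1 - C + C / (1 - α * t ^ 2))) ≤ ((⟨C, S⟩ : ℂ) * (w / (1 - (α : ℂ) * w ^ 2))).re := by
  have hC1 : C ≤ 1 := by nlinarith [sq_nonneg S]
  have ht2 : t ^ 2 ≤ 1 := by nlinarith
  have hd : 0 < 1 - α * t ^ 2 := by nlinarith
  rcases eq_or_ne w 0 with rfl | hne
  · simp
    have : 0 ≤ C / (1 - α * t ^ 2) := by positivity
    have : 0 ≤ 1 - C := by linarith
    positivity
  have hρ : 0 < ‖w‖ := norm_pos_iff.mpr hne
  set ρ := ‖w‖ with hρd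
  have hsq : w.re ^ 2 + w.im ^ 2 = ρ ^ 2 := by
    rw [hρd, Complex.sq_norm, Complex.normSq_apply]; ring
  obtain ⟨c, hc⟩ : ∃ c, w.re = ρ * c := ⟨w.re / ρ, by field_simp⟩
  obtain ⟨σ, hσ⟩ : ∃ σ, w.im = ρ * σ := ⟨w.im / ρ, by field_simp⟩
  have hcσ : c ^ 2 + σ ^ 2 = 1 := by
    rw [hc, hσ] at hsq
    have : ρ ^ 2 * (c ^ 2 + σ ^ 2) = ρ ^ 2 * 1 := by linarith
    exact mul_left_cancel₀ (by positivity) this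
  have hρ2 : ρ ^ 2 ≤ t ^ 2 := by gcongr
  set s := α * ρ ^ 2 with hs
  have hs0 : 0 ≤ s := by positivity
  have hst : s ≤ α * t ^ 2 := by rw [hs]; gcongr
  have hs1 : s ≤ 0.172 := by nlinarith
  have hp := aux_poly s C S (-c) (-σ) hs0 hs1 hC hCS (by nlinarith)
  have hD0 : 0 < (1 - s) ^ 2 * c ^ 2 + (1 + s) ^ 2 * σ ^ 2 := by
    have : (1 - s) ^ 2 * c ^ 2 + (1 + s) ^ 2 * σ ^ 2 = (1 - s) ^ 2 + 4 * s * σ ^ 2 := by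
      have : c ^ 2 = 1 - σ ^ 2 := by linarith
      rw [this]; ring
    rw [this]
    have : 0 < 1 - s := by linarith
    positivity
  have hure : (1 - (α : ℂ) * w ^ 2).re = 1 - s * (c ^ 2 - σ ^ 2) := by
    simp [pow_two, hc, hσ, hs]; ring
  have huim : (1 - (α : ℂ) * w ^ 2).im = - (2 * s * c * σ) := by
    simp [pow_two, hc, hσ, hs]; ring
  have hn : Complex.normSq (1 - (α : ℂ) * w ^ 2) = (1 - s) ^ 2 * c ^ 2 + (1 + s) ^ 2 * σ ^ 2 := by
    rw [Complex.normSq_apply, hure, huim]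
    have : c ^ 2 = 1 - σ ^ 2 := by linarith
    have e : (1 - s * (c ^ 2 - σ ^ 2)) * (1 - s * (c ^ 2 - σ ^ 2)) +
      -(2 * s * c * σ) * -(2 * s * c * σ) = (1 - s * (c ^ 2 - σ ^ 2)) ^ 2 + 4 * s ^ 2 * c ^ 2 * σ ^ 2 := by
        ring
    rw [e, this]; ring
  have hmain : ((⟨C, S⟩ : ℂ) * (w / (1 - (α : ℂ) * w ^ 2))).re =
      ρ * ((1 - s) * c * C - (1 + s) * σ * S) / ((1 - s) ^ 2 * c ^ 2 + (1 + s) ^ 2 * σ ^ 2) := by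
    rw [← mul_div_assoc, Complex.div_re, hn, hure, huim, ← add_div]
    congr 1
    simp only [Complex.mul_re, Complex.mul_im, hc, hσ]
    have : C * ρ * s * c * (c ^ 2 + σ ^ 2) = C * ρ * s * c := by rw [hcσ]; ring
    have h2 : S * ρ * s * σ * (c ^ 2 + σ ^ 2) = S * ρ * s * σ := by rw [hcσ]; ring
    linear_combination (-1) * this - h2
  rw [hmain, le_div_iff₀ hD0]
  have h1s : 0 < 1 - s := by linarith
  have hmono : ρ * (1 - C + C / (1 - s)) ≤ t * (1 - C + C / (1 - α * t ^ 2)) := by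
    have : C / (1 - s) ≤ C / (1 - α * t ^ 2) := by gcongr
    have : 0 ≤ C / (1 - s) := by positivity
    have : 0 ≤ 1 - C := by linarith
    gcongr
  have hq : ρ * (1 - C + C / (1 - s)) * ((1 - s) ^ 2 * c ^ 2 + (1 + s) ^ 2 * σ ^ 2) ≥
      - (ρ * ((1 - s) * c * C - (1 + s) * σ * S)) := by
    have e : 1 - C + C / (1 - s) = (1 - s + C * s) / (1 - s) := by field_simp; ring
    rw [e, ge_iff_le, mul_div_assoc', div_mul_eq_mul_div, le_div_iff₀ h1s]
    nlinarith
  have := mul_le_mul_of_nonneg_right hmono hD0.le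
  linarith

lemma aux_log (y : ℝ) (hy0 : 0 ≤ y) (hy1 : y < Real.pi / 2) :
    1 ≤ Real.cos y + Real.cos y * Real.log (Real.cos y) + y * Real.sin y := by
  have hcos : ∀ x ∈ Ico 0 (Real.pi / 2), 0 < Real.cos x := fun x hx =>
    Real.cos_pos_of_mem_Ioo ⟨by linarith [hx.1, Real.pi_pos], hx.2⟩
  have d1 : ∀ x ∈ Ico 0 (Real.pi / 2), HasDerivAt
      (fun x => x * Real.cos x - Real.sin x - Real.sin x * Real.log (Real.cos x))
      (- x * Real.sin x - Real.cos x * Real.log (Real.cos x) + Real.sin x * Real.tan x) x := by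
    intro x hx
    have hc := hcos x hx
    have := (((hasDerivAt_id x).mul (Real.hasDerivAt_cos x)).sub (Real.hasDerivAt_sin x)).sub
      ((Real.hasDerivAt_sin x).mul ((Real.hasDerivAt_cos x).log hc.ne'))
    refine this.congr_deriv ?_
    simp only [id, Real.tan_eq_sin_div_cos]; ring
  have m1 : MonotoneOn (fun x => x * Real.cos x - Real.sin x - Real.sin x * Real.log (Real.cos x))
      (Ico 0 (Real.pi / 2)) := by
    apply monotoneOn_of_hasDerivWithinAt_nonneg (convex_Ico _ _)
      (fun x hx => (d1 x hx).continuousAt.continuousWithinAt)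
      (fun x hx => (d1 x (interior_subset hx)).hasDerivWithinAt)
    intro x hx
    have hx := interior_subset hx
    have hc := hcos x hx
    have hs : 0 ≤ Real.sin x := Real.sin_nonneg_of_nonneg_of_le_pi hx.1 (by linarith [hx.2, Real.pi_pos])
    have hl : Real.log (Real.cos x) ≤ 0 := Real.log_nonpos hc.le (Real.cos_le_one x)
    have ht := Real.le_tan hx.1 hx.2
    nlinarith [mul_nonneg hc.le (neg_nonneg.mpr hl), mul_nonneg hs (sub_nonneg.mpr ht)]
  have d2 : ∀ x ∈ Ico 0 (Real.pi / 2), HasDerivAt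
      (fun x => Real.cos x + Real.cos x * Real.log (Real.cos x) + x * Real.sin x)
      (x * Real.cos x - Real.sin x - Real.sin x * Real.log (Real.cos x)) x := by
    intro x hx
    have hc := hcos x hx
    have := ((Real.hasDerivAt_cos x).add ((Real.hasDerivAt_cos x).mul
      ((Real.hasDerivAt_cos x).log hc.ne'))).add ((hasDerivAt_id x).mul (Real.hasDerivAt_sin x))
    refine this.congr_deriv ?_
    simp only [id]; field_simp; ring
  have m2 : MonotoneOn (fun x => Real.cos x + Real.cos x * Real.log (Real.cos x) + x * Real.sin x)
      (Ico 0 (Real.pi / 2)) := by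
    apply monotoneOn_of_hasDerivWithinAt_nonneg (convex_Ico _ _)
      (fun x hx => (d2 x hx).continuousAt.continuousWithinAt)
      (fun x hx => (d2 x (interior_subset hx)).hasDerivWithinAt)
    intro x hx
    have hx := interior_subset hx
    have := m1 (a := 0) ⟨le_rfl, by positivity⟩ hx hx.1
    simpa using this
  have := m2 (a := 0) ⟨le_rfl, by positivity⟩ ⟨hy0, hy1⟩ hy0
  simpa using this

lemma aux_log' (y : ℝ) (hy1 : |y| < Real.pi / 2) :
    1 ≤ Real.cos y + Real.cos y * Real.log (Real.cos y) + y * Real.sin y := by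
  rcases le_total 0 y with h | h
  · exact aux_log y h (by rwa [abs_of_nonneg h] at hy1)
  · have := aux_log (-y) (by linarith) (by rwa [abs_of_nonpos h] at hy1)
    simpa using this

/-- for 0 < α ≤ 3 - 2√2 and f ∈ ℬ𝒮(α), i.e.
zf'(z)/f(z) - 1 ≺ z/(1 - αz²), one has
Re(f(z)/z) ≥ ((1-√α)/(1+√α))^{1/(2√α)} on 𝔻 \ {0}; in particular ℬ𝒮(α) ⊂ 𝒢₀. -/
theorem BS_alpha_subset_G0 (α : ℝ) (hα0 : 0 < α) (hα1 : α ≤ 3 - 2 * Real.sqrt 2)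
    (f : ℂ → ℂ) (hf : memA f) (hf0 : ∀ z ∈ ball (0 : ℂ) 1, z ≠ 0 → f z ≠ 0)
    (hsub : subordinate (fun z => if z = 0 then 0 else z * deriv f z / f z - 1)
      (fun z => z / (1 - (α : ℂ) * z ^ 2))) :
    ∀ z ∈ ball (0 : ℂ) 1, z ≠ 0 →
      ((1 - Real.sqrt α) / (1 + Real.sqrt α)) ^ ((1 : ℝ) / (2 * Real.sqrt α)) ≤ (f z / z).re := by
  intro z hz hz0
  obtain ⟨hfd, hf00, hf1⟩ := hf
  obtain ⟨ω, hωd, hω0, hωm, hω⟩ := hsub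
  have hα2 : α ≤ 0.172 := by
    have : (1.414 : ℝ) ≤ Real.sqrt 2 := Real.le_sqrt_of_sq_le (by norm_num)
    linarith
  have hnb : ∀ x ∈ ball (0 : ℂ) 1, ball (0 : ℂ) 1 ∈ nhds x := fun x hx => isOpen_ball.mem_nhds hx
  have h0m : (0 : ℂ) ∈ ball (0 : ℂ) 1 := by simp
  -- the denominator
  have hden : ∀ x ∈ ball (0 : ℂ) 1, 1 - α ≤ ‖1 - (α : ℂ) * ω x ^ 2‖ := by
    intro x hx
    have h1 : ‖ω x‖ < 1 := by simpa using hωm x hx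
    have h2 : ‖(α : ℂ) * ω x ^ 2‖ ≤ α := by
      rw [norm_mul, norm_pow, Complex.norm_real, Real.norm_of_nonneg hα0.le]
      have : ‖ω x‖ ^ 2 ≤ 1 := pow_le_one₀ (norm_nonneg _) h1.le
      nlinarith
    have := norm_sub_norm_le (1 : ℂ) ((α : ℂ) * ω x ^ 2)
    rw [norm_one] at this
    linarith
  have hden0 : ∀ x ∈ ball (0 : ℂ) 1, 1 - (α : ℂ) * ω x ^ 2 ≠ 0 := by
    intro x hx
    have := hden x hx
    exact norm_pos_iff.mp (by linarith)
  -- Schwarz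
  have hmaps : MapsTo ω (ball 0 1) (closedBall (ω 0) 1) := by
    intro x hx
    rw [hω0]; exact ball_subset_closedBall (hωm x hx)
  set d : ℂ → ℂ := dslope ω 0 with hd
  have hdn : ∀ x ∈ ball (0 : ℂ) 1, ‖d x‖ ≤ 1 := by
    intro x hx
    simpa using Complex.norm_dslope_le_div_of_mapsTo_ball hωd hmaps hx
  have hdd : DifferentiableOn ℂ d (ball 0 1) := (Complex.differentiableOn_dslope (hnb 0 h0m)).mpr hωd
  have hdω : ∀ x, ω x = x * d x := by
    intro x
    have := sub_smul_dslope ω 0 x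
    simp only [sub_zero, hω0, smul_eq_mul] at this
    exact this.symm
  set k : ℂ → ℂ := fun x => d x / (1 - (α : ℂ) * ω x ^ 2) with hk
  have hkd : DifferentiableOn ℂ k (ball 0 1) :=
    hdd.div ((differentiableOn_const _).sub ((differentiableOn_const _).mul (hωd.pow 2))) hden0
  have hkn : ∀ x ∈ ball (0 : ℂ) 1, ‖k x‖ ≤ 1.21 := by
    intro x hx
    have h1 := hden x hx
    have h2 := hdn x hx
    rw [hk]; simp only [norm_div]
    rw [div_le_iff₀ (by linarith)]
    linarith
  obtain ⟨P, hP⟩ := hkd.isExactOn_ball.with_val_at 0 0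
  have hP0 : P 0 = 0 := by tauto
  have hPd : ∀ x ∈ ball (0 : ℂ) 1, HasDerivAt P (k x) x := by
    tauto
  -- p = f z / z
  set p : ℂ → ℂ := dslope f 0 with hp
  have hpd : DifferentiableOn ℂ p (ball 0 1) := (Complex.differentiableOn_dslope (hnb 0 h0m)).mpr hfd
  have hpf : ∀ x, f x = x * p x := by
    intro x
    have := sub_smul_dslope f 0 x
    simp only [sub_zero, hf00, smul_eq_mul] at this
    exact this.symm
  have hp0 : p 0 = 1 := by rw [hp, dslope_same, hf1]
  have hpe1 : ∀ x ∈ ball (0 : ℂ) 1, x ≠ 0 → deriv p x = k x * p x := by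
    intro x hx hx0
    have h1 := hω x hx
    simp only [if_neg hx0] at h1
    have hpx : DifferentiableAt ℂ p x := hpd.differentiableAt (hnb x hx)
    have hfx : deriv f x = p x + x * deriv p x := by
      have e : f = fun y => y * p y := funext hpf
      have := (hasDerivAt_id x).mul hpx.hasDerivAt
      rw [e]
      have := this.deriv
      simp only [id, one_mul] at this
      exact this
    have hpn : p x ≠ 0 := by
      intro h; exact hf0 x hx hx0 (by rw [hpf, h, mul_zero])
    have hk' : ω x / (1 - (α : ℂ) * ω x ^ 2) = x * k x := by
      rw [hk]; simp only []; rw [mul_div_assoc', ← hdω]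
    rw [hk', hfx, hpf x] at h1
    field_simp at h1
    have h2 : x * deriv p x = x * (k x * p x) := by linear_combination h1
    exact mul_left_cancel₀ hx0 h2
  have hpe : ∀ x ∈ ball (0 : ℂ) 1, deriv p x = k x * p x := by
    intro x hx
    rcases eq_or_ne x 0 with rfl | hx0
    · have c1 : ContinuousAt (deriv p) 0 := (hpd.deriv isOpen_ball).continuousOn.continuousAt (hnb 0 h0m)
      have c2 : ContinuousAt (fun x => k x * p x) 0 :=
        (hkd.mul hpd).continuousOn.continuousAt (hnb 0 h0m)
      have := (ContinuousAt.eventuallyEq_nhds_iff_eventuallyEq_nhdsNE c1 c2).mp (by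
        filter_upwards [self_mem_nhdsWithin, mem_nhdsWithin_of_mem_nhds (hnb 0 h0m)] with y hy hy2
        exact hpe1 y hy2 hy)
      exact this.eq_of_nhds
    · exact hpe1 x hx hx0
  have hQd : ∀ x ∈ ball (0 : ℂ) 1, HasDerivAt (fun x => p x * Complex.exp (-P x)) 0 x := by
    intro x hx
    have hpx := (hpd.differentiableAt (hnb x hx)).hasDerivAt
    refine (hpx.mul (hPd x hx).neg.cexp).congr_deriv ?_
    rw [hpe x hx]; ring
  have hpexp : p z = Complex.exp (P z) := by
    have := isOpen_ball.is_const_of_deriv_eq_zero (convex_ball (0 : ℂ) 1).isPreconnected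
      (fun x hx => (hQd x hx).differentiableAt.differentiableWithinAt)
      (fun x hx => (hQd x hx).deriv) hz h0m
    simp only [hP0, hp0, neg_zero, Complex.exp_zero, mul_one] at this
    rw [Complex.exp_neg] at this
    field_simp at this
    exact this
  have hfz : f z / z = Complex.exp (P z) := by
    rw [hpf z, ← hpexp]; field_simp
  have hz1 : ‖z‖ < 1 := by simpa using hz
  -- size of the imaginary part
  have hPn : ‖P z‖ ≤ 1.21 := by
    have := (convex_ball (0 : ℂ) 1).norm_image_sub_le_of_norm_hasDerivWithin_le
      (fun x hx => (hPd x hx).hasDerivWithinAt) hkn h0m hz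
    rw [hP0, sub_zero, sub_zero] at this
    linarith
  set y : ℝ := (P z).im with hy
  have hyabs : |y| ≤ 1.21 := (Complex.abs_im_le_norm _).trans hPn
  have hC : 0.1 ≤ Real.cos y := by
    have := Real.one_sub_sq_div_two_le_cos (x := y)
    have : y ^ 2 ≤ 1.21 ^ 2 := sq_le_sq' (by linarith [(abs_le.mp hyabs).1]) (abs_le.mp hyabs).2
    linarith
  have hylog := aux_log' y (by linarith [Real.pi_gt_three])
  have hCS : Real.cos y ^ 2 + Real.sin y ^ 2 = 1 := Real.cos_sq_add_sin_sq y
  set C := Real.cos y with hCd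
  set S := Real.sin y with hSd
  set β := Real.sqrt α with hβ
  have hβ0 : 0 < β := Real.sqrt_pos.mpr hα0
  have hβ2 : β ^ 2 = α := Real.sq_sqrt hα0.le
  have hβ1 : β < 1 := by nlinarith
  -- integrate along the ray
  have htz : ∀ t ∈ Icc (0 : ℝ) 1, (t : ℂ) * z ∈ ball (0 : ℂ) 1 := by
    intro t ht
    rw [mem_ball_zero_iff, norm_mul, Complex.norm_real, Real.norm_of_nonneg ht.1]
    nlinarith [ht.2, norm_nonneg z]
  have hΦ : ∀ t ∈ Icc (0 : ℝ) 1, HasDerivAt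
      (fun t : ℝ => ((⟨C, S⟩ : ℂ) * P ((t : ℂ) * z)).re + (1 - C) * t
        + C * ((Real.log (1 + β * t) - Real.log (1 - β * t)) / (2 * β)))
      (((⟨C, S⟩ : ℂ) * (k ((t : ℂ) * z) * z)).re + (1 - C) + C * (1 / (1 - α * t ^ 2))) t := by
    intro t ht
    have a1 : 0 < 1 + β * t := by nlinarith [ht.1]
    have a2 : 0 < 1 - β * t := by nlinarith [ht.2]
    have e1 : HasDerivAt (fun t : ℂ => t * z) z (t : ℂ) := by
      simpa using (hasDerivAt_id (t : ℂ)).mul_const z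
    have e2 : HasDerivAt (fun t : ℂ => (⟨C, S⟩ : ℂ) * P (t * z)) ((⟨C, S⟩ : ℂ) * (k ((t : ℂ) * z) * z)) (t : ℂ) :=
      ((hPd _ (htz t ht)).comp (t : ℂ) e1).const_mul _
    have e3 := e2.real_of_complex
    have e4 : HasDerivAt (fun t : ℝ => (1 - C) * t) (1 - C) t := by
      simpa using (hasDerivAt_id t).const_mul (1 - C)
    have e0 : HasDerivAt (fun t : ℝ => β * t) β t := by
      simpa using (hasDerivAt_id t).const_mul β
    have e5 := (e0.const_add 1).log a1.ne'
    have e6 := (e0.const_sub 1).log a2.ne'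
    have e7 := ((e5.sub e6).div_const (2 * β)).const_mul C
    refine ((e3.add e4).add e7).congr_deriv ?_
    congr 2
    have : 1 - α * t ^ 2 = (1 + β * t) * (1 - β * t) := by rw [← hβ2]; ring
    rw [this]
    field_simp
    ring
  have hmono : MonotoneOn (fun t : ℝ => ((⟨C, S⟩ : ℂ) * P ((t : ℂ) * z)).re + (1 - C) * t
        + C * ((Real.log (1 + β * t) - Real.log (1 - β * t)) / (2 * β))) (Icc 0 1) := by
    apply monotoneOn_of_hasDerivWithinAt_nonneg (convex_Icc _ _)
      (fun t ht => (hΦ t ht).continuousAt.continuousWithinAt)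
      (fun t ht => (hΦ t (interior_subset ht)).hasDerivWithinAt)
    intro t ht
    rw [interior_Icc] at ht
    have htI : t ∈ Icc (0 : ℝ) 1 := ⟨ht.1.le, ht.2.le⟩
    have hb := htz t htI
    have hwn : ‖ω ((t : ℂ) * z)‖ ≤ t := by
      rw [hdω, norm_mul, norm_mul, Complex.norm_real, Real.norm_of_nonneg ht.1.le]
      have h1 := hdn _ hb
      calc t * ‖z‖ * ‖d ((t : ℂ) * z)‖ ≤ t * 1 * 1 := by
            have := ht.1.le
            gcongr
        _ = t := by ring
    have key := aux_key α t C S (ω ((t : ℂ) * z)) hα0 hα2 ht.1.le ht.2.le hwn hC hCS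
    have e : (⟨C, S⟩ : ℂ) * (ω ((t : ℂ) * z) / (1 - (α : ℂ) * ω ((t : ℂ) * z) ^ 2))
        = (t : ℂ) * ((⟨C, S⟩ : ℂ) * (k ((t : ℂ) * z) * z)) := by
      have : ω ((t : ℂ) * z) / (1 - (α : ℂ) * ω ((t : ℂ) * z) ^ 2) = ((t : ℂ) * z) * k ((t : ℂ) * z) := by
        rw [hk]; simp only []; rw [mul_div_assoc', ← hdω]
      rw [this]; ring
    rw [e, Complex.re_ofReal_mul] at key
    have h2 : 0 ≤ t * (((⟨C, S⟩ : ℂ) * (k ((t : ℂ) * z) * z)).re + (1 - C) + C * (1 / (1 - α * t ^ 2))) := by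
      have : C * (1 / (1 - α * t ^ 2)) = C / (1 - α * t ^ 2) := by ring
      rw [this]; linarith
    exact nonneg_of_mul_nonneg_right h2 ht.1
  have hfin := hmono (a := 0) (b := 1) ⟨le_rfl, zero_le_one⟩ ⟨zero_le_one, le_rfl⟩ zero_le_one
  simp only [Complex.ofReal_zero, zero_mul, hP0, mul_zero, Complex.zero_re, add_zero, sub_zero,
    Real.log_one, zero_div, Complex.ofReal_one, one_mul, mul_one, Complex.mul_re] at hfin
  rw [← hy] at hfin
  set L := (Real.log (1 + β) - Real.log (1 - β)) / (2 * β) with hL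
  have hCpos : 0 < C := by linarith
  have hx : -L - Real.log C ≤ (P z).re := by
    have : C * (-L - Real.log C) ≤ C * (P z).re := by linarith
    exact le_of_mul_le_mul_left this hCpos
  have hlhs : ((1 - β) / (1 + β)) ^ ((1 : ℝ) / (2 * β)) = Real.exp (-L) := by
    have b1 : 0 < 1 - β := by linarith
    have b2 : 0 < 1 + β := by linarith
    rw [Real.rpow_def_of_pos (by positivity), Real.log_div b1.ne' b2.ne', hL]
    congr 1
    ring
  rw [hlhs, hfz, Complex.exp_re, ← hy, ← hCd]
  have : Real.exp (-L) = Real.exp (-L - Real.log C) * C := by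
    rw [Real.exp_sub, Real.exp_log hCpos]; field_simp
  rw [this]
  gcongr
end
end

section
/- Let φ be analytic and injective on 𝔻 with φ(0) = 1, φ'(0) > 0 (φ'(0) real and positive), Re φ(z) > 0 on 𝔻, φ(𝔻) starlike with respect to 1, and φ(conj(z)) = conj(φ(z)) for all z ∈ 𝔻. Suppose there is γ > 0 such that Re(exp(∫₀^z (φ(t) − 1)/t dt)) ≥ γ for all z ∈ 𝔻, where (φ(t)−1)/t is extended analytically by φ'(0) at t = 0. Then every f ∈ 𝒜 with f(z) ≠ 0 for z ∈ 𝔻 \ {0} satisfying z f'(z)/f(z) ≺ φ(z) satisfies Re(f(z)/z) ≥ γ for all z ∈ 𝔻 \ {0}; in particular 𝒮*(φ) ⊂ 𝒢₀. -/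
open Complex Metric Set intervalIntegral

noncomputable section

theorem aux_left {g : ℝ → ℝ} {g' a x : ℝ} (h : HasDerivAt g g' x) (hx : a < x)
    (hm : ∀ t ∈ Ioo a x, g t ≤ g x) : 0 ≤ g' := by
  have h1 := (hasDerivWithinAt_iff_tendsto_slope' (s := Iio x) (by simp)).1 h.hasDerivWithinAt
  refine ge_of_tendsto h1 ?_
  filter_upwards [Ioo_mem_nhdsLT hx] with t ht
  rw [slope_def_field]
  exact div_nonneg_of_nonpos (by linarith [hm t ht]) (by linarith [ht.2])

theorem aux_right {g : ℝ → ℝ} {g' a x : ℝ} (h : HasDerivAt g g' x) (hx : x < a)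
    (hm : ∀ t ∈ Ioo x a, g t ≤ g x) : g' ≤ 0 := by
  have h1 := (hasDerivWithinAt_iff_tendsto_slope' (s := Ioi x) (by simp)).1 h.hasDerivWithinAt
  refine le_of_tendsto h1 ?_
  filter_upwards [Ioo_mem_nhdsGT hx] with t ht
  rw [slope_def_field]
  exact div_nonpos_of_nonpos_of_nonneg (by linarith [hm t ht]) (by linarith [ht.1])

theorem aux_inv (ψ : ℂ → ℂ) (hd : DifferentiableOn ℂ ψ (ball 0 1))
    (hinj : InjOn ψ (ball 0 1)) :
    IsOpen (ψ '' ball 0 1) ∧ ∃ κ : ℂ → ℂ, DifferentiableOn ℂ κ (ψ '' ball 0 1) ∧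
      ∀ z ∈ ball (0 : ℂ) 1, κ (ψ z) = z := by
  have hB : IsOpen (ball (0 : ℂ) 1) := isOpen_ball
  have han : AnalyticOnNhd ℂ ψ (ball 0 1) := hd.analyticOnNhd hB
  have hpre : IsPreconnected (ball (0 : ℂ) 1) := (convex_ball 0 1).isPreconnected
  have h0 : (0 : ℂ) ∈ ball (0 : ℂ) 1 := by simp
  have h12 : (1 / 2 : ℂ) ∈ ball (0 : ℂ) 1 := by simp; norm_num
  have hne : (1 / 2 : ℂ) ≠ 0 := by norm_num
  have hopen : ∀ s ⊆ ball (0 : ℂ) 1, IsOpen s → IsOpen (ψ '' s) := by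
    rcases han.is_constant_or_isOpen hpre with ⟨w, hw⟩ | h
    · exact absurd (hinj h12 h0 ((hw _ h12).trans (hw _ h0).symm)) hne
    · exact h
  have hU := hopen _ subset_rfl hB
  refine ⟨hU, ?_⟩
  set κ := Function.invFunOn ψ (ball (0 : ℂ) 1) with hκ
  have hleft : ∀ z ∈ ball (0 : ℂ) 1, κ (ψ z) = z := fun z hz => hinj.leftInvOn_invFunOn hz
  refine ⟨κ, ?_, hleft⟩
  have hcont : ∀ z ∈ ball (0 : ℂ) 1, ContinuousAt κ (ψ z) := by
    intro z hz
    rw [ContinuousAt, hleft z hz, Filter.tendsto_def]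
    intro s hs
    obtain ⟨t, hts, hto, hzt⟩ := _root_.mem_nhds_iff.1 hs
    have : ψ '' (t ∩ ball 0 1) ∈ nhds (ψ z) :=
      (hopen _ inter_subset_right (hto.inter hB)).mem_nhds ⟨z, ⟨hzt, hz⟩, rfl⟩
    filter_upwards [this]
    rintro _ ⟨u, ⟨hut, hu⟩, rfl⟩
    simpa [hleft u hu] using hts hut
  have hright : ∀ w ∈ ψ '' ball (0 : ℂ) 1, ψ (κ w) = w := by
    rintro _ ⟨z, hz, rfl⟩
    rw [hleft z hz]
  have hgood : ∀ z ∈ ball (0 : ℂ) 1, deriv ψ z ≠ 0 → DifferentiableAt ℂ κ (ψ z) := by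
    intro z hz hz'
    have h1 : HasDerivAt ψ (deriv ψ z) (κ (ψ z)) := by
      rw [hleft z hz]; exact (hd.differentiableAt (hB.mem_nhds hz)).hasDerivAt
    refine (HasDerivAt.of_local_left_inverse (hcont z hz) h1 hz' ?_).differentiableAt
    filter_upwards [hU.mem_nhds ⟨z, hz, rfl⟩] with w hw using hright w hw
  rintro _ ⟨z, hz, rfl⟩
  refine DifferentiableAt.differentiableWithinAt ?_
  rcases (han.deriv z hz).eventually_eq_zero_or_eventually_ne_zero with h | h
  · exfalso
    have h2 : EqOn (deriv ψ) 0 (ball 0 1) :=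
      han.deriv.eqOn_zero_of_preconnected_of_eventuallyEq_zero hpre hz h
    have h3 : ψ (1 / 2) = ψ 0 :=
      hB.is_const_of_deriv_eq_zero hpre hd h2 h12 h0
    exact hne (hinj h12 h0 h3)
  · refine (Complex.analyticAt_of_differentiable_on_punctured_nhds_of_continuousAt
      ?_ (hcont z hz)).differentiableAt
    have h4 : ∀ᶠ u in nhds z, u ≠ z → deriv ψ u ≠ 0 := by
      simpa [eventually_nhdsWithin_iff] using h
    have h5 : ∀ᶠ w in nhds (ψ z), κ w ≠ z → deriv ψ (κ w) ≠ 0 := by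
      have := hcont z hz
      rw [ContinuousAt, hleft z hz] at this
      exact this.eventually h4
    rw [eventually_nhdsWithin_iff]
    filter_upwards [h5, hU.mem_nhds ⟨z, hz, rfl⟩] with w hw hwU hwne
    obtain ⟨u, hu, rfl⟩ := hwU
    rw [hleft u hu] at hw
    exact hgood u hu (hw (fun h => hwne (by simp [h])))

theorem aux_key_s12 (ψ ω p q : ℂ → ℂ) (hd : DifferentiableOn ℂ ψ (ball 0 1))
    (hinj : InjOn ψ (ball 0 1)) (hψ0 : ψ 0 = 0) (hstar : StarConvex ℝ (0 : ℂ) (ψ '' ball 0 1))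
    (hω : DifferentiableOn ℂ ω (ball 0 1)) (hω0 : ω 0 = 0)
    (hωm : MapsTo ω (ball 0 1) (ball 0 1))
    (hp : DifferentiableOn ℂ p (ball 0 1)) (hq : DifferentiableOn ℂ q (ball 0 1))
    (hp0 : p 0 = 0) (hq0 : q 0 = 0)
    (hpe : ∀ z ∈ ball (0 : ℂ) 1, z * deriv p z = ψ (ω z))
    (hqe : ∀ z ∈ ball (0 : ℂ) 1, z * deriv q z = ψ z) :
    ∀ z ∈ ball (0 : ℂ) 1, ∃ ζ ∈ ball (0 : ℂ) 1, (p z).re ≤ (q ζ).re := by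
  obtain ⟨hU, κ, hκ, hleft⟩ := aux_inv ψ hd hinj
  have hB : IsOpen (ball (0 : ℂ) 1) := isOpen_ball
  set U := ψ '' ball (0 : ℂ) 1 with hUdef
  have h0B : (0 : ℂ) ∈ ball (0 : ℂ) 1 := by simp
  have h0U : (0 : ℂ) ∈ U := ⟨0, h0B, hψ0⟩
  have hκ0 : κ 0 = 0 := by rw [← hψ0, hleft 0 h0B, hψ0]
  have hκB : ∀ w ∈ U, κ w ∈ ball (0 : ℂ) 1 := by
    rintro _ ⟨z, hz, rfl⟩; rwa [hleft z hz]
  have hright : ∀ w ∈ U, ψ (κ w) = w := by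
    rintro _ ⟨z, hz, rfl⟩; rw [hleft z hz]
  have hscale : ∀ w ∈ U, ∀ s : ℝ, 0 ≤ s → s ≤ 1 → (s : ℂ) * w ∈ U := by
    intro w hw s hs0 hs1
    simpa using hstar.smul_mem hw hs0 hs1
  have hseg : ∀ x y : ℝ, 0 ≤ x → x ≤ y → (y : ℂ) ∈ U → (x : ℂ) ∈ U := by
    intro x y hx hxy hy
    rcases eq_or_lt_of_le (hx.trans hxy) with h | h
    · have : x = y := by linarith
      rwa [this]
    · have := hscale y hy (x / y) (by positivity) ((div_le_one h).2 hxy)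
      have hy0 : (y : ℂ) ≠ 0 := by exact_mod_cast h.ne'
      rwa [ofReal_div, div_mul_cancel₀ _ hy0] at this
  have hmono : ∀ x y : ℝ, 0 ≤ x → x ≤ y → (y : ℂ) ∈ U → ‖κ x‖ ≤ ‖κ y‖ := by
    intro x y hx hxy hy
    rcases eq_or_lt_of_le (hx.trans hxy) with h | h
    · have : x = y := by linarith
      rw [this]
    have hy0 : (y : ℂ) ≠ 0 := by exact_mod_cast h.ne'
    have hmaps : MapsTo (fun w => ((x / y : ℝ) : ℂ) * ψ w) (ball 0 1) U := fun w hw =>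
      hscale _ ⟨w, hw, rfl⟩ _ (by positivity) ((div_le_one h).2 hxy)
    have hF : DifferentiableOn ℂ (fun w => κ (((x / y : ℝ) : ℂ) * ψ w)) (ball 0 1) :=
      hκ.comp (hd.const_mul _) hmaps
    have := Complex.norm_le_norm_of_mapsTo_ball (z := κ y) hF
      (fun w hw => ball_subset_closedBall (hκB _ (hmaps hw))) (by simp [hψ0, hκ0])
      (by simpa using hκB _ hy)
    simpa [hright _ hy, div_mul_cancel₀ _ hy0] using this
  have hκd : ∀ w ∈ U, DifferentiableAt ℂ κ w := fun w hw => hκ.differentiableAt (hU.mem_nhds hw)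
  have hpd : ∀ w ∈ ball (0 : ℂ) 1, DifferentiableAt ℂ p w := fun w hw =>
    hp.differentiableAt (hB.mem_nhds hw)
  have hqd : ∀ w ∈ ball (0 : ℂ) 1, DifferentiableAt ℂ q w := fun w hw =>
    hq.differentiableAt (hB.mem_nhds hw)
  intro z hz
  have hz1 : ‖z‖ < 1 := by simpa using hz
  -- reach
  obtain ⟨x₁, hx₁, hx₁U, hx₁z⟩ : ∃ x : ℝ, 0 ≤ x ∧ (x : ℂ) ∈ U ∧ ‖z‖ ≤ ‖κ x‖ := by
    by_contra! hcon
    have hK : IsCompact (ψ '' closedBall 0 ‖z‖) :=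
      (isCompact_closedBall _ _).image_of_continuousOn
        (hd.continuousOn.mono (closedBall_subset_ball hz1))
    have hI : {x : ℝ | 0 ≤ x ∧ (x : ℂ) ∈ U} = {x : ℝ | 0 ≤ x ∧ (x : ℂ) ∈ ψ '' closedBall 0 ‖z‖} := by
      ext x
      constructor
      · rintro ⟨h1, h2⟩
        exact ⟨h1, κ x, by simpa using (hcon x h1 h2).le, hright _ h2⟩
      · rintro ⟨h1, h2⟩
        exact ⟨h1, image_mono (closedBall_subset_ball hz1) h2⟩
    have hcl : IsClosed {x : ℝ | 0 ≤ x ∧ (x : ℂ) ∈ U} := by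
      rw [hI]
      exact isClosed_Ici.inter (hK.isClosed.preimage continuous_ofReal)
    have hbd : BddAbove {x : ℝ | 0 ≤ x ∧ (x : ℂ) ∈ U} := by
      obtain ⟨C, hC⟩ := hK.isBounded.exists_norm_le
      refine ⟨C, fun x hx => ?_⟩
      rw [hI] at hx
      have := hC _ hx.2
      rw [norm_real] at this
      exact (le_abs_self x).trans this
    have hmem := hcl.csSup_mem ⟨0, by simpa using h0U⟩ hbd
    set X := sSup {x : ℝ | 0 ≤ x ∧ (x : ℂ) ∈ U}
    have hev : ∀ᶠ x : ℝ in nhds X, (x : ℂ) ∈ U :=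
      (continuous_ofReal.continuousAt (x := X)).eventually (hU.mem_nhds hmem.2)
    obtain ⟨δ, hδ, hδU⟩ := Metric.eventually_nhds_iff.1 hev
    have h1 : ((X + δ / 2 : ℝ) : ℂ) ∈ U := hδU (by
      rw [Real.dist_eq, add_sub_cancel_left, abs_of_pos (by positivity)]; linarith)
    have := le_csSup hbd (show X + δ / 2 ∈ _ from ⟨by linarith [hmem.1], h1⟩)
    linarith
  have hIU : ∀ x ∈ Icc 0 x₁, (x : ℂ) ∈ U := fun x hx => hseg x x₁ hx.1 hx.2 hx₁U
  have hκc : ContinuousOn (fun x : ℝ => κ x) (Icc 0 x₁) :=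
    hκ.continuousOn.comp continuous_ofReal.continuousOn hIU
  obtain ⟨x, hx, hxz⟩ : ∃ x ∈ Icc 0 x₁, ‖κ x‖ = ‖z‖ := by
    have := intermediate_value_Icc hx₁ hκc.norm
    exact this ⟨by simp [hκ0], hx₁z⟩
  obtain ⟨c, hc, hcz⟩ : ∃ c : ℂ, ‖c‖ = 1 ∧ κ x * c = z := by
    by_cases h : z = 0
    · refine ⟨1, by simp, ?_⟩
      rw [h, norm_zero, norm_eq_zero] at hxz
      simp [hxz, h]
    · have hk : κ x ≠ 0 := by
        rw [← norm_ne_zero_iff, hxz]; simpa using h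
      refine ⟨z / κ x, ?_, by field_simp⟩
      rw [norm_div, hxz, div_self (by simpa using h)]
  refine ⟨κ x, hκB _ (hIU x hx), ?_⟩
  suffices hε : ∀ ε > 0, (p z).re ≤ (q (κ x)).re + ε * x by
    by_contra! hlt
    have h1 := hε (((p z).re - (q (κ x)).re) / (x + 1)) (div_pos (by linarith) (by linarith [hx.1]))
    have h2 : ((p z).re - (q (κ x)).re) / (x + 1) * (x + 1) = (p z).re - (q (κ x)).re :=
      div_mul_cancel₀ _ (by linarith [hx.1])
    have h3 : 0 < ((p z).re - (q (κ x)).re) / (x + 1) := div_pos (by linarith) (by linarith [hx.1])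
    nlinarith
  intro ε hε
  have hmulB : ∀ t ∈ Icc 0 x₁, ∀ c : ℂ, ‖c‖ = 1 → κ t * c ∈ ball (0 : ℂ) 1 := by
    intro t ht c hc
    simpa [hc] using hκB _ (hIU t ht)
  let v : ℝ × ℂ → ℝ := fun a => (p (κ a.1 * a.2)).re - (q (κ a.1)).re - ε * a.1
  have hvc : ContinuousOn v (Icc 0 x₁ ×ˢ sphere (0 : ℂ) 1) := by
    have h1 : ContinuousOn (fun a : ℝ × ℂ => κ a.1) (Icc 0 x₁ ×ˢ sphere (0 : ℂ) 1) :=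
      hκc.comp continuous_fst.continuousOn (fun a ha => ha.1)
    have h2 : ContinuousOn (fun a : ℝ × ℂ => p (κ a.1 * a.2)) (Icc 0 x₁ ×ˢ sphere (0 : ℂ) 1) :=
      hp.continuousOn.comp (h1.mul continuous_snd.continuousOn)
        (fun a ha => hmulB a.1 ha.1 a.2 (by simpa using ha.2))
    have h3 : ContinuousOn (fun a : ℝ × ℂ => q (κ a.1)) (Icc 0 x₁ ×ˢ sphere (0 : ℂ) 1) :=
      hq.continuousOn.comp h1 (fun a ha => hκB _ (hIU _ ha.1))
    exact ((continuous_re.comp_continuousOn h2).sub (continuous_re.comp_continuousOn h3)).sub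
      (by fun_prop)
  obtain ⟨⟨x₀, c₀⟩, ⟨hx₀, hc₀⟩, hmax⟩ := (isCompact_Icc.prod (isCompact_sphere (0 : ℂ) 1)).exists_isMaxOn
    ⟨(x, c), hx, by simpa using hc⟩ hvc
  have hc₀ : ‖c₀‖ = 1 := by simpa using hc₀
  have hx₀ : x₀ ∈ Icc 0 x₁ := hx₀
  have hmax' : ∀ t ∈ Icc 0 x₁, ∀ c : ℂ, ‖c‖ = 1 → v (t, c) ≤ v (x₀, c₀) := fun t ht c hc =>
    hmax ⟨ht, by simpa using hc⟩
  have hfin := hmax' x hx c hc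
  suffices hv0 : v (x₀, c₀) ≤ 0 by
    simp only [v, hcz] at hfin hv0
    linarith
  rcases eq_or_lt_of_le hx₀.1 with h | hpos
  · simp only [v, ← h]; simp [hκ0, hp0, hq0]
  exfalso
  have hx₀U := hIU _ hx₀
  have hz₀B := hmulB x₀ hx₀ c₀ hc₀
  have hx₀C : (x₀ : ℂ) ≠ 0 := by exact_mod_cast hpos.ne'
  have hκne : κ x₀ ≠ 0 := by
    intro h
    have := hright _ hx₀U
    rw [h, hψ0] at this
    exact hx₀C this.symm
  set z₀ := κ x₀ * c₀ with hz₀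
  have hP : HasDerivAt p (deriv p z₀) z₀ := (hpd _ hz₀B).hasDerivAt
  have hQ : HasDerivAt q (deriv q (κ x₀)) (κ x₀) := (hqd _ (hκB _ hx₀U)).hasDerivAt
  have hK : HasDerivAt (fun t : ℝ => κ t) (deriv κ x₀) x₀ :=
    (hκd _ hx₀U).hasDerivAt.comp_ofReal
  -- angular derivative
  have hang : (z₀ * deriv p z₀).im = 0 := by
    have h1 : HasDerivAt (fun θ : ℝ => κ x₀ * (c₀ * exp (θ * I))) (z₀ * I) 0 := by
      have h2 : HasDerivAt (fun θ : ℂ => κ x₀ * (c₀ * exp (θ * I)))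
          (κ x₀ * (c₀ * (exp ((0 : ℝ) * I) * (1 * I)))) ((0 : ℝ) : ℂ) :=
        ((((hasDerivAt_id _).mul_const I).cexp).const_mul c₀).const_mul (κ x₀)
      have h3 := h2.comp_ofReal
      convert h3 using 1
      simp [hz₀]; ring
    have h2 : HasDerivAt (fun θ : ℝ => p (κ x₀ * (c₀ * exp (θ * I)))) (deriv p z₀ * (z₀ * I)) 0 := by
      have hP' : HasDerivAt p (deriv p z₀) (κ x₀ * (c₀ * exp (((0 : ℝ) : ℂ) * I))) := by
        simpa [hz₀] using hP
      exact hP'.comp (0 : ℝ) h1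
    have h3 : HasDerivAt (fun θ : ℝ => (p (κ x₀ * (c₀ * exp (θ * I)))).re)
        (deriv p z₀ * (z₀ * I)).re 0 :=
      (Complex.reCLM.hasFDerivAt.comp_hasDerivAt (0 : ℝ) h2)
    have h4 : IsLocalMax (fun θ : ℝ => (p (κ x₀ * (c₀ * exp (θ * I)))).re) 0 := by
      refine Filter.Eventually.of_forall fun θ => ?_
      have := hmax' x₀ hx₀ (c₀ * exp (θ * I)) (by simp [hc₀, norm_exp_ofReal_mul_I])
      simp only [v] at this
      simp only [ofReal_zero, zero_mul, exp_zero, mul_one]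
      linarith
    have h5 := h4.hasDerivAt_eq_zero h3
    have h6 : (deriv p z₀ * (z₀ * I)).re = - (z₀ * deriv p z₀).im := by
      simp; ring
    linarith
  set y := (z₀ * deriv p z₀).re with hy
  have hyC : z₀ * deriv p z₀ = y := by
    apply Complex.ext <;> simp [hy, hang]
  set m := (deriv κ x₀ / κ x₀).re with hm
  -- radial derivative
  have hrad : 0 ≤ y * m - x₀ * m - ε := by
    have h1 : HasDerivAt (fun t : ℝ => p (κ t * c₀)) (deriv p z₀ * (deriv κ x₀ * c₀)) x₀ :=
      HasDerivAt.comp x₀ (h₂ := p) hP (hK.mul_const c₀)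
    have h2 : HasDerivAt (fun t : ℝ => q (κ t)) (deriv q (κ x₀) * deriv κ x₀) x₀ :=
      HasDerivAt.comp x₀ (h₂ := q) hQ hK
    have h3 : HasDerivAt (fun t : ℝ => (p (κ t * c₀)).re) (deriv p z₀ * (deriv κ x₀ * c₀)).re x₀ :=
      (Complex.reCLM.hasFDerivAt.comp_hasDerivAt x₀ h1)
    have h4 : HasDerivAt (fun t : ℝ => (q (κ t)).re) (deriv q (κ x₀) * deriv κ x₀).re x₀ :=
      (Complex.reCLM.hasFDerivAt.comp_hasDerivAt x₀ h2)
    have h5 := (h3.sub h4).sub ((hasDerivAt_id x₀).const_mul ε)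
    have h6 := aux_left h5 hpos (fun t ht => by
      have := hmax' t ⟨ht.1.le, ht.2.le.trans hx₀.2⟩ c₀ hc₀
      simpa [v] using this)
    have e1 : deriv p z₀ * (deriv κ x₀ * c₀) = y * (deriv κ x₀ / κ x₀) := by
      rw [← hyC, hz₀]; field_simp
    have e2 : deriv q (κ x₀) * deriv κ x₀ = x₀ * (deriv κ x₀ / κ x₀) := by
      have := hqe _ (hκB _ hx₀U)
      rw [hright _ hx₀U] at this
      rw [← mul_div_assoc, eq_div_iff hκne]
      linear_combination (deriv κ x₀) * this
    rw [e1, e2, re_ofReal_mul, re_ofReal_mul] at h6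
    simpa using h6
  have hN : HasDerivAt (fun t : ℝ => ‖κ t‖ ^ 2) (2 * (‖κ x₀‖ ^ 2 * m)) x₀ := by
    have h1 := hK.norm_sq
    convert h1 using 1
    have h2 : deriv κ x₀ = κ x₀ * (deriv κ x₀ / κ x₀) := by field_simp
    have h3 : inner ℝ (κ x₀) (deriv κ x₀) = ‖κ x₀‖ ^ 2 * m := by
      rw [h2, Complex.inner, ← Complex.normSq_eq_norm_sq, hm, ← re_ofReal_mul,
        Complex.normSq_eq_conj_mul_self]
      ring_nf
    rw [h3]
  have hNpos : 0 < ‖κ x₀‖ ^ 2 := by positivity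
  have hm0 : 0 ≤ m := by
    have := aux_left hN hpos (fun t ht => by
      have := hmono t x₀ ht.1.le ht.2.le hx₀U
      gcongr)
    by_contra! h
    nlinarith
  rcases le_or_gt y x₀ with hyx | hyx
  · nlinarith
  have hyψ : (y : ℂ) = ψ (ω z₀) := by rw [← hyC, hpe _ hz₀B]
  have hyU : (y : ℂ) ∈ U := ⟨ω z₀, hωm hz₀B, hyψ.symm⟩
  have hyle : ‖κ y‖ ≤ ‖κ x₀‖ := by
    rw [hyψ, hleft _ (hωm hz₀B)]
    have := Complex.norm_le_norm_of_mapsTo_ball (z := z₀) hω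
      (fun w hw => ball_subset_closedBall (hωm hw)) hω0 (by simpa using hz₀B)
    simpa [hz₀, hc₀] using this
  have := aux_right hN hyx (fun t ht => by
      have := (hmono t y (hpos.le.trans ht.1.le) ht.2.le hyU).trans hyle
      gcongr)
  have hm1 : m ≤ 0 := by
    by_contra! h
    nlinarith [mul_pos hNpos h]
  nlinarith

theorem aux_S (γ : ℝ) (hγ : 0 < γ) :
    Convex ℝ {w : ℂ | w.im ∈ Icc (-(Real.pi / 2)) (Real.pi / 2) ∧ γ ≤ (exp w).re} ∧
    IsClosed {w : ℂ | w.im ∈ Icc (-(Real.pi / 2)) (Real.pi / 2) ∧ γ ≤ (exp w).re} := by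
  constructor
  · have hiff : ∀ w : ℂ, γ ≤ (exp w).re → w.im ∈ Icc (-(Real.pi / 2)) (Real.pi / 2) →
        0 < Real.cos w.im ∧ Real.log γ ≤ w.re + Real.log (Real.cos w.im) := by
      intro w h _
      rw [exp_re] at h
      have hc : 0 < Real.cos w.im := by
        by_contra! hc
        nlinarith [Real.exp_pos w.re]
      refine ⟨hc, ?_⟩
      have := Real.log_le_log hγ h
      rwa [Real.log_mul (Real.exp_pos _).ne' hc.ne', Real.log_exp] at this
    rintro u ⟨hu1, hu2⟩ w ⟨hw1, hw2⟩ a b ha hb hab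
    obtain ⟨hu3, hu4⟩ := hiff u hu2 hu1
    obtain ⟨hw3, hw4⟩ := hiff w hw2 hw1
    have him : (a • u + b • w).im = a • u.im + b • w.im := by simp
    have hre : (a • u + b • w).re = a * u.re + b * w.re := by simp
    refine ⟨?_, ?_⟩
    · rw [him]; exact convex_Icc _ _ hu1 hw1 ha hb hab
    · rw [exp_re, him, hre]
      have h1 := strictConcaveOn_cos_Icc.concaveOn.2 hu1 hw1 ha hb hab
      have h2 := strictConcaveOn_log_Ioi.concaveOn.2 (mem_Ioi.2 hu3) (mem_Ioi.2 hw3) ha hb hab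
      have h3 : 0 < a • Real.cos u.im + b • Real.cos w.im :=
        convex_Ioi (0 : ℝ) (mem_Ioi.2 hu3) (mem_Ioi.2 hw3) ha hb hab
      have h4 := Real.log_le_log h3 h1
      have hcpos := h3.trans_le h1
      rw [← Real.exp_log hγ, ← Real.exp_log hcpos, ← Real.exp_add]
      apply Real.exp_le_exp.2
      simp only [smul_eq_mul] at *
      have h5 := mul_le_mul_of_nonneg_left hu4 ha
      have h6 := mul_le_mul_of_nonneg_left hw4 hb
      have h7 : Real.log γ = a * Real.log γ + b * Real.log γ := by rw [← add_mul, hab, one_mul]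
      linarith
  · exact (isClosed_Icc.preimage continuous_im).inter
      (isClosed_Ici.preimage (continuous_re.comp continuous_exp))

/-- for a Ma–Minda function φ (analytic, univalent, φ(0)=1, φ'(0)>0,
Re φ > 0, starlike image w.r.t. 1, real symmetric) with
Re(exp(∫₀^z (φ(t)-1)/t dt)) ≥ γ > 0 on 𝔻, every f ∈ 𝒮*(φ) satisfies
Re(f(z)/z) ≥ γ on 𝔻 \ {0}; in particular 𝒮*(φ) ⊂ 𝒢₀. -/
theorem MaMinda_subset_G0 (φ : ℂ → ℂ)
    (hφd : DifferentiableOn ℂ φ (ball (0 : ℂ) 1)) (hφinj : Set.InjOn φ (ball (0 : ℂ) 1))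
    (hφ0 : φ 0 = 1) (hφ'im : (deriv φ 0).im = 0) (hφ'pos : 0 < (deriv φ 0).re)
    (hφre : ∀ z ∈ ball (0 : ℂ) 1, 0 < (φ z).re)
    (hφstar : StarConvex ℝ (1 : ℂ) (φ '' ball (0 : ℂ) 1))
    (hφsymm : ∀ z ∈ ball (0 : ℂ) 1, φ (starRingEnd ℂ z) = starRingEnd ℂ (φ z))
    (γ : ℝ) (hγ : 0 < γ)
    (hγle : ∀ z ∈ ball (0 : ℂ) 1,
      γ ≤ (Complex.exp (z * ∫ s in (0 : ℝ)..1,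
        (if (s : ℂ) * z = 0 then deriv φ 0 else (φ ((s : ℂ) * z) - 1) / ((s : ℂ) * z)))).re)
    (f : ℂ → ℂ) (hf : memA f) (hf0 : ∀ z ∈ ball (0 : ℂ) 1, z ≠ 0 → f z ≠ 0)
    (hsub : subordinate (fun z => if z = 0 then 1 else z * deriv f z / f z) φ) :
    ∀ z ∈ ball (0 : ℂ) 1, z ≠ 0 → γ ≤ (f z / z).re := by
  intro z hz hz0
  obtain ⟨ω, hω, hω0, hωm, hωe⟩ := hsub
  obtain ⟨hfd, hf00, hf1⟩ := hf
  have hB : IsOpen (ball (0 : ℂ) 1) := isOpen_ball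
  have h0B : (0 : ℂ) ∈ ball (0 : ℂ) 1 := by simp
  have hBn : ball (0 : ℂ) 1 ∈ nhds (0 : ℂ) := hB.mem_nhds h0B
  -- the primitive q
  have hgd : DifferentiableOn ℂ (dslope φ 0) (ball 0 1) := (differentiableOn_dslope hBn).2 hφd
  obtain ⟨q, hq0, hq⟩ := hgd.isExactOn_ball.with_val_at 0 0
  have hqd : DifferentiableOn ℂ q (ball 0 1) := fun w hw =>
    (hq w hw).differentiableAt.differentiableWithinAt
  have hqe : ∀ w ∈ ball (0 : ℂ) 1, w * deriv q w = φ w - 1 := by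
    intro w hw
    rw [(hq w hw).deriv]
    have := sub_smul_dslope φ 0 w
    simpa [hφ0] using this
  have hscale : ∀ w ∈ ball (0 : ℂ) 1, ∀ s ∈ Icc (0 : ℝ) 1, (s : ℂ) * w ∈ ball (0 : ℂ) 1 := by
    intro w hw s hs
    simp only [mem_ball, dist_zero_right, norm_mul, norm_real, Real.norm_eq_abs,
      abs_of_nonneg hs.1] at *
    nlinarith [hs.2, norm_nonneg w]
  have hqexp : ∀ w ∈ ball (0 : ℂ) 1, γ ≤ (exp (q w)).re := by
    intro w hw
    have h1 := hγle w hw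
    have h2 : (w * ∫ s in (0 : ℝ)..1,
        (if (s : ℂ) * w = 0 then deriv φ 0 else (φ ((s : ℂ) * w) - 1) / ((s : ℂ) * w))) = q w := by
      have e : ∀ s : ℝ, (if (s : ℂ) * w = 0 then deriv φ 0
          else (φ ((s : ℂ) * w) - 1) / ((s : ℂ) * w)) = dslope φ 0 ((s : ℂ) * w) := by
        intro s
        split_ifs with h
        · rw [h, dslope_same]
        · rw [dslope_of_ne _ h, slope_def_field, hφ0, sub_zero]
      simp_rw [e]
      rw [← intervalIntegral.integral_const_mul]
      have hder : ∀ s ∈ uIcc (0 : ℝ) 1, HasDerivAt (fun s : ℝ => q ((s : ℂ) * w))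
          (w * dslope φ 0 ((s : ℂ) * w)) s := by
        intro s hs
        rw [uIcc_of_le zero_le_one] at hs
        have h3 : HasDerivAt (fun s : ℝ => (s : ℂ) * w) (1 * w) s :=
          (((hasDerivAt_id (s : ℂ)).mul_const w).comp_ofReal)
        have h4 := HasDerivAt.comp s (h₂ := q) (hq _ (hscale w hw s hs)) h3
        have e4 : w * dslope φ 0 ((s : ℂ) * w) = dslope φ 0 ((s : ℂ) * w) * (1 * w) := by ring
        rw [e4]
        exact h4
      rw [intervalIntegral.integral_eq_sub_of_hasDerivAt hder]
      · simp [hq0]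
      · apply ContinuousOn.intervalIntegrable
        rw [uIcc_of_le zero_le_one]
        exact continuousOn_const.mul (hgd.continuousOn.comp (by fun_prop) (hscale w hw))
    rwa [h2] at h1
  have hqS : ∀ w ∈ ball (0 : ℂ) 1,
      q w ∈ {w : ℂ | w.im ∈ Icc (-(Real.pi / 2)) (Real.pi / 2) ∧ γ ≤ (exp w).re} := by
    intro w hw
    refine ⟨?_, hqexp w hw⟩
    have hc : ContinuousOn (fun s : ℝ => (q ((s : ℂ) * w)).im) (Icc 0 1) :=
      continuous_im.comp_continuousOn (hqd.continuousOn.comp (by fun_prop) (hscale w hw))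
    have hno : ∀ s ∈ Icc (0 : ℝ) 1, Real.cos (q ((s : ℂ) * w)).im ≠ 0 := by
      intro s hs h
      have := hqexp _ (hscale w hw s hs)
      rw [exp_re, h, mul_zero] at this
      linarith
    have hpi := Real.pi_pos
    constructor
    · by_contra! h
      obtain ⟨s, hs, hs'⟩ := intermediate_value_Icc' zero_le_one hc
        (show -(Real.pi / 2) ∈ _ from ⟨by simpa using h.le, by simp [hq0]; positivity⟩)
      exact hno s hs (by simp only at hs'; rw [hs']; simp)
    · by_contra! h
      obtain ⟨s, hs, hs'⟩ := intermediate_value_Icc zero_le_one hc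
        (show Real.pi / 2 ∈ _ from ⟨by simp [hq0]; positivity, by simpa using h.le⟩)
      exact hno s hs (by simp only at hs'; rw [hs']; simp)
  -- the logarithm p
  set k := dslope f 0 with hk
  have hkd : DifferentiableOn ℂ k (ball 0 1) := (differentiableOn_dslope hBn).2 hfd
  have hk0 : k 0 = 1 := by rw [hk, dslope_same, hf1]
  have hfk : ∀ w, f w = w * k w := by
    intro w
    have := sub_smul_dslope f 0 w
    simpa [hf00] using this.symm
  have hkne : ∀ w ∈ ball (0 : ℂ) 1, k w ≠ 0 := by
    intro w hw h
    by_cases hw0 : w = 0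
    · rw [hw0, hk0] at h; exact one_ne_zero h
    · exact hf0 w hw hw0 (by rw [hfk, h, mul_zero])
  have hkD : ∀ w ∈ ball (0 : ℂ) 1, HasDerivAt k (deriv k w) w := fun w hw =>
    (hkd.differentiableAt (hB.mem_nhds hw)).hasDerivAt
  have hld : DifferentiableOn ℂ (fun w => deriv k w / k w) (ball 0 1) :=
    (hkd.deriv hB).div hkd hkne
  obtain ⟨p, hp0, hp⟩ := hld.isExactOn_ball.with_val_at 0 0
  have hpd : DifferentiableOn ℂ p (ball 0 1) := fun w hw =>
    (hp w hw).differentiableAt.differentiableWithinAt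
  have hpk : ∀ w ∈ ball (0 : ℂ) 1, k w = exp (p w) := by
    intro w hw
    have hder : ∀ u ∈ ball (0 : ℂ) 1, HasDerivAt (fun u => k u * exp (-p u)) 0 u := by
      intro u hu
      have h1 := (hkD u hu).mul (hp u hu).neg.cexp
      have h2 := hkne u hu
      have e : (0 : ℂ) = deriv k u * exp ((-p) u) + k u * (exp ((-p) u) * -(deriv k u / k u)) := by
        field_simp
        ring
      rw [e]
      exact h1
    have h1 : k w * exp (-p w) = k 0 * exp (-p 0) :=
      hB.is_const_of_deriv_eq_zero (convex_ball 0 1).isPreconnected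
        (fun u hu => (hder u hu).differentiableAt.differentiableWithinAt)
        (fun u hu => (hder u hu).deriv) hw h0B
    rw [hk0, hp0, neg_zero, exp_zero, mul_one, exp_neg] at h1
    exact (mul_inv_eq_one₀ (exp_ne_zero _)).1 h1
  have hpe : ∀ w ∈ ball (0 : ℂ) 1, w * deriv p w = φ (ω w) - 1 := by
    intro w hw
    rw [(hp w hw).deriv, ← hωe w hw]
    by_cases hw0 : w = 0
    · simp [hw0]
    · have hfw : HasDerivAt f (1 * k w + w * deriv k w) w := by
        have := (hasDerivAt_id w).mul (hkD w hw)
        have e : f = id * k := by ext u; simp [hfk u]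
        rw [e]; exact this
      simp only [hw0, if_false]
      rw [hfw.deriv, hfk w]
      have := hkne w hw
      rw [eq_sub_iff_add_eq, eq_div_iff (mul_ne_zero hw0 this)]
      field_simp
      ring
  have hfz : f z / z = exp (p z) := by
    rw [← hpk z hz, hfk z]; field_simp
  rw [hfz]
  obtain ⟨hconv, hclosed⟩ := aux_S γ hγ
  suffices h : p z ∈ {w : ℂ | w.im ∈ Icc (-(Real.pi / 2)) (Real.pi / 2) ∧ γ ≤ (exp w).re} from h.2
  by_contra hnot
  obtain ⟨l, u, hl1, hl2⟩ := geometric_hahn_banach_closed_point hconv hclosed hnot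
  set b : ℂ := ⟨l 1, -l I⟩ with hb
  have hlb : ∀ w : ℂ, l w = (b * w).re := by
    intro w
    have : w = w.re • (1 : ℂ) + w.im • I := by simp
    conv_lhs => rw [this]
    rw [map_add, map_smul, map_smul]
    simp [hb]; ring
  have hbne : b ≠ 0 := by
    intro h
    have h1 := hl1 _ (hqS 0 h0B)
    rw [hlb, h] at h1
    rw [hlb, h] at hl2
    simp at h1 hl2
    linarith
  have hstar : StarConvex ℝ (0 : ℂ) ((fun w => b * (φ w - 1)) '' ball 0 1) := by
    rw [starConvex_zero_iff]
    rintro _ ⟨w, hw, rfl⟩ a ha0 ha1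
    obtain ⟨w', hw', he⟩ := hφstar (mem_image_of_mem φ hw) (sub_nonneg.2 ha1) ha0 (by ring)
    refine ⟨w', hw', ?_⟩
    simp only [he]
    simp
    ring
  obtain ⟨ζ, hζ, hle⟩ := aux_key_s12 (fun w => b * (φ w - 1)) ω (fun w => b * p w) (fun w => b * q w)
    ((hφd.sub_const 1).const_mul b)
    (fun x hx y hy h => hφinj hx hy (by simpa [hbne] using h))
    (by simp [hφ0]) hstar hω hω0 hωm (hpd.const_mul b) (hqd.const_mul b)
    (by simp [hp0]) (by simp [hq0])
    (fun w hw => by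
      rw [((hp w hw).const_mul b).deriv, ← hpe w hw, (hp w hw).deriv]; ring)
    (fun w hw => by
      rw [((hq w hw).const_mul b).deriv, ← hqe w hw, (hq w hw).deriv]; ring) z hz
  have h1 := hl1 _ (hqS ζ hζ)
  rw [hlb] at h1 hl2
  linarith
end
end

section
/- Let −1 ≤ B < A ≤ 0 and let f ∈ 𝒜 with f(z) ≠ 0 for z ∈ 𝔻 \ {0} satisfy z f'(z)/f(z) ≺ (1 + Az)/(1 + Bz) (i.e. f ∈ 𝒮*[A,B]). Then Re(f(z)/z) ≥ (1 − B)^{(A−B)/B} > 0 for all z ∈ 𝔻 \ {0}; in particular 𝒮*[A,B] ⊂ 𝒢₀. -/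
open Complex Metric Set

noncomputable section

lemma jack_dir (φ : ℂ → ℂ) (hφ : DifferentiableOn ℂ φ (ball (0 : ℂ) 1)) (h0 : φ 0 = 0)
    (z₀ : ℂ) (hz₀ : z₀ ∈ ball (0 : ℂ) 1) (h1 : ‖φ z₀‖ = 1)
    (hle : ∀ z, ‖z‖ < ‖z₀‖ → ‖φ z‖ ≤ 1) (w : ℂ) (hw : w.re < 0) :
    ((starRingEnd ℂ) (φ z₀) * (deriv φ z₀ * (z₀ * w))).re ≤ w.re := by
  have hz0 : z₀ ≠ 0 := by
    rintro rfl
    simp [h0] at h1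
  have hr : 0 < ‖z₀‖ := norm_pos_iff.mpr hz0
  have hz₀' : ‖z₀‖ < 1 := by simpa using hz₀
  have hsch : ∀ z, ‖z‖ < ‖z₀‖ → ‖φ z‖ ≤ ‖z‖ / ‖z₀‖ := by
    intro z hz
    have := Complex.dist_le_div_mul_dist_of_mapsTo_ball (f := φ) (c := 0) (z := z) (R₁ := ‖z₀‖)
      (R₂ := 1) (hφ.mono (ball_subset_ball hz₀'.le))
      (by
        intro y hy
        simpa [h0] using hle y (by simpa using hy)) (by simpa using hz)
    simp only [h0, dist_zero_right] at this
    calc _ ≤ _ := this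
      _ = _ := by ring
  have hline : HasDerivAt (fun t : ℝ => 1 + (t : ℂ) * w) w 0 := by
    have := ((Complex.ofRealCLM.hasDerivAt (x := (0:ℝ))).mul_const w).const_add 1
    simpa using this
  have hline2 : HasDerivAt (fun t : ℝ => z₀ * (1 + (t : ℂ) * w)) (z₀ * w) 0 :=
    hline.const_mul z₀
  have hd : HasDerivAt φ (deriv φ z₀) (z₀ * (1 + ((0 : ℝ) : ℂ) * w)) := by
    have := (hφ.differentiableAt (isOpen_ball.mem_nhds hz₀)).hasDerivAt
    simpa using this
  have hcomp : HasDerivAt (fun t : ℝ => φ (z₀ * (1 + (t : ℂ) * w))) (deriv φ z₀ * (z₀ * w)) 0 :=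
    HasDerivAt.comp (0 : ℝ) hd hline2
  have hγ := hcomp.norm_sq.sub hline.norm_sq
  have hs := (hasDerivWithinAt_iff_tendsto_slope' (s := Ioi (0:ℝ)) (by simp)).1
    (hγ.hasDerivWithinAt)
  have hev : ∀ᶠ t : ℝ in nhdsWithin 0 (Ioi 0), t * ‖w‖ ^ 2 < -2 * w.re := by
    have : ContinuousAt (fun t : ℝ => t * ‖w‖ ^ 2) 0 := by fun_prop
    exact (this.eventually_lt continuousAt_const (by simp; linarith)).filter_mono
      nhdsWithin_le_nhds
  have hlim := le_of_tendsto hs (b := 0) (by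
    filter_upwards [hev, self_mem_nhdsWithin] with t ht htpos
    have htpos : 0 < t := htpos
    have hlt : ‖1 + (t : ℂ) * w‖ < 1 := by
      have : ‖1 + (t : ℂ) * w‖ ^ 2 < 1 := by
        rw [← Complex.normSq_eq_norm_sq, Complex.normSq_apply] at *
        simp
        nlinarith
      nlinarith [norm_nonneg (1 + (t : ℂ) * w)]
    have h3 := hsch (z₀ * (1 + (t : ℂ) * w)) (by
      rw [norm_mul]; nlinarith)
    rw [norm_mul, mul_div_cancel_left₀ _ hr.ne'] at h3
    have h4 : ‖φ (z₀ * (1 + (t : ℂ) * w))‖ ^ 2 ≤ ‖1 + (t : ℂ) * w‖ ^ 2 := by gcongr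
    rw [slope_def_field]
    apply div_nonpos_of_nonpos_of_nonneg _ (by linarith)
    simp [h1]
    exact h4)
  simp [Complex.inner] at hlim ⊢
  linarith

lemma jack (φ : ℂ → ℂ) (hφ : DifferentiableOn ℂ φ (ball (0 : ℂ) 1)) (h0 : φ 0 = 0)
    (z₀ : ℂ) (hz₀ : z₀ ∈ ball (0 : ℂ) 1) (h1 : ‖φ z₀‖ = 1)
    (hle : ∀ z, ‖z‖ < ‖z₀‖ → ‖φ z‖ ≤ 1) :
    ∃ k : ℝ, 1 ≤ k ∧ z₀ * deriv φ z₀ = k * φ z₀ := by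
  have key := jack_dir φ hφ h0 z₀ hz₀ h1 hle
  obtain ⟨p, hp⟩ : ∃ p, p = (starRingEnd ℂ) (φ z₀) * (z₀ * deriv φ z₀) := ⟨_, rfl⟩
  have key2 : ∀ w : ℂ, w.re < 0 → p.re * w.re - p.im * w.im ≤ w.re := by
    intro w hw
    have := key w hw
    rw [show (starRingEnd ℂ) (φ z₀) * (deriv φ z₀ * (z₀ * w)) = p * w by rw [hp]; ring] at this
    simpa using this
  have hre : 1 ≤ p.re := by
    have := key2 (-1) (by simp)
    simp at this
    linarith
  have him : p.im = 0 := by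
    by_contra hne
    have := key2 ⟨-1, -(p.re) / p.im⟩ (by simp)
    have e : p.im * (-(p.re) / p.im) = -p.re := by field_simp
    have := key2 ⟨-1, -(p.re + 1) / p.im⟩ (by simp)
    have e : p.im * (-(p.re + 1) / p.im) = -(p.re + 1) := by field_simp
    simp only [e] at this
    linarith
  refine ⟨p.re, hre, ?_⟩
  have hpr : (p.re : ℂ) = p := by
    apply Complex.ext <;> simp [him]
  have hc : φ z₀ * (starRingEnd ℂ) (φ z₀) = 1 := by
    rw [Complex.mul_conj, Complex.normSq_eq_norm_sq, h1]; simp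
  rw [hpr, hp]
  linear_combination (-(z₀ * deriv φ z₀)) * hc

/-- the Schwarz function claim -/
lemma phi_lt_one (B : ℝ) (hB : -1 ≤ B) (hB0 : B < 0) (φ ω : ℂ → ℂ)
    (hφ : DifferentiableOn ℂ φ (ball (0 : ℂ) 1)) (h0 : φ 0 = 0)
    (hω : ∀ z ∈ ball (0 : ℂ) 1, ‖ω z‖ < 1)
    (hode : ∀ z ∈ ball (0 : ℂ) 1, z * deriv φ z * (1 + B * ω z) = (1 + B * φ z) * ω z) :
    ∀ z ∈ ball (0 : ℂ) 1, ‖φ z‖ < 1 := by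
  by_contra! hcon
  obtain ⟨z₁, hz₁, hφ₁⟩ := hcon
  have hz₁' : ‖z₁‖ < 1 := by simpa using hz₁
  have hsub : closedBall (0 : ℂ) ‖z₁‖ ⊆ ball 0 1 := closedBall_subset_ball hz₁'
  have hcont : ContinuousOn φ (closedBall (0 : ℂ) ‖z₁‖) := hφ.continuousOn.mono hsub
  have hcomp : IsCompact (closedBall (0 : ℂ) ‖z₁‖ ∩ (fun z => ‖φ z‖) ⁻¹' (Ici 1)) := by
    apply (isCompact_closedBall (0 : ℂ) ‖z₁‖).of_isClosed_subset _ inter_subset_left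
    exact hcont.norm.preimage_isClosed_of_isClosed isClosed_closedBall isClosed_Ici
  obtain ⟨z₀, ⟨hz₀, hz₀1⟩, hmin⟩ := hcomp.exists_isMinOn ⟨z₁, by simp, hφ₁⟩
    (continuous_norm.continuousOn)
  have hz₀b : z₀ ∈ ball (0 : ℂ) 1 := hsub hz₀
  have hz₀1 : 1 ≤ ‖φ z₀‖ := hz₀1
  have hz₀n : ‖z₀‖ ≤ ‖z₁‖ := by simpa using hz₀
  have hlt : ∀ z, ‖z‖ < ‖z₀‖ → ‖φ z‖ < 1 := by
    intro z hz
    by_contra! h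
    have : ‖z₀‖ ≤ ‖z‖ := hmin ⟨by simp; linarith, h⟩
    linarith
  have hz0 : z₀ ≠ 0 := by
    rintro rfl
    simp [h0] at hz₀1
    linarith
  have h1 : ‖φ z₀‖ = 1 := by
    apply le_antisymm _ hz₀1
    have hc : ContinuousAt φ z₀ := hφ.continuousOn.continuousAt (isOpen_ball.mem_nhds hz₀b)
    have hmem : z₀ ∈ closure (ball (0 : ℂ) ‖z₀‖) := by
      rw [closure_ball _ (norm_ne_zero_iff.mpr hz0)]; simp
    have : (nhdsWithin z₀ (ball (0 : ℂ) ‖z₀‖)).NeBot := mem_closure_iff_nhdsWithin_neBot.1 hmem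
    refine le_of_tendsto (hc.norm.tendsto.mono_left (nhdsWithin_le_nhds (s := ball (0:ℂ) ‖z₀‖))) ?_
    filter_upwards [self_mem_nhdsWithin] with z hz
    exact (hlt z (by simpa using hz)).le
  obtain ⟨k, hk, hkk⟩ := jack φ hφ h0 z₀ hz₀b h1 (fun z hz => (hlt z hz).le)
  have ho := hode z₀ hz₀b
  rw [hkk] at ho
  have e : (k : ℂ) * φ z₀ = ω z₀ * (1 + ((((1 - k) * B : ℝ)) : ℂ) * φ z₀) := by
    push_cast
    linear_combination ho
  have hn := congrArg norm e
  rw [norm_mul, norm_mul, h1, Complex.norm_real, Real.norm_of_nonneg (by linarith)] at hn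
  have hb : ‖1 + ((((1 - k) * B : ℝ)) : ℂ) * φ z₀‖ ≤ k := by
    calc _ ≤ ‖(1:ℂ)‖ + ‖((((1 - k) * B : ℝ)) : ℂ) * φ z₀‖ := norm_add_le _ _
      _ = 1 + (1 - k) * B := by
        rw [norm_mul, h1, Complex.norm_real, Real.norm_of_nonneg (by nlinarith)]; simp
      _ ≤ k := by nlinarith
  have := hω z₀ hz₀b
  nlinarith [norm_nonneg (ω z₀)]

lemma final_ineq (b c : ℝ) (hb : 0 < b) (hb1 : b ≤ 1) (hc : 0 < c) (hc1 : c ≤ 1) (u : ℂ)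
    (hu : ‖u - 1‖ ≤ b) (hre : 0 < u.re) :
    (1 + b) ^ (-c) ≤ (Complex.exp (-c * Complex.log u)).re := by
  have hu0 : u ≠ 0 := by rintro rfl; simp at hre
  have hn : 0 < ‖u‖ := norm_pos_iff.mpr hu0
  have hsq : ‖u‖ ^ 2 ≤ (1 + b) * u.re := by
    have h1 : ‖u - 1‖ ^ 2 ≤ b ^ 2 := by gcongr
    have h2 : u.re - 1 ≤ b := by
      have := (Complex.re_le_norm (u - 1)).trans hu
      simpa using this
    rw [← Complex.normSq_eq_norm_sq, Complex.normSq_apply] at *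
    simp at h1
    nlinarith
  set θ := Complex.arg u with hθ
  have hθ2 : |θ| < Real.pi / 2 := Complex.abs_arg_lt_pi_div_two_iff.2 (Or.inl hre)
  have hθ3 := abs_lt.1 hθ2
  have hcos : u.re = ‖u‖ * Real.cos θ := (Complex.norm_mul_cos_arg u).symm
  have hcp : 0 < Real.cos θ := Real.cos_pos_of_mem_Ioo hθ3
  have hexp : (Complex.exp (-c * Complex.log u)).re = ‖u‖ ^ (-c) * Real.cos (c * θ) := by
    rw [Complex.exp_re, Real.rpow_def_of_pos hn]
    simp [Complex.log_re, Complex.log_im, hθ, mul_comm]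
  have hconc : c * Real.cos θ + (1 - c) ≤ Real.cos (c * θ) := by
    have := strictConcaveOn_cos_Icc.concaveOn.2 (x := θ) ⟨hθ3.1.le, hθ3.2.le⟩ (y := 0)
      ⟨by linarith [Real.pi_pos], by linarith [Real.pi_pos]⟩ hc.le
      (show 0 ≤ 1 - c by linarith) (by ring)
    simpa using this
  have hgm : Real.cos θ ^ c ≤ c * Real.cos θ + (1 - c) := by
    have := Real.geom_mean_le_arith_mean2_weighted hc.le (show 0 ≤ 1 - c by linarith) hcp.le
      zero_le_one (by ring)
    simpa using this
  rw [hexp]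
  have h5 : (1 + b)⁻¹ ≤ ‖u‖⁻¹ * Real.cos θ := by
    rw [hcos] at hsq
    have : ‖u‖ ≤ (1 + b) * Real.cos θ := by nlinarith
    rw [inv_mul_eq_div, inv_le_comm₀ (by positivity) (by positivity), inv_div,
      div_le_iff₀ hcp]
    exact this
  calc (1 + b) ^ (-c) = ((1 + b)⁻¹) ^ c := by
        rw [Real.rpow_neg (by positivity), Real.inv_rpow (by positivity)]
    _ ≤ (‖u‖⁻¹ * Real.cos θ) ^ c := by gcongr
    _ = ‖u‖ ^ (-c) * Real.cos θ ^ c := by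
        rw [Real.mul_rpow (by positivity) hcp.le, Real.rpow_neg (by positivity),
          Real.inv_rpow (by positivity)]
    _ ≤ _ := by
        gcongr
        linarith

/-- for -1 ≤ B < A ≤ 0 and f in the Janowski class 𝒮*[A,B], i.e.
zf'(z)/f(z) ≺ (1+Az)/(1+Bz), one has Re(f(z)/z) ≥ (1-B)^{(A-B)/B} > 0 on 𝔻 \ {0};
in particular 𝒮*[A,B] ⊂ 𝒢₀.  Here the power is a real power of 1-B > 0. -/
theorem janowski_subset_G0 (A B : ℝ) (hB : -1 ≤ B) (hBA : B < A) (hA : A ≤ 0)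
    (f : ℂ → ℂ) (hf : memA f) (hf0 : ∀ z ∈ ball (0 : ℂ) 1, z ≠ 0 → f z ≠ 0)
    (hsub : subordinate (fun z => if z = 0 then 1 else z * deriv f z / f z)
      (fun z => (1 + (A : ℂ) * z) / (1 + (B : ℂ) * z))) :
    0 < (1 - B) ^ ((A - B) / B) ∧
      ∀ z ∈ ball (0 : ℂ) 1, z ≠ 0 → (1 - B) ^ ((A - B) / B) ≤ (f z / z).re := by
  have hB0 : B < 0 := by linarith
  refine ⟨Real.rpow_pos_of_pos (by linarith) _, ?_⟩
  obtain ⟨hfd, hfz, hf1⟩ := hf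
  obtain ⟨ω, hωd, hω0, hωm, hωe⟩ := hsub
  have hω : ∀ z ∈ ball (0 : ℂ) 1, ‖ω z‖ < 1 := fun z hz => by simpa using hωm z hz
  have hrepos : ∀ w : ℂ, ‖w‖ < 1 → 0 < (1 + (B : ℂ) * w).re := by
    intro w hw
    have := (abs_le.1 (Complex.abs_re_le_norm w))
    simp
    nlinarith
  have hne : ∀ w : ℂ, ‖w‖ < 1 → 1 + (B : ℂ) * w ≠ 0 := by
    intro w hw h
    have := hrepos w hw
    simp [h] at this
  have hnhds : ball (0 : ℂ) 1 ∈ nhds (0 : ℂ) := isOpen_ball.mem_nhds (by simp)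
  have h0mem : (0 : ℂ) ∈ ball (0 : ℂ) 1 := by simp
  have hpre : IsPreconnected (ball (0 : ℂ) 1) := (convex_ball (0 : ℂ) 1).isPreconnected
  -- the logarithmic derivative of f(z)/z
  have hgd : DifferentiableOn ℂ (fun z => ((A : ℂ) - B) * dslope ω 0 z / (1 + B * ω z))
      (ball (0 : ℂ) 1) := by
    apply DifferentiableOn.div
    · exact ((Complex.differentiableOn_dslope hnhds).2 hωd).const_mul _
    · exact (hωd.const_mul _).const_add _
    · intro z hz
      exact hne _ (hω z hz)
  obtain ⟨G, hG0, hG⟩ := hgd.isExactOn_ball.with_val_at 0 0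
  have hGd : DifferentiableOn ℂ G (ball (0 : ℂ) 1) := fun z hz =>
    (hG z hz).differentiableAt.differentiableWithinAt
  have hzg : ∀ z, z * dslope ω 0 z = ω z := by
    intro z
    have := sub_smul_dslope ω 0 z
    simpa [hω0] using this
  -- f(z)/z = exp (G z)
  have hFd : DifferentiableOn ℂ (dslope f 0) (ball (0 : ℂ) 1) :=
    (Complex.differentiableOn_dslope hnhds).2 hfd
  have hFz : ∀ z, z ≠ 0 → dslope f 0 z = f z / z := by
    intro z hz
    rw [dslope_of_ne _ hz, slope_def_field]
    simp [hfz]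
  have hHd : DifferentiableOn ℂ (fun z => dslope f 0 z * Complex.exp (-G z)) (ball (0 : ℂ) 1) :=
    hFd.mul hGd.neg.cexp
  have hder : ∀ z ∈ ball (0 : ℂ) 1, z ≠ 0 →
      deriv (fun z => dslope f 0 z * Complex.exp (-G z)) z = 0 := by
    intro z hz hz0
    have hfa := (hfd.differentiableAt (isOpen_ball.mem_nhds hz)).hasDerivAt
    have hq : HasDerivAt (dslope f 0) ((deriv f z * z - f z * 1) / z ^ 2) z := by
      refine (hfa.div (hasDerivAt_id z) hz0).congr_of_eventuallyEq ?_
      filter_upwards [isOpen_ne.mem_nhds hz0] with y hy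
      simp [hFz y hy]
    have hd := hq.mul (hG z hz).neg.cexp
    have hdd : deriv (fun z => dslope f 0 z * Complex.exp (-G z)) z = _ := hd.deriv
    rw [hdd, hFz z hz0]
    have h1 := hωe z hz
    simp only [hz0, if_false] at h1
    have hf0z := hf0 z hz hz0
    have hn := hne _ (hω z hz)
    rw [div_eq_div_iff hf0z hn] at h1
    have h2 : dslope ω 0 z = ω z / z := by
      rw [← hzg z]; field_simp
    rw [h2]
    have h3 : (deriv f z * z - f z * 1) / z ^ 2 =
        f z / z * (((A : ℂ) - B) * (ω z / z) / (1 + B * ω z)) := by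
      field_simp
      linear_combination h1
    simp only [Pi.neg_apply, h3]
    ring
  have hder0 : EqOn (deriv (fun z => dslope f 0 z * Complex.exp (-G z))) 0 (ball (0 : ℂ) 1) := by
    intro z hz
    by_cases hz0 : z = 0
    · subst hz0
      have hc : ContinuousAt (deriv (fun z => dslope f 0 z * Complex.exp (-G z))) 0 :=
        ((hHd.deriv isOpen_ball).continuousOn).continuousAt hnhds
      have h1 := hc.tendsto.mono_left (nhdsWithin_le_nhds (s := {(0 : ℂ)}ᶜ))
      refine tendsto_nhds_unique_of_eventuallyEq h1 (tendsto_const_nhds (x := (0 : ℂ))) ?_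
      filter_upwards [self_mem_nhdsWithin, nhdsWithin_le_nhds hnhds] with y hy hy2
      exact hder y hy2 hy
    · exact hder z hz hz0
  have hFG : ∀ z ∈ ball (0 : ℂ) 1, dslope f 0 z = Complex.exp (G z) := by
    intro z hz
    have := isOpen_ball.is_const_of_deriv_eq_zero hpre hHd hder0 hz h0mem
    simp only [dslope_same, hf1, hG0, neg_zero, Complex.exp_zero, mul_one] at this
    rw [Complex.exp_neg] at this
    field_simp at this
    exact this
  -- the Schwarz function
  obtain ⟨c, hc⟩ : ∃ c : ℝ, c = (A - B) / (-B) := ⟨_, rfl⟩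
  have hcpos : 0 < c := by rw [hc]; apply div_pos <;> linarith
  have hc1 : c ≤ 1 := by rw [hc, div_le_one (by linarith)]; linarith
  have hcC : (c : ℂ) ≠ 0 := by exact_mod_cast hcpos.ne'
  have hBC : (B : ℂ) ≠ 0 := by exact_mod_cast hB0.ne
  have hcB : (c : ℂ) * B = -((A : ℂ) - B) := by
    have hBne : B ≠ 0 := hB0.ne
    have : c * B = -(A - B) := by rw [hc]; field_simp
    exact_mod_cast this
  have hu : ∀ z ∈ ball (0 : ℂ) 1, HasDerivAt (fun z => Complex.exp (-G z / c))
      (Complex.exp (-G z / c) * (-(((A : ℂ) - B) * dslope ω 0 z / (1 + B * ω z)) / c)) z := by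
    intro z hz
    exact ((hG z hz).neg.div_const (c : ℂ)).cexp
  obtain ⟨φ, hφ⟩ : ∃ φ : ℂ → ℂ, φ = fun z => (Complex.exp (-G z / c) - 1) / B := ⟨_, rfl⟩
  have hφu : ∀ z, 1 + (B : ℂ) * φ z = Complex.exp (-G z / c) := by
    intro z; rw [hφ]; field_simp; ring
  have hφder : ∀ z ∈ ball (0 : ℂ) 1, HasDerivAt φ
      (Complex.exp (-G z / c) * (-(((A : ℂ) - B) * dslope ω 0 z / (1 + B * ω z)) / c) / B) z := by
    intro z hz
    rw [hφ]
    exact ((hu z hz).sub_const 1).div_const _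
  have hφlt := phi_lt_one B hB hB0 φ ω
    (fun z hz => (hφder z hz).differentiableAt.differentiableWithinAt)
    (by simp [hφ, hG0]) hω (by
      intro z hz
      rw [(hφder z hz).deriv, hφu, ← hzg z]
      have hn := hne _ (hω z hz)
      rw [hzg z]
      have hAB : (A : ℂ) - B = -(c * B) := by rw [hcB]; ring
      rw [hAB]
      field_simp
      rw [hzg z])
  -- take the logarithm
  have hslit : ∀ z ∈ ball (0 : ℂ) 1, Complex.exp (-G z / c) ∈ slitPlane := by
    intro z hz
    left
    rw [← hφu]
    exact hrepos _ (hφlt z hz)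
  have hlog : EqOn (fun z => Complex.log (Complex.exp (-G z / c))) (fun z => -G z / c)
      (ball (0 : ℂ) 1) := by
    refine isOpen_ball.eqOn_of_deriv_eq hpre ?_ ?_ ?_ h0mem ?_
    · intro z hz
      exact ((hu z hz).clog (hslit z hz)).differentiableAt.differentiableWithinAt
    · exact hGd.neg.div_const _
    · intro z hz
      rw [((hu z hz).clog (hslit z hz)).deriv]
      have h2 : deriv (fun z => -G z / c) z = _ := ((hG z hz).neg.div_const (c : ℂ)).deriv
      rw [h2, mul_div_cancel_left₀ _ (Complex.exp_ne_zero _)]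
    · simp [hG0]
  intro z hz hz0
  have hfin := final_ineq (-B) c (by linarith) (by linarith) hcpos hc1 (Complex.exp (-G z / c))
    (by
      rw [← hφu, add_sub_cancel_left, norm_mul, Complex.norm_real, Real.norm_of_nonpos hB0.le]
      have := hφlt z hz
      nlinarith)
    (by rw [← hφu]; exact hrepos _ (hφlt z hz))
  have hl := hlog hz
  simp only at hl
  rw [hl, show -(c : ℂ) * (-G z / c) = G z by field_simp, ← hFG z hz, hFz z hz0] at hfin
  rw [show (A - B) / B = -c by rw [hc]; field_simp, show 1 - B = 1 + -B by ring]
  exact hfin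
end
end

section
/- Let m ∈ [0,1) and 0 ≤ k < 1 with k ≠ 1/2, and set k₀ = (2m³ − 6m² + 9m − 6 + 2√((m−1)⁴(m² − 2m + 4)))/(4m³ − 21m² + 36m − 20) and k₁ = (m² − 4m + 4)/(m² − 8m + 8). Assume k ≤ k₀ and k ≠ k₁. Let f ∈ 𝒜 satisfy Re(f(z)/z) > k for all z ∈ 𝔻 \ {0}. Then Re(z f'(z)/f(z)) > m for all z with |z| < r, where r = (2k − mk − 1 + √((k−1)(k(m−2)² − (m−2)m − 2)))/((1 − 2k)(1 − m)). -/
open Complex Metric Set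

noncomputable section

/-- Schwarz–Pick inequality, open-disk target. -/
lemma schwarzPick_aux (p : ℂ → ℂ) (hd : DifferentiableOn ℂ p (ball (0 : ℂ) 1))
    (hp : ∀ z ∈ ball (0 : ℂ) 1, ‖p z‖ < 1) (a : ℂ) (ha : a ∈ ball (0 : ℂ) 1) :
    (1 - ‖a‖ ^ 2) * ‖deriv p a‖ ≤ 1 - ‖p a‖ ^ 2 := by
  have key : ∀ b w : ℂ, ‖b‖ < 1 → ‖w‖ < 1 → ‖w - b‖ < ‖1 - (starRingEnd ℂ) b * w‖ := by
    intro b w hb hw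
    have h1 : ‖1 - (starRingEnd ℂ) b * w‖ ^ 2 - ‖w - b‖ ^ 2
        = (1 - ‖b‖ ^ 2) * (1 - ‖w‖ ^ 2) := by
      simp only [Complex.sq_norm, Complex.normSq_apply]
      simp
      ring
    have h2 : 0 < (1 - ‖b‖ ^ 2) * (1 - ‖w‖ ^ 2) := by
      apply mul_pos <;> nlinarith [norm_nonneg b, norm_nonneg w]
    exact lt_of_pow_lt_pow_left₀ 2 (norm_nonneg _) (by linarith)
  have ha1 : ‖a‖ < 1 := by simpa using ha
  have hb1 : ‖p a‖ < 1 := hp a ha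
  set b := p a with hb
  set T : ℂ → ℂ := fun ζ => (ζ + a) / (1 + (starRingEnd ℂ) a * ζ) with hT
  have hTden : ∀ ζ : ℂ, ‖ζ‖ < 1 → 1 + (starRingEnd ℂ) a * ζ ≠ 0 := by
    intro ζ hζ h0
    have := key (-a) ζ (by simpa using ha1) hζ
    simp [h0] at this
    linarith [norm_nonneg (ζ + a)]
  have hTlt : ∀ ζ : ℂ, ‖ζ‖ < 1 → T ζ ∈ ball (0 : ℂ) 1 := by
    intro ζ hζ
    have := key (-a) ζ (by simpa using ha1) hζ
    simp only [mem_ball_zero_iff, hT, norm_div]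
    rw [div_lt_one (norm_pos_iff.mpr (hTden ζ hζ))]
    simpa using this
  have hFden : ∀ w : ℂ, ‖w‖ < 1 → 1 - (starRingEnd ℂ) b * w ≠ 0 := by
    intro w hw h0
    have := key b w hb1 hw
    rw [h0, norm_zero] at this
    linarith [norm_nonneg (w - b)]
  set F : ℂ → ℂ := fun ζ => (p (T ζ) - b) / (1 - (starRingEnd ℂ) b * p (T ζ)) with hF
  have hTd : ∀ ζ : ℂ, ‖ζ‖ < 1 → DifferentiableAt ℂ T ζ := by
    intro ζ hζ
    have := hTden ζ hζ
    simp only [hT]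
    fun_prop (disch := assumption)
  have hpd : ∀ w ∈ ball (0 : ℂ) 1, DifferentiableAt ℂ p w := fun w hw =>
    hd.differentiableAt (isOpen_ball.mem_nhds hw)
  have hFd : DifferentiableOn ℂ F (ball 0 1) := by
    intro ζ hζ
    have hζ' : ‖ζ‖ < 1 := by simpa using hζ
    have h1 : DifferentiableAt ℂ (fun ζ => p (T ζ)) ζ :=
      (hpd _ (hTlt ζ hζ')).comp ζ (hTd ζ hζ')
    have h2 := hFden (p (T ζ)) (hp _ (hTlt ζ hζ'))
    exact ((h1.sub_const b).div ((h1.const_mul _).const_sub 1) h2).differentiableWithinAt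
  have hT0 : T 0 = a := by simp [hT]
  have hF0 : F 0 = 0 := by simp [hF, hT0, hb]
  have hFm : MapsTo F (ball 0 1) (closedBall (F 0) 1) := by
    intro ζ hζ
    have hζ' : ‖ζ‖ < 1 := by simpa using hζ
    rw [hF0, mem_closedBall_zero_iff]
    have h2 := hFden (p (T ζ)) (hp _ (hTlt ζ hζ'))
    simp only [hF, norm_div]
    rw [div_le_one (norm_pos_iff.mpr h2)]
    exact (key b _ hb1 (hp _ (hTlt ζ hζ'))).le
  have hD := norm_deriv_le_one_of_mapsTo_ball hFd hFm one_pos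
  have hTder : HasDerivAt T (1 - (starRingEnd ℂ) a * a) 0 := by
    have h1 : HasDerivAt (fun ζ : ℂ => ζ + a) 1 0 := (hasDerivAt_id 0).add_const a
    have h2 : HasDerivAt (fun ζ : ℂ => 1 + (starRingEnd ℂ) a * ζ) ((starRingEnd ℂ) a * 1) 0 :=
      ((hasDerivAt_id (0 : ℂ)).const_mul _).const_add 1
    have := h1.div h2 (by simp)
    refine this.congr_deriv ?_
    simp
    try ring
  have hpT : HasDerivAt (fun ζ => p (T ζ)) (deriv p a * (1 - (starRingEnd ℂ) a * a)) 0 := by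
    have h1 : HasDerivAt p (deriv p a) (T 0) := by rw [hT0]; exact (hpd a ha).hasDerivAt
    exact h1.comp 0 hTder
  have hbne : (1 - (starRingEnd ℂ) b * b) ≠ 0 := hFden b hb1
  have hFder : HasDerivAt F
      (deriv p a * (1 - (starRingEnd ℂ) a * a) / (1 - (starRingEnd ℂ) b * b)) 0 := by
    have := (hpT.sub_const b).div ((hpT.const_mul ((starRingEnd ℂ) b)).const_sub 1)
      (by rw [hT0]; exact hbne)
    refine this.congr_deriv ?_
    rw [hT0, ← hb]
    field_simp
    ring
  rw [hFder.deriv, norm_div, norm_mul] at hD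
  have hn : ∀ c : ℂ, ‖c‖ < 1 → ‖1 - (starRingEnd ℂ) c * c‖ = 1 - ‖c‖ ^ 2 := by
    intro c hc
    have : (1 - (starRingEnd ℂ) c * c) = ((1 - ‖c‖ ^ 2 : ℝ) : ℂ) := by
      rw [← Complex.normSq_eq_conj_mul_self, Complex.normSq_eq_norm_sq]; push_cast; ring
    rw [this, Complex.norm_real, Real.norm_of_nonneg]
    nlinarith [norm_nonneg c]
  rw [hn a ha1, hn b hb1, div_le_one (by nlinarith [norm_nonneg b])] at hD
  linarith

/-- Schwarz–Pick inequality, closed-disk target. -/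
lemma schwarzPick (p : ℂ → ℂ) (hd : DifferentiableOn ℂ p (ball (0 : ℂ) 1))
    (hp : ∀ z ∈ ball (0 : ℂ) 1, ‖p z‖ ≤ 1) (a : ℂ) (ha : a ∈ ball (0 : ℂ) 1) :
    (1 - ‖a‖ ^ 2) * ‖deriv p a‖ ≤ 1 - ‖p a‖ ^ 2 := by
  have hc : ∀ c ∈ Ioo (0 : ℝ) 1,
      (1 - ‖a‖ ^ 2) * (c * ‖deriv p a‖) ≤ 1 - (c * ‖p a‖) ^ 2 := by
    intro c hc
    have h := schwarzPick_aux (fun z => (c : ℂ) * p z) (hd.const_mul _) (by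
      intro z hz
      rw [norm_mul, Complex.norm_real, Real.norm_of_nonneg hc.1.le]
      nlinarith [hp z hz, hc.1, hc.2, norm_nonneg (p z)]) a ha
    rw [deriv_const_mul_field] at h
    simpa [norm_mul, Complex.norm_real, Real.norm_of_nonneg hc.1.le, abs_of_pos hc.1] using h
  have h1 : (1 : ℝ) ∈ closure (Ioo (0 : ℝ) 1) := by
    rw [closure_Ioo (by norm_num)]; simp
  have h2 := closure_minimal (s := Ioo (0 : ℝ) 1)
    (t := {c : ℝ | (1 - ‖a‖ ^ 2) * (c * ‖deriv p a‖) ≤ 1 - (c * ‖p a‖) ^ 2})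
    (fun c h => by simpa only [mem_setOf_eq] using hc c h) (isClosed_le (by fun_prop) (by fun_prop)) h1
  simpa using h2

/-- Invariant derivative estimate for Carathéodory functions. -/
lemma carath (h : ℂ → ℂ) (hd : DifferentiableOn ℂ h (ball (0 : ℂ) 1))
    (hp : ∀ z ∈ ball (0 : ℂ) 1, 0 < (h z).re) (h0 : h 0 = 1) (z : ℂ)
    (hz : z ∈ ball (0 : ℂ) 1) :
    ‖2 * z * deriv h z - (h z ^ 2 - 1)‖ * (1 - ‖z‖ ^ 2)
      ≤ ‖z‖ ^ 2 * ‖h z + 1‖ ^ 2 - ‖h z - 1‖ ^ 2 := by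
  have hne : ∀ z ∈ ball (0 : ℂ) 1, h z + 1 ≠ 0 := by
    intro z hz h1
    have := congrArg Complex.re h1
    have := hp z hz
    simp at *
    linarith
  have hdat : ∀ z ∈ ball (0 : ℂ) 1, DifferentiableAt ℂ h z := fun w hw =>
    hd.differentiableAt (isOpen_ball.mem_nhds hw)
  set w : ℂ → ℂ := fun z => (h z - 1) / (h z + 1) with hw
  have hwder : ∀ z ∈ ball (0 : ℂ) 1, HasDerivAt w (2 * deriv h z / (h z + 1) ^ 2) z := by
    intro z hz
    have h1 := (hdat z hz).hasDerivAt
    have := (h1.sub_const 1).div (h1.add_const 1) (hne z hz)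
    refine this.congr_deriv ?_
    ring
  have hwd : DifferentiableOn ℂ w (ball 0 1) := fun z hz =>
    (hwder z hz).differentiableAt.differentiableWithinAt
  have hw0 : w 0 = 0 := by simp [hw, h0]
  have hwm : MapsTo w (ball 0 1) (closedBall (w 0) 1) := by
    intro z hz
    rw [hw0, mem_closedBall_zero_iff]
    simp only [hw, norm_div]
    rw [div_le_one (norm_pos_iff.mpr (hne z hz))]
    apply le_of_sq_le_sq _ (norm_nonneg _)
    simp only [Complex.sq_norm, Complex.normSq_apply]
    simp
    nlinarith [hp z hz]
  have hφd : DifferentiableOn ℂ (dslope w 0) (ball 0 1) :=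
    (differentiableOn_dslope (ball_mem_nhds _ one_pos)).mpr hwd
  have hφ : ∀ z ∈ ball (0 : ℂ) 1, ‖dslope w 0 z‖ ≤ 1 := by
    intro z hz
    simpa using norm_dslope_le_div_of_mapsTo_ball hwd hwm hz
  have hSP := schwarzPick _ hφd hφ z hz
  have hwφ : ∀ z, z * dslope w 0 z = w z := by
    intro z
    have := sub_smul_dslope w 0 z
    simpa [hw0] using this
  have hφat := (hφd.differentiableAt (isOpen_ball.mem_nhds hz)).hasDerivAt
  have hder : 2 * deriv h z / (h z + 1) ^ 2 = dslope w 0 z + z * deriv (dslope w 0) z := by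
    have h1 : HasDerivAt w (1 * dslope w 0 z + z * deriv (dslope w 0) z) z := by
      have := (hasDerivAt_id z).mul hφat
      refine this.congr_of_eventuallyEq ?_
      exact Filter.Eventually.of_forall fun y => (hwφ y).symm
    rw [(hwder z hz).unique h1, one_mul]
  have hnz := hne z hz
  have e1 : 2 * z * deriv h z - (h z ^ 2 - 1)
      = (h z + 1) ^ 2 * (z ^ 2 * deriv (dslope w 0) z) := by
    have e2 : 2 * deriv h z = (h z + 1) ^ 2 * (dslope w 0 z + z * deriv (dslope w 0) z) := by
      rw [← hder]; field_simp
    have e3 : (h z + 1) * (z * dslope w 0 z) = h z - 1 := by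
      rw [hwφ]; simp only [hw]; field_simp
    linear_combination z * e2 + (h z + 1) * e3
  have e4 : ‖h z - 1‖ = ‖h z + 1‖ * (‖z‖ * ‖dslope w 0 z‖) := by
    rw [← norm_mul, ← norm_mul, hwφ]; simp only [hw]; congr 1; field_simp
  rw [e1, e4]
  simp only [norm_mul, norm_pow]
  have := mul_le_mul_of_nonneg_left hSP (by positivity : 0 ≤ ‖h z + 1‖ ^ 2 * ‖z‖ ^ 2)
  nlinarith [this]

/-- The real optimisation. -/
lemma real_opt (n κ β ρ U R : ℝ) (hκ : 0 ≤ κ) (hβ : 0 < β) (hρ : 0 ≤ ρ)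
    (hβρ : β * (β + 2 * ρ) = 1) (hR : 0 < R) (hU : U ≤ R)
    (hM : 0 ≤ 2 * (β + ρ + κ) * U - (1 + κ ^ 2 + 2 * (β + ρ) * κ) - R ^ 2)
    (hC : 0 ≤ β - ρ + n) (hq : 0 < n * (κ + β) - ρ * β) :
    0 < U * R ^ 2 - 2 * κ * R ^ 2 + (κ ^ 2 - 1) * U
      - R * (2 * (β + ρ + κ) * U - (1 + κ ^ 2 + 2 * (β + ρ) * κ) - R ^ 2) + 2 * n * R ^ 2 := by
  have hαU : 2 * (β + ρ + κ) * U ≤ 2 * (β + ρ + κ) * R :=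
    mul_le_mul_of_nonneg_left hU (by positivity)
  have hcoef : R ^ 2 + κ ^ 2 - 1 - 2 * (β + ρ + κ) * R ≤ 0 := by
    have : 0 ≤ (β + ρ) * κ := by positivity
    linarith
  have hL : κ + β ≤ R := by
    have h1 : (R - (β + ρ + κ)) ^ 2 ≤ ρ ^ 2 := by nlinarith
    have h2 := abs_le_of_sq_le_sq' h1 hρ
    linarith [h2.1]
  have hφ : 0 < R ^ 2 - (2 * κ + (β + ρ) - n) * R + κ * (κ + (β + ρ)) := by
    have h3 : 0 ≤ (R - (κ + β)) * (R + (κ + β) - (2 * κ + (β + ρ) - n)) :=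
      mul_nonneg (by linarith) (by linarith)
    nlinarith
  have h4 := mul_nonneg_of_nonpos_of_nonpos hcoef (by linarith : U - R ≤ 0)
  have h5 := mul_pos hR hφ
  nlinarith

/-- Consequences of `k ≤ k₀`: the range of admissible `x`. -/
lemma radius_real (m k x : ℝ) (hm0 : 0 ≤ m) (hm1 : m < 1)
    (hk0 : 0 ≤ k) (hk1 : k < 1) (hkhalf : k ≠ 1 / 2)
    (hkk0 : k ≤ (2 * m ^ 3 - 6 * m ^ 2 + 9 * m - 6 +
        2 * Real.sqrt ((m - 1) ^ 4 * (m ^ 2 - 2 * m + 4))) /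
      (4 * m ^ 3 - 21 * m ^ 2 + 36 * m - 20)) (hx0 : 0 ≤ x)
    (hx : x < (2 * k - m * k - 1 +
          Real.sqrt ((k - 1) * (k * (m - 2) ^ 2 - (m - 2) * m - 2))) /
        ((1 - 2 * k) * (1 - m))) :
    x < 1 ∧ 0 ≤ 1 + (1 - m) - 4 * x + (1 - (1 - m)) * x ^ 2 ∧
      (1 - 2 * k) * (1 - m) * x ^ 2 + 2 * (1 - k - (1 - m) * k) * x - (1 - m) < 0 := by
  obtain ⟨n, rfl⟩ : ∃ n, m = 1 - n := ⟨1 - m, by ring⟩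
  have hn0 : 0 < n := by linarith
  have hn1 : n ≤ 1 := by linarith
  have hsq : Real.sqrt ((1 - n - 1) ^ 4 * ((1 - n) ^ 2 - 2 * (1 - n) + 4))
      = n ^ 2 * Real.sqrt (n ^ 2 + 3) := by
    rw [show (1 - n - 1) ^ 4 * ((1 - n) ^ 2 - 2 * (1 - n) + 4) = (n ^ 2) ^ 2 * (n ^ 2 + 3) by ring,
      Real.sqrt_mul (by positivity), Real.sqrt_sq (by positivity)]
  rw [hsq] at hkk0
  set s := Real.sqrt (n ^ 2 + 3) with hs
  have hs2 : s ^ 2 = n ^ 2 + 3 := Real.sq_sqrt (by positivity)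
  have hs0 : 0 < s := Real.sqrt_pos.mpr (by positivity)
  have hsn : n < s := by nlinarith
  have hk : k * ((1 + n) ^ 2 * (1 + 4 * n)) ≤ 1 + 3 * n + 2 * n ^ 3 - 2 * n ^ 2 * s := by
    rw [← le_div_iff₀ (by positivity)]
    refine hkk0.trans_eq ?_
    rw [← neg_div_neg_eq]
    congr 1 <;> ring
  have hB : 0 < 1 - k - n * k := by
    by_contra hcon
    have h1 : 1 * ((1 + n) * (1 + 4 * n)) ≤ (k * (1 + n)) * ((1 + n) * (1 + 4 * n)) :=
      mul_le_mul_of_nonneg_right (by linarith) (by positivity)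
    nlinarith [mul_pos hn0 hn0, mul_pos (mul_pos hn0 hn0) (sub_pos.mpr hsn)]
  set B := 1 - k - n * k with hBd
  set y := (1 + n) / (2 + s) with hy
  have hy0 : 0 < y := by positivity
  have hys : y * (2 + s) = 1 + n := by rw [hy]; field_simp
  have hy1 : y < 1 := by rw [hy, div_lt_one (by positivity)]; linarith
  have hqy : 0 ≤ (1 - 2 * k) * n * y ^ 2 + 2 * B * y - n := by
    have h1 : 0 ≤ ((1 - 2 * k) * n * y ^ 2 + 2 * B * y - n) * (2 + s) ^ 2 := by
      have e : ((1 - 2 * k) * n * y ^ 2 + 2 * B * y - n) * (2 + s) ^ 2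
          = (1 - 2 * k) * n * (1 + n) ^ 2 + 2 * B * (1 + n) * (2 + s) - n * (2 + s) ^ 2 := by
        rw [← hys]; ring
      rw [e]
      have h2 : k * (1 + n) ^ 2 * (n + 2 + s) * (1 + 4 * n)
          ≤ (2 - n + n ^ 2 + s * (1 - n)) * (1 + 4 * n) := by
        have h3 := mul_le_mul_of_nonneg_right hk (by positivity : 0 ≤ n + 2 + s)
        have h4 : (1 + 3 * n + 2 * n ^ 3 - 2 * n ^ 2 * s) * (n + 2 + s)
            = (2 - n + n ^ 2 + s * (1 - n)) * (1 + 4 * n) := by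
          linear_combination (- 2 * n ^ 2) * hs2
        linarith
      have h5 := le_of_mul_le_mul_right h2 (by positivity)
      have e2 : (1 - 2 * k) * n * (1 + n) ^ 2 + 2 * B * (1 + n) * (2 + s) - n * (2 + s) ^ 2
          = 2 * ((2 - n + n ^ 2 + s * (1 - n)) - k * (1 + n) ^ 2 * (n + 2 + s)) := by
        rw [hBd]; linear_combination (- n) * hs2
      rw [e2]; linarith
    exact nonneg_of_mul_nonneg_left h1 (by positivity)
  -- the discriminant
  have hDeq : (k - 1) * (k * (1 - n - 2) ^ 2 - (1 - n - 2) * (1 - n) - 2)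
      = B ^ 2 + (1 - 2 * k) * n ^ 2 := by rw [hBd]; ring
  rw [hDeq] at hx
  have hDy : (n - B * y) ^ 2 ≤ (B ^ 2 + (1 - 2 * k) * n ^ 2) * y ^ 2 := by
    nlinarith [mul_nonneg hn0.le hqy]
  have hD0 : 0 ≤ B ^ 2 + (1 - 2 * k) * n ^ 2 := by
    have : 0 ≤ (B ^ 2 + (1 - 2 * k) * n ^ 2) * y ^ 2 := le_trans (sq_nonneg _) hDy
    exact nonneg_of_mul_nonneg_left this (by positivity)
  set S := Real.sqrt (B ^ 2 + (1 - 2 * k) * n ^ 2) with hS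
  have hS2 : S ^ 2 = B ^ 2 + (1 - 2 * k) * n ^ 2 := Real.sq_sqrt hD0
  have hS0 : 0 ≤ S := Real.sqrt_nonneg _
  have ha : 1 - 2 * k ≠ 0 := fun h => hkhalf (by linarith)
  have hr : (2 * k - (1 - n) * k - 1 + S) / ((1 - 2 * k) * (1 - (1 - n))) = n / (S + B) := by
    rw [div_eq_div_iff (mul_ne_zero ha (by linarith)) (by positivity)]
    rw [hBd] at hS2 ⊢
    linear_combination hS2
  rw [hr, lt_div_iff₀ (by positivity)] at hx
  have hnS : n ≤ y * (S + B) := by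
    have h1 : (n - B * y) ^ 2 ≤ (S * y) ^ 2 := by rw [mul_pow, hS2]; exact hDy
    have := (abs_le_of_sq_le_sq' h1 (by positivity)).2
    linarith
  have hxy : x < y := lt_of_mul_lt_mul_right (lt_of_lt_of_le hx hnS) (by positivity)
  refine ⟨by linarith, ?_, ?_⟩
  · have hy2 : 1 + n - 4 * y + (1 - n) * y ^ 2 = 0 := by
      have h1 : (1 + n - 4 * y + (1 - n) * y ^ 2) * (2 + s) ^ 2 = 0 := by
        have : (1 + n - 4 * y + (1 - n) * y ^ 2) * (2 + s) ^ 2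
          = (1 + n) * (2 + s) ^ 2 - 4 * (1 + n) * (2 + s) + (1 - n) * (1 + n) ^ 2 := by
          linear_combination (-4 * (2 + s) + (1 - n) * (y * (2 + s) + 1 + n)) * hys
        rw [this]
        linear_combination (1 + n) * hs2
      exact (mul_eq_zero.mp h1).resolve_right (by positivity)
    have h4 : (1 - n) * (x + y) ≤ 1 * (x + y) :=
      mul_le_mul_of_nonneg_right (by linarith) (by linarith)
    have h5 := mul_nonneg (sub_nonneg.mpr hxy.le)
      (by linarith : 0 ≤ 4 - (1 - n) * (x + y))
    have h6 : 1 + (1 - (1 - n)) - 4 * x + (1 - (1 - (1 - n))) * x ^ 2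
        = (y - x) * (4 - (1 - n) * (x + y)) := by
      linear_combination hy2
    rw [h6]; exact h5
  · have h1 : (S * x) ^ 2 < (n - B * x) ^ 2 := by
      have : 0 ≤ S * x := by positivity
      exact pow_lt_pow_left₀ (by linarith) this two_ne_zero
    rw [mul_pow, hS2] at h1
    have h2 : n * ((1 - 2 * k) * n * x ^ 2 + 2 * B * x - n) < 0 := by nlinarith
    have h3 := neg_of_mul_neg_right h2 hn0.le
    have e : (1 - (1 - n)) = n := by ring
    rw [e]; exact h3

/-- (first case of the radius theorem) if f ∈ 𝒜 with Re(f(z)/z) > k on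
𝔻 \ {0}, k ≤ k₀, k ≠ 1/2, k ≠ k₁, then Re(zf'(z)/f(z)) > m for |z| < r, where
r = (2k - mk - 1 + √((k-1)(k(m-2)² - (m-2)m - 2)))/((1-2k)(1-m)).
Here zf'(z)/f(z) denotes the analytic extension with value 1 at z = 0. -/
theorem radius_first_case (m k : ℝ) (hm0 : 0 ≤ m) (hm1 : m < 1)
    (hk0 : 0 ≤ k) (hk1 : k < 1) (hkhalf : k ≠ 1 / 2)
    (hkk0 : k ≤ (2 * m ^ 3 - 6 * m ^ 2 + 9 * m - 6 +
        2 * Real.sqrt ((m - 1) ^ 4 * (m ^ 2 - 2 * m + 4))) /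
      (4 * m ^ 3 - 21 * m ^ 2 + 36 * m - 20))
    (hkk1 : k ≠ (m ^ 2 - 4 * m + 4) / (m ^ 2 - 8 * m + 8))
    (f : ℂ → ℂ) (hf : memA f)
    (hre : ∀ z ∈ ball (0 : ℂ) 1, z ≠ 0 → k < (f z / z).re) :
    ∀ z : ℂ,
      ‖z‖ < (2 * k - m * k - 1 +
          Real.sqrt ((k - 1) * (k * (m - 2) ^ 2 - (m - 2) * m - 2))) /
        ((1 - 2 * k) * (1 - m)) →
      m < (if z = 0 then (1 : ℂ) else z * deriv f z / f z).re := by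
  obtain ⟨hfd, hf0, hf1⟩ := hf
  intro z hz
  by_cases hz0 : z = 0
  · simpa [hz0] using hm1
  rw [if_neg hz0]
  obtain ⟨hx1, hC, hq⟩ := radius_real m k ‖z‖ hm0 hm1 hk0 hk1 hkhalf hkk0 (norm_nonneg z) hz
  have hzb : z ∈ ball (0 : ℂ) 1 := by simpa using hx1
  have hk1' : 0 < 1 - k := by linarith
  have hkc : (1 - k : ℂ) ≠ 0 := by
    have : ((1 - k : ℝ) : ℂ) ≠ 0 := by exact_mod_cast hk1'.ne'
    simpa using this
  have hgd : DifferentiableOn ℂ (dslope f 0) (ball 0 1) :=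
    (differentiableOn_dslope (ball_mem_nhds _ one_pos)).mpr hfd
  have hgf : ∀ y, y * dslope f 0 y = f y := by
    intro y
    have := sub_smul_dslope f 0 y
    simpa [hf0] using this
  have hgre : ∀ y ∈ ball (0 : ℂ) 1, k < (dslope f 0 y).re := by
    intro y hy
    by_cases hy0 : y = 0
    · rw [hy0, dslope_same, hf1]; simpa using hk1
    · have := hre y hy hy0
      rwa [← hgf y, mul_div_cancel_left₀ _ hy0] at this
  set h : ℂ → ℂ := fun y => (dslope f 0 y - k) / (1 - k) with hh
  have hhd : DifferentiableOn ℂ h (ball 0 1) := (hgd.sub_const _).div_const _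
  have hh0 : h 0 = 1 := by simp only [hh, dslope_same, hf1]; exact div_self hkc
  have hhp : ∀ y ∈ ball (0 : ℂ) 1, 0 < (h y).re := by
    intro y hy
    have e : h y = (dslope f 0 y - k) / ((1 - k : ℝ) : ℂ) := by simp [hh]
    rw [e, Complex.div_ofReal_re]
    apply div_pos _ hk1'
    simpa using hgre y hy
  have hcar := carath h hhd hhp hh0 z hzb
  have hgh : dslope f 0 = fun y => (k : ℂ) + (1 - k) * h y := by
    funext y
    simp only [hh]; field_simp; ring
  have hhat := (hhd.differentiableAt (isOpen_ball.mem_nhds hzb)).hasDerivAt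
  have hfder : deriv f z = dslope f 0 z + z * ((1 - k) * deriv h z) := by
    have h1 : HasDerivAt (dslope f 0) ((1 - k) * deriv h z) z := by
      rw [hgh]; exact (hhat.const_mul _).const_add _
    have h2 : HasDerivAt f (1 * dslope f 0 z + z * ((1 - k) * deriv h z)) z := by
      refine ((hasDerivAt_id z).mul h1).congr_of_eventuallyEq ?_
      exact Filter.Eventually.of_forall fun y => (hgf y).symm
    rw [h2.deriv, one_mul]
  set κ : ℝ := k / (1 - k) with hκd
  have hκ0 : 0 ≤ κ := by positivity
  have hκc : (κ : ℂ) * (1 - k) = k := by rw [hκd]; push_cast; field_simp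
  have hup := hhp z hzb
  set P := z * deriv h z with hP
  set H := h z + κ with hH
  have hHre : 0 < H.re := by simp [hH]; linarith
  have hH0 : H ≠ 0 := by intro h0; simp [h0] at hHre
  have hgH : dslope f 0 z = (1 - k) * H := by
    rw [hgh, hH]; linear_combination -hκc
  have hquot : z * deriv f z / f z = 1 + P / H := by
    rw [hfder, ← hgf z, hgH, hP]
    field_simp
  rw [hquot]
  set x := ‖z‖ with hx
  have hx0 : 0 ≤ x := norm_nonneg z
  set R := ‖H‖ with hR
  have hR0 : 0 < R := norm_pos_iff.mpr hH0
  have hR2 : R ^ 2 = ((h z).re + κ) ^ 2 + (h z).im ^ 2 := by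
    rw [hR, Complex.sq_norm, Complex.normSq_apply]; simp [hH]; ring
  have hUR : H.re ≤ R := Complex.re_le_norm H
  have hxx : 0 < 1 - x ^ 2 := by nlinarith
  set β := (1 - x) / (1 + x) with hβ
  set ρ := 2 * x / (1 - x ^ 2) with hρ
  have h1x : (1 - x) ≠ 0 := by linarith
  have h1x' : (1 + x) ≠ 0 := by positivity
  have hρ' : ρ = 2 * x / ((1 - x) * (1 + x)) := by rw [hρ]; congr 1; ring
  have hβ0 : 0 < β := div_pos (by linarith) (by positivity)
  have hρ0 : 0 ≤ ρ := div_nonneg (by positivity) hxx.le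
  have hβρ : β * (β + 2 * ρ) = 1 := by
    rw [hρ', hβ]; field_simp; ring
  have hα : (β + ρ) * (1 - x ^ 2) = 1 + x ^ 2 := by
    rw [hρ', hβ]; field_simp; ring
  have hU : H.re = (h z).re + κ := by simp [hH]
  have hM2 : x ^ 2 * ‖h z + 1‖ ^ 2 - ‖h z - 1‖ ^ 2
      = (2 * (β + ρ + κ) * H.re - (1 + κ ^ 2 + 2 * (β + ρ) * κ) - R ^ 2) * (1 - x ^ 2) := by
    rw [hR2, hU]
    simp only [Complex.sq_norm, Complex.normSq_apply]
    simp
    linear_combination (-2 * (h z).re) * hα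
  set M := 2 * (β + ρ + κ) * H.re - (1 + κ ^ 2 + 2 * (β + ρ) * κ) - R ^ 2 with hM
  rw [hM2] at hcar
  have hcar2 : ‖2 * z * deriv h z - (h z ^ 2 - 1)‖ ≤ M := le_of_mul_le_mul_right hcar hxx
  have hM0 : 0 ≤ M := le_trans (norm_nonneg _) hcar2
  have hCC : 0 ≤ β - ρ + (1 - m) := by
    have e : β - ρ + (1 - m)
        = (1 + (1 - m) - 4 * x + (1 - (1 - m)) * x ^ 2) / (1 - x ^ 2) := by
      rw [eq_div_iff hxx.ne', hρ', hβ]; field_simp; ring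
    rw [e]; exact div_nonneg hC hxx.le
  have hqq : 0 < (1 - m) * (κ + β) - ρ * β := by
    have e : (1 - m) * (κ + β) - ρ * β
        = -((1 - 2 * k) * (1 - m) * x ^ 2 + 2 * (1 - k - (1 - m) * k) * x - (1 - m))
          / ((1 - k) * (1 + x) ^ 2) := by
      rw [hρ', hβ, hκd]; field_simp; ring
    rw [e]; exact div_pos (by linarith) (by positivity)
  have hopt := real_opt (1 - m) κ β ρ H.re R hκ0 hβ0 hρ0 hβρ hR0 hUR hM0 hCC hqq
  rw [← hM] at hopt
  set e := 2 * z * deriv h z - (h z ^ 2 - 1) with he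
  have hPe : 2 * P = (h z ^ 2 - 1) + e := by rw [he, hP]; ring
  have hre1 : 2 * (P / H).re * R ^ 2
      = ((h z ^ 2 - 1) * (starRingEnd ℂ) H).re + (e * (starRingEnd ℂ) H).re := by
    have h1 : 2 * P * (starRingEnd ℂ) H = 2 * (P / H) * ((R ^ 2 : ℝ) : ℂ) := by
      have : (((R ^ 2 : ℝ)) : ℂ) = H * (starRingEnd ℂ) H := by
        rw [Complex.mul_conj, Complex.normSq_eq_norm_sq]
      rw [this]; field_simp
    have h2 := congrArg Complex.re h1
    rw [hPe, add_mul, Complex.add_re, Complex.re_mul_ofReal] at h2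
    rw [h2]; simp
  have hre2 : -(M * R) ≤ (e * (starRingEnd ℂ) H).re := by
    have h1 := (abs_le.mp (Complex.abs_re_le_norm (e * (starRingEnd ℂ) H))).1
    rw [norm_mul, Complex.norm_conj] at h1
    have := mul_le_mul_of_nonneg_right hcar2 hR0.le
    linarith
  have hre3 : ((h z ^ 2 - 1) * (starRingEnd ℂ) H).re
      = H.re * R ^ 2 - 2 * κ * R ^ 2 + (κ ^ 2 - 1) * H.re := by
    rw [hR2, hU]
    simp [hH, pow_two]
    ring
  have hfin : 0 < (2 * (P / H).re + 2 * (1 - m)) * R ^ 2 := by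
    rw [add_mul, hre1, hre3]; linarith
  have := pos_of_mul_pos_left hfin (by positivity)
  simp
  linarith
end
end

section
/- Let m ∈ [0,1) and set k₁ = (m² − 4m + 4)/(m² − 8m + 8). Let f ∈ 𝒜 satisfy Re(f(z)/z) > k₁ for all z ∈ 𝔻 \ {0}. Then Re(z f'(z)/f(z)) > m for all z with |z| < r, where r = √((1 − m)/(2 − m)). -/
open Complex Metric Set

noncomputable section

lemma cert_disc (R : ℝ) (h1 : 1/6 ≤ R) (h2 : R ≤ 3/8) :
    0 ≤ -2 + 15 * R - 317 * R^3 + 48 * R^2 + 376 * R^4 - 136 * R^5 + 96 * R^6 - 80 * R^7 := by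
  obtain ⟨X, hX⟩ : ∃ X, X = 6 * R - 1 := ⟨_, rfl⟩
  obtain ⟨Y, hY⟩ : ∃ Y, Y = 3 - 8 * R := ⟨_, rfl⟩
  have hX0 : 0 ≤ X := by linarith
  have hY0 : 0 ≤ Y := by linarith
  have h : 0 ≤ 448 * Y^7 + 6336 * X^1 * Y^6 + 31088 * X^2 * Y^5 + 74000 * X^3 * Y^4
    + 94015 * X^4 * Y^3 + 62799 * X^5 * Y^2 + 18993 * X^6 * Y^1 + 1409 * X^7 := by positivity
  rw [hX, hY] at h
  linarith [h]

lemma cert_K (R : ℝ) (h1 : 3/8 ≤ R) (h2 : R ≤ 1/2) :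
    0 ≤ -1 - 3 * R + 8 * R^2 + 28 * R^3 - 32 * R^5 := by
  obtain ⟨X, hX⟩ : ∃ X, X = 8 * R - 3 := ⟨_, rfl⟩
  obtain ⟨Y, hY⟩ : ∃ Y, Y = 1 - 2 * R := ⟨_, rfl⟩
  have hX0 : 0 ≤ X := by linarith
  have hY0 : 0 ≤ Y := by linarith
  have h : 0 ≤ 490 * Y^5 + 1358 * X^1 * Y^4 + 1097 * X^2 * Y^3 + 389 * X^3 * Y^2 + 64 * X^4 * Y^1
    + 4 * X^5 := by positivity
  rw [hX, hY] at h
  linarith [h]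

lemma cert_sl (r : ℝ) (h1 : 0 ≤ r) (h2 : r ≤ 41/100) :
    0 ≤ 1 - 3 * r + 2 * r^2 - 6 * r^3 + 13 * r^4 + 25 * r^5 - 20 * r^6 - 4 * r^7 + 4 * r^8
      - 12 * r^9 := by
  obtain ⟨Y, hY⟩ : ∃ Y, Y = 41 - 100 * r := ⟨_, rfl⟩
  have hY0 : 0 ≤ Y := by linarith
  have h : 0 ≤ Y^9 + 777 * r^1 * Y^8 + 264962 * r^2 * Y^7 + 51499874 * r^3 * Y^6
    + 6206639293 * r^4 * Y^5 + 475904951525 * r^5 * Y^4 + 23353529225180 * r^6 * Y^3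
    + 753584588958476 * r^7 * Y^2 + 17301580337211684 * r^8 * Y^1
    + 246136563603680868 * r^9 := by positivity
  rw [hY] at h
  linarith [h]

/-- value on the real axis -/
lemma real_axis (R N c s x : ℝ) (hN : N = 1 + 4*R - 4*R^2) (hN0 : N ≠ 0)
    (hc : c = (1-2*R)^2 / N) (hR : 1 - R ≠ 0) (hx : x * (s - c) = s - 1) (hsc : s - c ≠ 0) :
    (s^2-c)*(s^2*(1-x^2) - (1-c^2*x^2) - 2*(1-c)*((R - x^2)/(1-R))*s)
      + 2*(R/(1-R))*(1-c)*(1-c*x^2)*s^2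
    = s*(1-c*x^2)*((1-2*R)*(s-c)+(3-2*R)*(s-1))^2/(4*(1-R)^2) := by
  have hx' : x = (s-1)/(s-c) := by field_simp; exact hx
  have hc1 : c * N = (1-2*R)^2 := by rw [hc]; field_simp
  have h1 : (s^2-c)*(s^2*(1-x^2) - (1-c^2*x^2) - 2*(1-c)*((R - x^2)/(1-R))*s)
      + 2*(R/(1-R))*(1-c)*(1-c*x^2)*s^2
      = 2*s*(1-c*x^2)*((s-1)*(s-c) - (R*(s-c)^2-(s-1)^2)/(1-R) + R/(1-R)*s*(1-c)) := by
    rw [hx']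
    field_simp
    ring
  have h2 : 8*(1-R)*((1-R)*(s-1)*(s-c) - R*(s-c)^2+(s-1)^2 + R*s*(1-c))
      = ((1-2*R)*(s-c)+(3-2*R)*(s-1))^2 := by
    rw [hN] at hc1
    linear_combination (1-c)*hc1
  rw [h1, ← h2]
  field_simp
  ring

set_option maxHeartbeats 2000000 in
lemma Qpos (R r N c s : ℝ) (hR0 : 0 < R) (hR : R ≤ 1/2) (hr : 0 ≤ r) (hr2 : r^2 = R)
    (hN : N = 1 + 4*R - 4*R^2)
    (hc : c = (1-2*R)^2 / N) (hs0 : 0 < s) (hs : 1 + c*r ≤ s*(1+r)) :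
    0 ≤ (s^2-c)*(s^2*(1-R) - (1-c^2*R)) + 2*(R/(1-R))*(1-c)*(1-c*R)*s^2 := by
  have hNpos : 0 < N := by nlinarith
  have h1R : 0 < 1 - R := by linarith
  have hc0 : 0 ≤ c := by rw [hc]; positivity
  have hc2 : 1 - c = 8*R*(1-R)/N := by
    rw [hc, eq_div_iff hNpos.ne', sub_mul, div_mul_cancel₀ _ hNpos.ne', hN]; ring
  have hc1 : c < 1 := by
    have : 0 < 8*R*(1-R)/N := by positivity
    linarith
  obtain ⟨K, hK⟩ : ∃ K, K = -c*(1-R) - (1-c^2*R) + 2*(R/(1-R))*(1-c)*(1-c*R) := ⟨_, rfl⟩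
  have hKN : K * N^2 = 2*(-1 - 3 * R + 8 * R^2 + 28 * R^3 - 32 * R^5) := by
    rw [hK, hc2, hc]
    field_simp
    rw [hN]; ring
  have hQ : (s^2-c)*(s^2*(1-R) - (1-c^2*R)) + 2*(R/(1-R))*(1-c)*(1-c*R)*s^2
      = (1-R)*(s^2)^2 + K*s^2 + c*(1-c^2*R) := by rw [hK]; ring
  have hcR : 0 ≤ 1 - c^2*R := by nlinarith
  rw [hQ]
  rcases le_total (3/8) R with h38 | h38
  · have : 0 ≤ K := by
      have := cert_K R h38 hR
      by_contra hneg
      push Not at hneg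
      nlinarith [mul_pos (neg_pos.2 hneg) (pow_pos hNpos 2)]
    positivity
  rcases le_total (1/6) R with h16 | h16
  · have hd : K^2 ≤ 4*(1-R)*(c*(1-c^2*R)) := by
      have hd1 : (4*(1-R)*(c*(1-c^2*R)) - K^2)*N^4 = 64*R^3*(-2 + 15 * R - 317 * R^3 + 48 * R^2 + 376 * R^4 - 136 * R^5 + 96 * R^6 - 80 * R^7) := by
        have : (4*(1-R)*(c*(1-c^2*R)) - K^2)*N^4 = 4*(1-R)*((c*N)*(N^2-(c*N)^2*R))*N - (K*N^2)^2 := by ring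
        rw [this, hKN, hc, div_mul_cancel₀ _ hNpos.ne', hN]; ring
      have hd2 := cert_disc R h16 h38
      have hd3 : 0 ≤ (4*(1-R)*(c*(1-c^2*R)) - K^2)*N^4 := by rw [hd1]; positivity
      have := nonneg_of_mul_nonneg_left hd3 (by positivity)
      linarith
    have h4 : 0 ≤ (4*(1-R)) * ((1-R)*(s^2)^2 + K*s^2 + c*(1-c^2*R)) := by
      nlinarith [sq_nonneg (2*(1-R)*s^2 + K)]
    exact nonneg_of_mul_nonneg_right h4 (by positivity)
  · have hr41 : r ≤ 41/100 := by
      by_contra h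
      push Not at h
      nlinarith
    obtain ⟨s0, hs0d⟩ : ∃ s0, s0 = (1+c*r)/(1+r) := ⟨_, rfl⟩
    have h1r : 0 < 1 + r := by linarith
    have hs0e : s0*(1+r) = 1+c*r := by rw [hs0d]; field_simp
    have hs0p : 0 < s0 := by rw [hs0d]; positivity
    have hs0s : s0 ≤ s := by rw [hs0d, div_le_iff₀ h1r]; exact hs
    have hs0c : s0 - c ≠ 0 := by
      intro h
      have : s0 = c := by linarith
      rw [this] at hs0e; linarith
    have hax := real_axis R N c s0 (-r) hN hNpos.ne' hc h1R.ne' (by linarith) hs0c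
    have hr2' : (-r)^2 = R := by rw [← hr2]; ring
    rw [hr2', sub_self, zero_div, mul_zero, zero_mul, sub_zero] at hax
    have hQ0 : 0 ≤ (1-R)*(s0^2)^2 + K*s0^2 + c*(1-c^2*R) := by
      have : (1-R)*(s0^2)^2 + K*s0^2 + c*(1-c^2*R) = (s0^2-c)*(s0^2*(1-R) - (1-c^2*R)) + 2*(R/(1-R))*(1-c)*(1-c*R)*s0^2 := by rw [hK]; ring
      rw [this, hax]
      have : 0 ≤ 1 - c*R := by nlinarith
      positivity
    have hsl : 0 ≤ 2*(1-R)*s0^2 + K := by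
      have e1 : (2*(1-R)*s0^2 + K)*(N^2*(1+r)) = 8*r^2*(1 - 3 * r + 2 * r^2 - 6 * r^3 + 13 * r^4 + 25 * r^5 - 20 * r^6 - 4 * r^7 + 4 * r^8 - 12 * r^9) := by
        have : (2*(1-R)*s0^2 + K)*(N^2*(1+r)) = 2*(1-r)*(N*(s0*(1+r)))^2 + (1+r)*(K*N^2) := by
          rw [← hr2]; ring
        rw [this, hs0e, hKN, mul_add, mul_one, ← mul_assoc, mul_comm N c, hc, div_mul_cancel₀ _ hNpos.ne', hN, ← hr2]; ring
      have e2 := cert_sl r hr hr41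
      have e3 : 0 ≤ (2*(1-R)*s0^2 + K)*(N^2*(1+r)) := by rw [e1]; positivity
      exact nonneg_of_mul_nonneg_left e3 (by positivity)
    have hss : s0^2 ≤ s^2 := by gcongr
    have e4 : (1-R)*(s^2)^2 + K*s^2 + c*(1-c^2*R) = ((1-R)*(s0^2)^2 + K*s0^2 + c*(1-c^2*R))
        + (s^2-s0^2)*(2*(1-R)*s0^2 + K) + (1-R)*(s^2-s0^2)^2 := by ring
    have e5 := mul_nonneg (sub_nonneg.2 hss) hsl
    have e6 := mul_nonneg h1R.le (sq_nonneg (s^2 - s0^2))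
    linarith

/-- key inequality -/
lemma Ppos (R N c s t : ℝ) (hR0 : 0 < R) (hR : R ≤ 1/2) (hN : N = 1 + 4*R - 4*R^2)
    (hc : c = (1-2*R)^2 / N) (hs0 : 0 < s) (hsc : c < s^2)
    (ht : (s-1)^2 ≤ t * (s-c)^2) (htR : t ≤ R) :
    0 ≤ (s^2-c)*(s^2*(1-t) - (1-c^2*t) - 2*(1-c)*((R - t)/(1-R))*s)
      + 2*(R/(1-R))*(1-c)*(1-c*t)*s^2 := by
  have hNpos : 0 < N := by nlinarith
  have h1R : 0 < 1 - R := by linarith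
  have hc0 : 0 ≤ c := by rw [hc]; positivity
  have hc2 : 1 - c = 8*R*(1-R)/N := by
    rw [hc, eq_div_iff hNpos.ne', sub_mul, div_mul_cancel₀ _ hNpos.ne', hN]; ring
  have hc1 : c < 1 := by
    have : 0 < 8*R*(1-R)/N := by positivity
    linarith
  have hscp : 0 < s - c := by
    by_contra h
    push Not at h
    nlinarith
  obtain ⟨x, hx⟩ : ∃ x, x = (s-1)/(s-c) := ⟨_, rfl⟩
  have hxe : x*(s-c) = s-1 := by rw [hx]; field_simp
  have hxt : x^2 ≤ t := by
    rw [hx, div_pow, div_le_iff₀ (by positivity)]; exact ht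
  have hax := real_axis R N c s x hN hNpos.ne' hc h1R.ne' hxe hscp.ne'
  have h0 : 0 ≤ s*(1-c*x^2)*((1-2*R)*(s-c)+(3-2*R)*(s-1))^2/(4*(1-R)^2) := by
    have : 0 ≤ 1 - c*x^2 := by nlinarith [sq_nonneg x]
    positivity
  rw [← hax] at h0
  have hrr : Real.sqrt R ^ 2 = R := Real.sq_sqrt hR0.le
  have hxr : -Real.sqrt R ≤ x := by
    have := Real.abs_le_sqrt (hxt.trans htR)
    exact (abs_le.1 this).1
  have h1 := Qpos R (Real.sqrt R) N c s hR0 hR (Real.sqrt_nonneg _) hrr hN hc hs0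
    (by nlinarith [mul_le_mul_of_nonneg_right hxr hscp.le])
  obtain ⟨B, hB⟩ : ∃ B, B = (s^2-c)*(-s^2 + c^2 + 2*(1-c)*(1/(1-R))*s)
      - 2*(R/(1-R))*(1-c)*c*s^2 := ⟨_, rfl⟩
  have e0 : (s^2-c)*(s^2*(1-t) - (1-c^2*t) - 2*(1-c)*((R - t)/(1-R))*s)
      + 2*(R/(1-R))*(1-c)*(1-c*t)*s^2 = (s^2-c)*(s^2*(1-x^2) - (1-c^2*x^2) - 2*(1-c)*((R - x^2)/(1-R))*s)
      + 2*(R/(1-R))*(1-c)*(1-c*x^2)*s^2 + (t - x^2)*B := by rw [hB]; ring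
  have e1 : (s^2-c)*(s^2*(1-t) - (1-c^2*t) - 2*(1-c)*((R - t)/(1-R))*s)
      + 2*(R/(1-R))*(1-c)*(1-c*t)*s^2 = (s^2-c)*(s^2*(1-R) - (1-c^2*R)) + 2*(R/(1-R))*(1-c)*(1-c*R)*s^2 + (R-t)*(-B) := by rw [hB]; ring
  rcases le_total 0 B with h | h
  · rw [e0]
    have := mul_nonneg (sub_nonneg.2 hxt) h
    linarith
  · rw [e1]
    have := mul_nonneg (sub_nonneg.2 htR) (neg_nonneg.2 h)
    linarith

/-- disc automorphism -/
lemma mob_lt (b ζ : ℂ) (hb : ‖b‖ < 1) (hζ : ‖ζ‖ < 1) :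
    1 - (starRingEnd ℂ) b * ζ ≠ 0 ∧ ‖(ζ - b) / (1 - (starRingEnd ℂ) b * ζ)‖ < 1 := by
  have hid : ‖1 - (starRingEnd ℂ) b * ζ‖^2 - ‖ζ - b‖^2 = (1-‖b‖^2)*(1-‖ζ‖^2) := by
    simp only [← Complex.normSq_eq_norm_sq, Complex.normSq_apply]
    simp
    ring
  have hpos : 0 < (1-‖b‖^2)*(1-‖ζ‖^2) := by
    apply mul_pos <;> nlinarith [norm_nonneg b, norm_nonneg ζ]
  have hlt : ‖ζ - b‖ < ‖1 - (starRingEnd ℂ) b * ζ‖ := by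
    apply lt_of_pow_lt_pow_left₀ 2 (norm_nonneg _)
    linarith
  have hp : 0 < ‖1 - (starRingEnd ℂ) b * ζ‖ := lt_of_le_of_lt (norm_nonneg _) hlt
  refine ⟨norm_pos_iff.1 hp, ?_⟩
  rw [norm_div, div_lt_one hp]
  exact hlt

lemma mob_deriv (b ζ : ℂ) (h : 1 - (starRingEnd ℂ) b * ζ ≠ 0) :
    HasDerivAt (fun ζ : ℂ => (ζ - b) / (1 - (starRingEnd ℂ) b * ζ))
      ((1 - (starRingEnd ℂ) b * b) / (1 - (starRingEnd ℂ) b * ζ)^2) ζ := by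
  have h1 : HasDerivAt (fun ζ : ℂ => ζ - b) 1 ζ := (hasDerivAt_id ζ).sub_const b
  have h2 : HasDerivAt (fun ζ : ℂ => 1 - (starRingEnd ℂ) b * ζ) (-((starRingEnd ℂ) b * 1)) ζ :=
    ((hasDerivAt_id ζ).const_mul _).const_sub 1
  exact (h1.div h2 h).congr_deriv (by ring)

lemma schwarz_pick (g : ℂ → ℂ) (hg : DifferentiableOn ℂ g (ball 0 1))
    (hm : ∀ z ∈ ball (0:ℂ) 1, ‖g z‖ < 1) (z : ℂ) (hz : ‖z‖ < 1) :
    ‖deriv g z‖ * (1 - ‖z‖^2) ≤ 1 - ‖g z‖^2 := by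
  have hzb : z ∈ ball (0:ℂ) 1 := by simpa using hz
  obtain ⟨φ, hφ⟩ : ∃ φ : ℂ → ℂ, φ = fun ζ => (ζ - (-z)) / (1 - (starRingEnd ℂ) (-z) * ζ) := ⟨_, rfl⟩
  obtain ⟨ψ, hψ⟩ : ∃ ψ : ℂ → ℂ, ψ = fun ζ => (ζ - g z) / (1 - (starRingEnd ℂ) (g z) * ζ) := ⟨_, rfl⟩
  have hnz : ‖-z‖ < 1 := by simpa using hz
  have hgz := hm z hzb
  have hφ0 : φ 0 = z := by simp [hφ]
  have hψ0 : ψ (g z) = 0 := by simp [hψ]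
  have hφm : ∀ ζ ∈ ball (0:ℂ) 1, φ ζ ∈ ball (0:ℂ) 1 := by
    intro ζ hζ
    have := (mob_lt (-z) ζ hnz (by simpa using hζ)).2
    simpa [hφ] using this
  have hφd : ∀ ζ ∈ ball (0:ℂ) 1, HasDerivAt φ ((1 - (starRingEnd ℂ) (-z) * (-z)) / (1 - (starRingEnd ℂ) (-z) * ζ)^2) ζ := by
    intro ζ hζ
    rw [hφ]
    exact mob_deriv _ _ (mob_lt (-z) ζ hnz (by simpa using hζ)).1
  have hψd : ∀ ζ ∈ ball (0:ℂ) 1, HasDerivAt ψ ((1 - (starRingEnd ℂ) (g z) * (g z)) / (1 - (starRingEnd ℂ) (g z) * ζ)^2) ζ := by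
    intro ζ hζ
    rw [hψ]
    exact mob_deriv _ _ (mob_lt (g z) ζ hgz (by simpa using hζ)).1
  have hgd : ∀ ζ ∈ ball (0:ℂ) 1, HasDerivAt g (deriv g ζ) ζ := fun ζ hζ =>
    (hg.differentiableAt (isOpen_ball.mem_nhds hζ)).hasDerivAt
  have hgm : ∀ ζ ∈ ball (0:ℂ) 1, g ζ ∈ ball (0:ℂ) 1 := fun ζ hζ => by simpa using hm ζ hζ
  have hd : ∀ ζ ∈ ball (0:ℂ) 1, HasDerivAt (fun ζ => ψ (g (φ ζ))) _ ζ := fun ζ hζ =>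
    (hψd _ (hgm _ (hφm ζ hζ))).comp ζ ((hgd _ (hφm ζ hζ)).comp ζ (hφd ζ hζ))
  have h0 : (0:ℂ) ∈ ball (0:ℂ) 1 := by simp
  have hle := Complex.norm_deriv_le_one_of_mapsTo_ball (f := fun ζ => ψ (g (φ ζ))) (c := 0) (R := 1)
    (fun ζ hζ => (hd ζ hζ).differentiableAt.differentiableWithinAt)
    (by
      intro ζ hζ
      simp only [hφ0, hψ0]
      have := (mob_lt (g z) (g (φ ζ)) hgz (hm _ (hφm ζ hζ))).2
      rw [mem_closedBall_zero_iff]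
      simp only [hψ]
      exact this.le) one_pos
  rw [(hd 0 h0).deriv, hφ0] at hle
  have e1 : (1 - (starRingEnd ℂ) (-z) * (-z)) = ((1 - ‖z‖^2 : ℝ) : ℂ) := by
    have := Complex.conj_mul' z
    push_cast
    rw [← this]; simp
  have e2 : (1 - (starRingEnd ℂ) (g z) * (g z)) = ((1 - ‖g z‖^2 : ℝ) : ℂ) := by
    have := Complex.conj_mul' (g z)
    push_cast
    rw [← this]
  have p1 : 0 < 1 - ‖z‖^2 := by nlinarith [norm_nonneg z]
  have p2 : 0 < 1 - ‖g z‖^2 := by nlinarith [norm_nonneg (g z)]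
  rw [e1, e2, norm_mul, norm_mul, norm_div, norm_div, norm_pow, Complex.norm_real, Complex.norm_real,
    Real.norm_of_nonneg p1.le, Real.norm_of_nonneg p2.le] at hle
  simp only [mul_zero, sub_zero, norm_one, one_pow, div_one] at hle
  have e3 : (1 - ‖g z‖^2) / (1 - ‖g z‖^2)^2 = 1 / (1 - ‖g z‖^2) := by field_simp
  rw [e3, one_div, inv_mul_le_iff₀ p2] at hle
  linarith

lemma schwarz_pick' (g : ℂ → ℂ) (hg : DifferentiableOn ℂ g (ball 0 1))
    (hm : ∀ z ∈ ball (0:ℂ) 1, ‖g z‖ ≤ 1) (z : ℂ) (hz : ‖z‖ < 1) :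
    ‖deriv g z‖ * (1 - ‖z‖^2) ≤ 1 - ‖g z‖^2 := by
  have key : ∀ l ∈ Ioo (0:ℝ) 1, l * ‖deriv g z‖ * (1 - ‖z‖^2) ≤ 1 - (l * ‖g z‖)^2 := by
    intro l hl
    have h := schwarz_pick (fun z => (l:ℂ) * g z) (hg.const_mul _) (by
      intro ζ hζ
      rw [norm_mul, Complex.norm_real, Real.norm_of_nonneg hl.1.le]
      nlinarith [hm ζ hζ, hl.1, hl.2]) z hz
    rw [deriv_const_mul_field, norm_mul, norm_mul, Complex.norm_real, Real.norm_of_nonneg hl.1.le] at h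
    exact h
  have hmem : ∀ᶠ l in nhdsWithin (1:ℝ) (Iio 1), l ∈ Ioo (0:ℝ) 1 :=
    Ioo_mem_nhdsLT one_pos
  have t1 : Filter.Tendsto (fun l : ℝ => l * ‖deriv g z‖ * (1 - ‖z‖^2)) (nhdsWithin 1 (Iio 1))
      (nhds (1 * ‖deriv g z‖ * (1 - ‖z‖^2))) :=
    (Continuous.tendsto (by fun_prop) 1).mono_left nhdsWithin_le_nhds
  have t2 : Filter.Tendsto (fun l : ℝ => 1 - (l * ‖g z‖)^2) (nhdsWithin 1 (Iio 1))
      (nhds (1 - (1 * ‖g z‖)^2)) :=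
    (Continuous.tendsto (f := fun l : ℝ => 1 - (l * ‖g z‖)^2) (by fun_prop) 1).mono_left nhdsWithin_le_nhds
  have := le_of_tendsto_of_tendsto t1 t2 (hmem.mono key)
  simpa using this

/-- Dieudonné's lemma -/
lemma dieudonne (w : ℂ → ℂ) (hw : DifferentiableOn ℂ w (ball 0 1)) (hw0 : w 0 = 0)
    (hm : ∀ z ∈ ball (0:ℂ) 1, ‖w z‖ < 1) (z : ℂ) (hz : ‖z‖ < 1) (hz0 : z ≠ 0) :
    ‖w z‖ ≤ ‖z‖ ∧ ‖z * deriv w z - w z‖ * (1 - ‖z‖^2) ≤ ‖z‖^2 - ‖w z‖^2 := by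
  have hmaps : MapsTo w (ball 0 1) (closedBall (w 0) 1) := by
    intro ζ hζ
    rw [hw0, mem_closedBall_zero_iff]
    exact (hm ζ hζ).le
  have hzb : z ∈ ball (0:ℂ) 1 := by simpa using hz
  have hvd : DifferentiableOn ℂ (dslope w 0) (ball 0 1) :=
    (Complex.differentiableOn_dslope (ball_mem_nhds _ one_pos)).2 hw
  have hv1 : ∀ ζ ∈ ball (0:ℂ) 1, ‖dslope w 0 ζ‖ ≤ 1 := by
    intro ζ hζ
    simpa using Complex.norm_dslope_le_div_of_mapsTo_ball hw hmaps hζ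
  have hwv : ∀ ζ, w ζ = ζ * dslope w 0 ζ := by
    intro ζ
    have := sub_smul_dslope w 0 ζ
    simp [hw0] at this
    exact this.symm
  have hsp := schwarz_pick' _ hvd hv1 z hz
  have hder : deriv w z = dslope w 0 z + z * deriv (dslope w 0) z := by
    have h1 := (hasDerivAt_id z).mul (hvd.differentiableAt (isOpen_ball.mem_nhds hzb)).hasDerivAt
    have h2 : w = (id * dslope w 0) := by ext ζ; simpa using hwv ζ
    have h3 := h1.deriv
    rw [← h2] at h3
    rw [h3]; simp
  have hv := hv1 z hzb
  have hn : ‖w z‖ = ‖z‖ * ‖dslope w 0 z‖ := by rw [hwv z, norm_mul]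
  have hzp : 0 < ‖z‖ := norm_pos_iff.2 hz0
  refine ⟨by rw [hn]; nlinarith, ?_⟩
  have e : z * deriv w z - w z = z^2 * deriv (dslope w 0) z := by
    rw [hder, mul_add, ← hwv z]; ring
  rw [e, norm_mul, norm_pow, hn]
  nlinarith [mul_le_mul_of_nonneg_left hsp (sq_nonneg ‖z‖)]

set_option maxHeartbeats 2000000 in
lemma final_ineq_s17 (R N c : ℝ) (hR0 : 0 < R) (hR : R ≤ 1/2) (hN : N = 1 + 4*R - 4*R^2)
    (hc : c = (1-2*R)^2 / N) (w e : ℂ) (hw : ‖w‖^2 ≤ R) (he : ‖e‖ < (R - ‖w‖^2)/(1-R)) :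
    -(R/(1-R)) < ((1-c) * (w+e) / ((1-w)*(1-c*w))).re := by
  have hNpos : 0 < N := by nlinarith
  have h1R : 0 < 1 - R := by linarith
  have hc0 : 0 ≤ c := by rw [hc]; positivity
  have hc2 : 1 - c = 8*R*(1-R)/N := by
    rw [hc, eq_div_iff hNpos.ne', sub_mul, div_mul_cancel₀ _ hNpos.ne', hN]; ring
  have hc1 : 0 < 1 - c := by rw [hc2]; positivity
  obtain ⟨t, ht⟩ : ∃ t, t = ‖w‖^2 := ⟨_, rfl⟩
  rw [← ht] at hw he
  obtain ⟨d, hd⟩ : ∃ d, d = ‖1-w‖ := ⟨_, rfl⟩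
  obtain ⟨q, hq⟩ : ∃ q, q = ‖1-c*w‖ := ⟨_, rfl⟩
  obtain ⟨τ, hτ⟩ : ∃ τ, τ = (R - t)/(1-R) := ⟨_, rfl⟩
  have ht0 : 0 ≤ t := by rw [ht]; positivity
  have ht2 : t = w.re^2 + w.im^2 := by
    rw [ht, ← Complex.normSq_eq_norm_sq, Complex.normSq_apply]; ring
  have hd2 : d^2 = 1 + t - 2*w.re := by
    rw [hd, ht2, ← Complex.normSq_eq_norm_sq, Complex.normSq_apply]; simp; ring
  have hq2 : q^2 = 1 + c^2*t - 2*c*w.re := by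
    rw [hq, ht2, ← Complex.normSq_eq_norm_sq, Complex.normSq_apply]; simp; ring
  have hu : w.re^2 ≤ t := by rw [ht2]; nlinarith [sq_nonneg w.im]
  have hct : 0 < 1 - c*t := by nlinarith
  have hd2p : 0 < d^2 := by rw [hd2]; nlinarith [sq_nonneg (w.re - 1)]
  have hrel : q^2 - c*d^2 = (1-c)*(1-c*t) := by rw [hq2, hd2]; ring
  have hq2p : 0 < q^2 := by nlinarith [mul_pos hc1 hct, mul_nonneg hc0 hd2p.le]
  have hdp : 0 < d := by
    have : 0 ≤ d := by rw [hd]; positivity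
    exact lt_of_le_of_ne this (fun h => by rw [← h] at hd2p; simp at hd2p)
  have hqp : 0 < q := by
    have : 0 ≤ q := by rw [hq]; positivity
    exact lt_of_le_of_ne this (fun h => by rw [← h] at hq2p; simp at hq2p)
  have hdq : 1 + c*t - w.re*(1+c) ≤ q*d := by
    have h1 := Complex.re_le_norm ((1-w) * (starRingEnd ℂ) (1-c*w))
    rw [norm_mul, Complex.norm_conj, ← hd, ← hq] at h1
    have h2 : ((1-w) * (starRingEnd ℂ) (1-c*w)).re = 1 + c*t - w.re*(1+c) := by
      rw [ht2]; simp; ring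
    linarith
  have hP := Ppos R N c (q/d) t hR0 hR hN hc (by positivity)
    (by rw [div_pow, lt_div_iff₀ hd2p]; nlinarith [mul_pos hc1 hct])
    (by
      have e1 : q/d - 1 = (q-d)/d := by field_simp
      have e2 : q/d - c = (q-c*d)/d := by field_simp
      rw [e1, e2, div_pow, div_pow, ← mul_div_assoc]
      gcongr
      have : (q-d)^2 - t*(q-c*d)^2 = q^2*(1-t) + d^2*(1-c^2*t) - 2*(q*d)*(1-c*t) := by ring
      have h3 : q^2*(1-t) + d^2*(1-c^2*t) = 2*(1-c*t)*(1 + c*t - w.re*(1+c)) := by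
        rw [hq2, hd2]; ring
      nlinarith [mul_le_mul_of_nonneg_left hdq hct.le]) hw
  rw [← hτ] at hP he
  obtain ⟨G, hG⟩ : ∃ G, G = (1-c)*(w.re*(1+c*t)-(1+c)*t) := ⟨_, rfl⟩
  have hmain : (1-c)*τ*(q*d) ≤ G + R/(1-R)*(d^2*q^2) := by
    have e1 : (q/d)^2 - c = (1-c)*(1-c*t)/d^2 := by
      rw [← hrel]; field_simp
    have e2 : (q/d)^2*(1-t) - (1-c^2*t) = 2*G/d^2 := by
      have : q^2*(1-t) - d^2*(1-c^2*t) = 2*G := by rw [hq2, hd2, hG]; ring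
      rw [← this]; field_simp
    have e3 : ((q/d)^2-c)*((q/d)^2*(1-t) - (1-c^2*t) - 2*(1-c)*τ*(q/d))
      + 2*(R/(1-R))*(1-c)*(1-c*t)*(q/d)^2 = 2*((1-c)*(1-c*t))/d^4*(G + R/(1-R)*(d^2*q^2) - (1-c)*τ*(q*d)) := by
      rw [e1, e2]; field_simp; ring
    rw [e3] at hP
    have := nonneg_of_mul_nonneg_right hP (by have := mul_pos hc1 hct; positivity)
    linarith
  obtain ⟨den, hden⟩ : ∃ den, den = (1-w)*(1-c*w) := ⟨_, rfl⟩
  have hnd : ‖den‖ = d*q := by rw [hden, norm_mul, ← hd, ← hq]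
  have hre : ((1-c) * (w+e) / ((1-w)*(1-c*w))).re = (G + (1-c)*(e * (starRingEnd ℂ) den).re)/(d*q)^2 := by
    rw [← hden, ← hnd, div_eq_mul_inv, Complex.inv_def, ← Complex.normSq_eq_norm_sq, ← mul_assoc,
      Complex.re_mul_ofReal, ← div_eq_mul_inv]
    congr 1
    rw [hG, ht2, hden]; simp; ring
  have hel : -(‖e‖*(d*q)) ≤ (e * (starRingEnd ℂ) den).re := by
    have := Complex.abs_re_le_norm (e * (starRingEnd ℂ) den)
    rw [norm_mul, Complex.norm_conj, hnd] at this
    exact (abs_le.1 this).1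
  rw [hre, lt_div_iff₀ (by positivity)]
  have h5 : ‖e‖*(d*q) < τ*(d*q) := by gcongr
  nlinarith [mul_lt_mul_of_pos_left h5 hc1, mul_le_mul_of_nonneg_left hel hc1.le]

theorem radius_boundary_case (m : ℝ) (hm0 : 0 ≤ m) (hm1 : m < 1)
    (f : ℂ → ℂ) (hf : memA f)
    (hre : ∀ z ∈ ball (0 : ℂ) 1, z ≠ 0 →
      (m ^ 2 - 4 * m + 4) / (m ^ 2 - 8 * m + 8) < (f z / z).re) :
    ∀ z : ℂ, ‖z‖ < Real.sqrt ((1 - m) / (2 - m)) →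
      m < (if z = 0 then (1 : ℂ) else z * deriv f z / f z).re := by
  intro z hz
  by_cases hz0 : z = 0
  · simp [hz0, hm1]
  rw [if_neg hz0]
  obtain ⟨hfd, hf0, hf1⟩ := hf
  have h2m : 0 < 2 - m := by linarith
  have h1m : 0 < 1 - m := by linarith
  have hM : 0 < m ^ 2 - 8 * m + 8 := by nlinarith
  obtain ⟨R, hRd⟩ : ∃ R, R = (1-m)/(2-m) := ⟨_, rfl⟩
  obtain ⟨N, hN⟩ : ∃ N, N = 1 + 4*R - 4*R^2 := ⟨_, rfl⟩
  obtain ⟨c, hc⟩ : ∃ c, c = (1-2*R)^2 / N := ⟨_, rfl⟩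
  obtain ⟨k, hk⟩ : ∃ k, k = (m ^ 2 - 4 * m + 4) / (m ^ 2 - 8 * m + 8) := ⟨_, rfl⟩
  rw [← hk] at hre
  rw [← hRd] at hz
  have hR0 : 0 < R := by rw [hRd]; positivity
  have hR : R ≤ 1/2 := by rw [hRd, div_le_iff₀ h2m]; linarith
  have hNM : N = (m ^ 2 - 8 * m + 8)/(2-m)^2 := by rw [hN, hRd]; field_simp; ring
  have hcm : c = m^2/(m ^ 2 - 8 * m + 8) := by
    have : 1 - 2*R = m/(2-m) := by rw [hRd]; field_simp; ring
    rw [hc, hNM, this]; field_simp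
  have hck : c = 2*k - 1 := by 
    rw [hcm, hk, div_eq_iff hM.ne', sub_mul, mul_assoc, div_mul_cancel₀ _ hM.ne']; ring
  have ha : R/(1-R) = 1-m := by
    have : 1 - R = 1/(2-m) := by rw [hRd]; field_simp; ring
    rw [this, hRd]; field_simp
  have hk1 : k < 1 := by rw [hk, div_lt_one hM]; linarith
  have hk0 : 0 < k := by rw [hk]; have : m^2-4*m+4 = (2-m)^2 := by ring
                         rw [this]; positivity
  -- the function p
  obtain ⟨p, hp⟩ : ∃ p, p = dslope f 0 := ⟨_, rfl⟩
  have hpd : DifferentiableOn ℂ p (ball 0 1) := by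
    rw [hp]; exact (Complex.differentiableOn_dslope (ball_mem_nhds _ one_pos)).2 hfd
  have hp0 : p 0 = 1 := by rw [hp, dslope_same, hf1]
  have hfp : ∀ ζ, f ζ = ζ * p ζ := by
    intro ζ
    have := sub_smul_dslope f 0 ζ
    simp [hf0] at this
    rw [hp]; exact this.symm
  have hpre : ∀ ζ ∈ ball (0:ℂ) 1, k < (p ζ).re := by
    intro ζ hζ
    by_cases h : ζ = 0
    · rw [h, hp0]; simpa using hk1
    · have := hre ζ hζ h
      rwa [hfp, mul_div_cancel_left₀ _ h] at this
  have hpc : ∀ ζ ∈ ball (0:ℂ) 1, p ζ - c ≠ 0 := by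
    intro ζ hζ h
    have h1 := congrArg Complex.re h
    simp at h1
    linarith [hpre ζ hζ]
  have hzR : ‖z‖^2 < R := by
    have := Real.lt_sqrt (norm_nonneg z) |>.1 hz
    exact this
  have hz1 : ‖z‖ < 1 := by nlinarith [norm_nonneg z]
  have hzb : z ∈ ball (0:ℂ) 1 := by simpa using hz1
  obtain ⟨w, hw⟩ : ∃ w : ℂ → ℂ, w = fun ζ => (p ζ - 1)/(p ζ - c) := ⟨_, rfl⟩
  have hwd : DifferentiableOn ℂ w (ball 0 1) := by
    rw [hw]; exact (hpd.sub_const 1).div (hpd.sub_const _) hpc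
  have hw0 : w 0 = 0 := by simp [hw, hp0]
  have hwm : ∀ ζ ∈ ball (0:ℂ) 1, ‖w ζ‖ < 1 := by
    intro ζ hζ
    simp only [hw]
    rw [norm_div, div_lt_one (norm_pos_iff.2 (hpc ζ hζ))]
    apply lt_of_pow_lt_pow_left₀ 2 (norm_nonneg _)
    simp only [← Complex.normSq_eq_norm_sq, Complex.normSq_apply]
    simp
    have := hpre ζ hζ
    rw [hck]
    nlinarith [mul_pos (sub_pos.2 hk1) (sub_pos.2 this)]
  obtain ⟨hA, hB⟩ := dieudonne w hwd hw0 hwm z hz1 hz0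
  have hwz : ‖w z‖^2 ≤ ‖z‖^2 := by gcongr
  have h1R : 0 < 1 - R := by linarith
  have he : ‖z * deriv w z - w z‖ < (R - ‖w z‖^2)/(1-R) := by
    have p1 : 0 < 1 - ‖z‖^2 := by linarith
    have : ‖z * deriv w z - w z‖ ≤ (‖z‖^2 - ‖w z‖^2)/(1-‖z‖^2) := by rwa [le_div_iff₀ p1]
    refine this.trans_lt ?_
    rw [div_lt_div_iff₀ p1 h1R]
    nlinarith [mul_pos (sub_pos.2 hzR) (show 0 < 1 - ‖w z‖^2 by linarith)]
  have hfin := final_ineq_s17 R N c hR0 hR hN hc (w z) (z * deriv w z - w z) (hwz.trans hzR.le) he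
  rw [ha] at hfin
  have hpD := (hpd.differentiableAt (isOpen_ball.mem_nhds hzb)).hasDerivAt
  have hpcz := hpc z hzb
  have hwder : deriv w z = deriv p z * (1-c)/(p z - c)^2 := by
    rw [hw, ((hpD.sub_const 1).fun_div (hpD.sub_const (c:ℂ)) hpcz).deriv]
    congr 1; ring
  have hfder : deriv f z = p z + z * deriv p z := by
    have h1 := ((hasDerivAt_id z).fun_mul hpD).deriv
    have h2 : f = fun ζ => id ζ * p ζ := by ext ζ; simpa using hfp ζ
    rw [h2, h1]; simp
  have hpz : p z ≠ 0 := by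
    intro h
    have := hpre z hzb
    rw [h] at this; simp at this; linarith
  have hc1 : (1:ℂ) - c ≠ 0 := by
    intro h
    have h1 := congrArg Complex.re h
    simp at h1; linarith
  have e1 : 1 - w z = (1-c)/(p z - c) := by simp only [hw]; field_simp; ring
  have e2 : 1 - c * w z = p z*(1-c)/(p z - c) := by simp only [hw]; field_simp; ring
  have e3 : (1-c) * (w z + (z * deriv w z - w z)) / ((1-w z)*(1-c*w z)) = z * deriv p z / p z := by
    rw [e1, e2, hwder]; field_simp; ring
  rw [e3] at hfin
  have e4 : z * deriv f z / f z = 1 + z * deriv p z / p z := by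
    rw [hfder, hfp z]; field_simp
  rw [e4, Complex.add_re, Complex.one_re]
  linarith
end
end

section
/- Let β ∈ [0,1], m ∈ [0,1), and set κ(β) = ∫₀¹ (1 − t^{1−β})/(1 + t^{1−β}) dt and k₀ = (2m³ − 6m² + 9m − 6 + 2√((m−1)⁴(m² − 2m + 4)))/(4m³ − 21m² + 36m − 20). Let f ∈ 𝒜_β. Then Re(z f'(z)/f(z)) > m for all z with |z| < r, where: (i) if κ(β) ≥ k₀, then r = √((m²(1−κ(β)) − m(2 − 6κ(β)) − 4κ(β) + 4√((m−1)(κ(β)−1)κ(β))) / (m²(1−κ(β)) − m(4 − 8κ(β)) − 8κ(β) + 4)); (ii) if κ(β) ≤ k₀, then r = (2κ(β) − mκ(β) − 1 + √((κ(β)−1)(κ(β)(m−2)² − (m−2)m − 2)))/((1 − 2κ(β))(1 − m)). -/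
open Complex Metric Set intervalIntegral

noncomputable section

/-- The class 𝒜_β : f ∈ 𝒜 with Re(β f(z)/z + (1-β) f'(z)) > 0 on 𝔻
(at z = 0 the quantity equals 1 by the convention f(z)/z = 1 there). -/
def memAb (β : ℝ) (f : ℂ → ℂ) : Prop :=
  memA f ∧ ∀ z ∈ ball (0 : ℂ) 1, z ≠ 0 →
    0 < ((β : ℂ) * (f z / z) + (1 - (β : ℂ)) * deriv f z).re

/-- κ(β) = ∫₀¹ (1 - t^{1-β})/(1 + t^{1-β}) dt. -/
def kappa (β : ℝ) : ℝ := ∫ t in (0 : ℝ)..1, (1 - t ^ (1 - β)) / (1 + t ^ (1 - β))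

lemma normSq_mob (u b : ℂ) :
    ‖1 - (starRingEnd ℂ) b * u‖ ^ 2 - ‖u - b‖ ^ 2 = (1 - ‖u‖ ^ 2) * (1 - ‖b‖ ^ 2) := by
  simp only [← Complex.normSq_eq_norm_sq, Complex.normSq_apply]
  simp
  ring

lemma mob {u b : ℂ} (hu : ‖u‖ < 1) (hb : ‖b‖ < 1) :
    1 - (starRingEnd ℂ) b * u ≠ 0 ∧ ‖(u - b) / (1 - (starRingEnd ℂ) b * u)‖ < 1 := by
  have h := normSq_mob u b
  have h1 : 0 < (1 - ‖u‖ ^ 2) * (1 - ‖b‖ ^ 2) := by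
    apply mul_pos <;> nlinarith [norm_nonneg u, norm_nonneg b]
  have h2 : ‖u - b‖ < ‖1 - (starRingEnd ℂ) b * u‖ := by
    apply lt_of_pow_lt_pow_left₀ 2 (norm_nonneg _)
    linarith
  have h3 : 0 < ‖1 - (starRingEnd ℂ) b * u‖ := lt_of_le_of_lt (norm_nonneg _) h2
  refine ⟨norm_pos_iff.1 h3, ?_⟩
  rw [norm_div, div_lt_one h3]
  exact h2

lemma SP_strict {φ : ℂ → ℂ} (hd : DifferentiableOn ℂ φ (ball 0 1))
    (hb : ∀ z ∈ ball (0 : ℂ) 1, ‖φ z‖ < 1) {z : ℂ} (hz : z ∈ ball (0 : ℂ) 1) :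
    (1 - ‖z‖ ^ 2) * ‖deriv φ z‖ ≤ 1 - ‖φ z‖ ^ 2 := by
  have hz1 : ‖z‖ < 1 := by simpa using hz
  set b := φ z with hbdef
  have hb1 : ‖b‖ < 1 := hb z hz
  set S : ℂ → ℂ := fun w => (w - (-z)) / (1 - (starRingEnd ℂ) (-z) * w) with hS
  set g : ℂ → ℂ := fun w => (φ (S w) - b) / (1 - (starRingEnd ℂ) b * φ (S w)) with hg
  have hnz : ‖-z‖ < 1 := by simpa using hz1
  have hSm : ∀ w ∈ ball (0 : ℂ) 1, S w ∈ ball (0 : ℂ) 1 := by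
    intro w hw
    have := (mob (u := w) (b := -z) (by simpa using hw) hnz).2
    exact mem_ball_zero_iff.2 this
  have hSd : ∀ w ∈ ball (0 : ℂ) 1, DifferentiableAt ℂ S w := by
    intro w hw
    have := (mob (u := w) (b := -z) (by simpa using hw) hnz).1
    exact DifferentiableAt.div (by fun_prop) (by fun_prop) this
  have hφd : ∀ w ∈ ball (0 : ℂ) 1, DifferentiableAt ℂ φ w := fun w hw =>
    hd.differentiableAt (isOpen_ball.mem_nhds hw)
  have hgd : DifferentiableOn ℂ g (ball 0 1) := by
    intro w hw
    have h1 := (mob (hb _ (hSm w hw)) hb1).1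
    have h2 : DifferentiableAt ℂ (fun w => φ (S w)) w :=
      (hφd _ (hSm w hw)).comp w (hSd w hw)
    exact (DifferentiableAt.div (h2.sub_const b) ((h2.const_mul _).const_sub 1)
      h1).differentiableWithinAt
  have hS0 : S 0 = z := by simp [hS]
  have hg0 : g 0 = 0 := by simp [hg, hS0, hbdef]
  have hmaps : MapsTo g (ball 0 1) (closedBall (g 0) 1) := by
    intro w hw
    rw [hg0]
    have := (mob (hb _ (hSm w hw)) hb1).2
    exact mem_closedBall_zero_iff.2 this.le
  have hle := norm_deriv_le_one_of_mapsTo_ball hgd hmaps one_pos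
  have h0 : (0 : ℂ) ∈ ball (0 : ℂ) 1 := by simp
  have hS' : HasDerivAt S (1 - (starRingEnd ℂ) z * z) 0 := by
    have h1 : HasDerivAt (fun w : ℂ => w - (-z)) 1 0 := (hasDerivAt_id _).sub_const _
    have h2 : HasDerivAt (fun w : ℂ => 1 - (starRingEnd ℂ) (-z) * w)
        (-((starRingEnd ℂ) (-z) * 1)) 0 :=
      ((hasDerivAt_id _).const_mul _).const_sub _
    have := h1.div h2 (by simp)
    refine this.congr_deriv ?_
    simp
    ring
  have hφ' : HasDerivAt φ (deriv φ z) (S 0) := by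
    rw [hS0]; exact (hφd z hz).hasDerivAt
  have hc : HasDerivAt (fun w => φ (S w)) (deriv φ z * (1 - (starRingEnd ℂ) z * z)) 0 :=
    hφ'.comp 0 hS'
  have hbb := (mob hb1 hb1).1
  have hg' : HasDerivAt g (deriv φ z * (1 - (starRingEnd ℂ) z * z) /
      (1 - (starRingEnd ℂ) b * b)) 0 := by
    have h1 := hc.sub_const b
    have h2 := (hc.const_mul ((starRingEnd ℂ) b)).const_sub 1
    have hne : 1 - (starRingEnd ℂ) b * φ (S 0) ≠ 0 := by rw [hS0]; exact hbb
    have := h1.div h2 hne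
    refine this.congr_deriv ?_
    rw [hS0, ← hbdef]
    field_simp
    ring
  rw [hg'.deriv] at hle
  have key : ∀ c : ℂ, ‖c‖ < 1 → ‖1 - (starRingEnd ℂ) c * c‖ = 1 - ‖c‖ ^ 2 := by
    intro c hc
    rw [← Complex.normSq_eq_conj_mul_self, Complex.normSq_eq_norm_sq, ← Complex.ofReal_one,
      ← Complex.ofReal_sub, Complex.norm_real, Real.norm_of_nonneg]
    nlinarith [norm_nonneg c]
  rw [norm_div, norm_mul, key z hz1, key b hb1, div_le_one] at hle
  · linarith
  · nlinarith [norm_nonneg b]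

lemma SP {φ : ℂ → ℂ} (hd : DifferentiableOn ℂ φ (ball 0 1))
    (hb : ∀ z ∈ ball (0 : ℂ) 1, ‖φ z‖ ≤ 1) {z : ℂ} (hz : z ∈ ball (0 : ℂ) 1) :
    (1 - ‖z‖ ^ 2) * ‖deriv φ z‖ ≤ 1 - ‖φ z‖ ^ 2 := by
  have hφd : DifferentiableAt ℂ φ z := hd.differentiableAt (isOpen_ball.mem_nhds hz)
  have h : ∀ t : ℝ, t ∈ Ioo (0 : ℝ) 1 →
      (1 - ‖z‖ ^ 2) * (t * ‖deriv φ z‖) ≤ 1 - (t * ‖φ z‖) ^ 2 := by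
    intro t ht
    have := SP_strict (φ := fun w => (t : ℂ) * φ w) (hd.const_mul _) (by
      intro w hw
      rw [norm_mul, Complex.norm_real, Real.norm_of_nonneg ht.1.le]
      have := hb w hw
      nlinarith [norm_nonneg (φ w), ht.1, ht.2]) hz
    rw [deriv_const_mul _ hφd] at this
    simpa [abs_of_pos ht.1] using this
  have hne : (Ioo (0 : ℝ) 1) ⊆ {t : ℝ | (1 - ‖z‖ ^ 2) * (t * ‖deriv φ z‖) ≤ 1 - (t * ‖φ z‖) ^ 2} := h
  have hcl : IsClosed {t : ℝ | (1 - ‖z‖ ^ 2) * (t * ‖deriv φ z‖) ≤ 1 - (t * ‖φ z‖) ^ 2} :=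
    isClosed_le (by fun_prop) (by fun_prop)
  have h1 := closure_minimal hne hcl
  rw [closure_Ioo (by norm_num)] at h1
  have := h1 (show (1 : ℝ) ∈ Icc (0 : ℝ) 1 by simp)
  simpa using this

lemma cara {q : ℂ → ℂ} (hd : DifferentiableOn ℂ q (ball 0 1)) (h0 : q 0 = 1)
    (hre : ∀ z ∈ ball (0 : ℂ) 1, 0 ≤ (q z).re) {z : ℂ} (hz : z ∈ ball (0 : ℂ) 1) :
    (1 - ‖z‖ ^ 2) * ‖z * deriv q z - (q z ^ 2 - 1) / 2‖ ≤
      (1 + ‖z‖ ^ 2) * (q z).re - (1 - ‖z‖ ^ 2) * (1 + ‖q z‖ ^ 2) / 2 := by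
  set w : ℂ → ℂ := fun z => (q z - 1) / (q z + 1) with hw
  have hne : ∀ z ∈ ball (0 : ℂ) 1, q z + 1 ≠ 0 := by
    intro z hz h
    have := congrArg Complex.re h
    simp at this
    linarith [hre z hz]
  have hwd : DifferentiableOn ℂ w (ball 0 1) :=
    DifferentiableOn.div (hd.sub_const _) (hd.add_const _) hne
  have hw0 : w 0 = 0 := by simp [hw, h0]
  have hn : ∀ u : ℂ, ‖u + 1‖ ^ 2 = ‖u‖ ^ 2 + 1 + 2 * u.re ∧
      ‖u - 1‖ ^ 2 = ‖u‖ ^ 2 + 1 - 2 * u.re := by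
    intro u
    simp only [← Complex.normSq_eq_norm_sq, Complex.normSq_apply]
    simp
    constructor <;> ring
  have hmaps : MapsTo w (ball 0 1) (closedBall (w 0) 1) := by
    intro u hu
    rw [hw0, mem_closedBall_zero_iff, hw]
    simp only [norm_div]
    rw [div_le_one (norm_pos_iff.2 (hne u hu))]
    apply le_of_sq_le_sq _ (norm_nonneg _)
    rw [(hn _).1, (hn _).2]
    linarith [hre u hu]
  set φ := dslope w 0 with hφ
  have hφn : ∀ z ∈ ball (0 : ℂ) 1, ‖φ z‖ ≤ 1 := by
    intro u hu
    simpa using norm_dslope_le_div_of_mapsTo_ball hwd hmaps hu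
  have hφd : DifferentiableOn ℂ φ (ball 0 1) :=
    (Complex.differentiableOn_dslope (ball_mem_nhds _ one_pos)).2 hwd
  have hsp := SP hφd hφn hz
  have hwφ : ∀ z, w z = z * φ z := by
    intro z
    have := sub_smul_dslope w 0 z
    simpa [hw0] using this.symm
  have hqa : DifferentiableAt ℂ q z := hd.differentiableAt (isOpen_ball.mem_nhds hz)
  have hφa : DifferentiableAt ℂ φ z := hφd.differentiableAt (isOpen_ball.mem_nhds hz)
  have d1 : HasDerivAt w (1 * φ z + z * deriv φ z) z := by
    have := (hasDerivAt_id z).mul hφa.hasDerivAt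
    have e : w = id * φ := by
      funext z; simp [hwφ z]
    rw [e]; exact this
  have d2 : HasDerivAt w ((deriv q z * (q z + 1) - (q z - 1) * deriv q z) / (q z + 1) ^ 2) z :=
    (hqa.hasDerivAt.sub_const 1).div (hqa.hasDerivAt.add_const 1) (hne z hz)
  have e1 := d1.unique d2
  have hq1 := hne z hz
  have hwz : (q z - 1) / (q z + 1) = z * φ z := hwφ z
  have e2 : z * deriv q z - (q z ^ 2 - 1) / 2 = (q z + 1) ^ 2 / 2 * (z ^ 2 * deriv φ z) := by
    rw [eq_div_iff (pow_ne_zero 2 hq1)] at e1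
    rw [div_eq_iff hq1] at hwz
    linear_combination (-z/2) * e1 - (q z + 1) / 2 * hwz
  have e3 : ‖z‖ * ‖φ z‖ * ‖q z + 1‖ = ‖q z - 1‖ := by
    rw [div_eq_iff hq1] at hwz
    rw [hwz]; simp
  rw [e2]
  simp only [norm_mul, norm_div, norm_pow]
  have hA := (hn (q z)).1
  have hB := (hn (q z)).2
  have e4 : ‖z‖ ^ 2 * ‖φ z‖ ^ 2 * ‖q z + 1‖ ^ 2 = ‖q z - 1‖ ^ 2 := by rw [← e3]; ring
  have h5 := mul_le_mul_of_nonneg_left hsp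
    (show 0 ≤ ‖q z + 1‖ ^ 2 / 2 * ‖z‖ ^ 2 by positivity)
  simp
  have h6 : ‖q z + 1‖ ^ 2 / 2 * ‖z‖ ^ 2 * (1 - ‖φ z‖ ^ 2) =
     (1 + ‖z‖ ^ 2) * (q z).re - (1 - ‖z‖ ^ 2) * (1 + ‖q z‖ ^ 2) / 2 := by
    have : ‖q z + 1‖ ^ 2 / 2 * ‖z‖ ^ 2 * (1 - ‖φ z‖ ^ 2) =
      ‖q z + 1‖ ^ 2 / 2 * ‖z‖ ^ 2 - ‖z‖ ^ 2 * ‖φ z‖ ^ 2 * ‖q z + 1‖ ^ 2 / 2 := by ring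
    rw [this, e4, hA, hB]; ring
  linarith

lemma re_lower {q : ℂ → ℂ} (hd : DifferentiableOn ℂ q (ball 0 1)) (h0 : q 0 = 1)
    (hre : ∀ z ∈ ball (0 : ℂ) 1, 0 ≤ (q z).re) {z : ℂ} (hz : z ∈ ball (0 : ℂ) 1) :
    (1 - ‖z‖) / (1 + ‖z‖) ≤ (q z).re := by
  have h := cara hd h0 hre hz
  have hz1 : ‖z‖ < 1 := by simpa using hz
  have hz0 := norm_nonneg z
  have hX : (q z).re ^ 2 ≤ ‖q z‖ ^ 2 := by
    rw [← Complex.normSq_eq_norm_sq, Complex.normSq_apply]; nlinarith [sq_nonneg (q z).im]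
  have hr2 : 0 < 1 - ‖z‖ ^ 2 := by nlinarith
  have h1 : 0 ≤ (1 - ‖z‖ ^ 2) * ‖z * deriv q z - (q z ^ 2 - 1) / 2‖ := by positivity
  have h2 : (1 - ‖z‖ ^ 2) * (1 + (q z).re ^ 2) ≤ (1 - ‖z‖ ^ 2) * (1 + ‖q z‖ ^ 2) := by gcongr
  rw [div_le_iff₀ (by linarith)]
  by_contra hc
  push Not at hc
  have hx := hre z hz
  have : 0 < (1 - ‖z‖ - (1 + ‖z‖) * (q z).re) * (1 + ‖z‖ - (1 - ‖z‖) * (q z).re) := by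
    apply mul_pos
    · linarith
    · nlinarith
  nlinarith

lemma core {q D : ℂ} {s r : ℝ} (hs : 0 ≤ s) (hr0 : 0 ≤ r) (hr1 : r < 1)
    (h : (1 - r ^ 2) * ‖D - (q ^ 2 - 1) / 2‖ ≤
      (1 + r ^ 2) * q.re - (1 - r ^ 2) * (1 + ‖q‖ ^ 2) / 2) :
    ∃ R : ℝ, 0 < R ∧ s + (1 - r) / (1 + r) ≤ R ∧
      R + s * (s + (1 + r ^ 2) / (1 - r ^ 2)) / R - 2 * s - (1 + r ^ 2) / (1 - r ^ 2) ≤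
        (D / (q + s)).re := by
  have hr2 : 0 < 1 - r ^ 2 := by nlinarith
  set a := (1 + r ^ 2) / (1 - r ^ 2) with ha
  have ha0 : 0 < a := by positivity
  have haeq : a * (1 - r ^ 2) = 1 + r ^ 2 := by rw [ha]; field_simp
  set E := D - (q ^ 2 - 1) / 2 with hE
  have h' : ‖E‖ ≤ a * q.re - (1 + ‖q‖ ^ 2) / 2 := by
    apply le_of_mul_le_mul_left _ hr2
    calc _ ≤ _ := h
      _ = _ := by rw [← haeq]; ring
  set Q : ℂ := q + s with hQ
  set R := ‖Q‖ with hR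
  set X := Q.re with hX
  have hqX : q.re = X - s := by simp [hX, hQ]
  have hR2 : R ^ 2 = Q.re ^ 2 + Q.im ^ 2 := by
    rw [hR, ← Complex.normSq_eq_norm_sq, Complex.normSq_apply]; ring
  have hq2 : ‖q‖ ^ 2 = R ^ 2 - 2 * s * X + s ^ 2 := by
    rw [hR2, ← Complex.normSq_eq_norm_sq, Complex.normSq_apply]
    simp [hX, hQ]; ring
  have hXR : X ≤ R := Complex.re_le_norm Q
  have hE0 := norm_nonneg E
  rw [hqX, hq2] at h'
  have hcon : R ^ 2 - 2 * (s + a) * X + s ^ 2 + 1 + 2 * a * s ≤ 0 := by linarith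
  have hconR : R ^ 2 - 2 * (s + a) * R + s ^ 2 + 1 + 2 * a * s ≤ 0 := by
    nlinarith
  have hRn : 0 ≤ R := norm_nonneg _
  have hRpos : 0 < R := by
    rcases hRn.eq_or_lt with h | h
    · rw [← h] at hconR; nlinarith [mul_nonneg ha0.le hs, sq_nonneg s]
    · exact h
  refine ⟨R, hRpos, ?_, ?_⟩
  · by_contra hc
    push Not at hc
    have e1 : a - 2 * r / (1 - r ^ 2) = (1 - r) / (1 + r) := by
      have h1 : (1 - r ^ 2) ≠ 0 := hr2.ne'
      have h2 : (1 + r) ≠ 0 := by linarith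
      rw [ha]
      field_simp
      ring
    have e2 : (2 * r / (1 - r ^ 2)) ^ 2 = a ^ 2 - 1 := by
      have h1 : (1 - r ^ 2) ≠ 0 := hr2.ne'
      rw [ha]
      field_simp
      ring
    rw [← e1] at hc
    have hρ : 0 ≤ 2 * r / (1 - r ^ 2) := by positivity
    nlinarith
  · have hQ0 : Q ≠ 0 := norm_pos_iff.1 hRpos
    have e1 : (D / Q).re = (D * (starRingEnd ℂ) Q).re / R ^ 2 := by
      rw [Complex.div_re, hR, ← Complex.normSq_eq_norm_sq]
      simp
      ring
    rw [e1, le_div_iff₀ (by positivity)]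
    have e2 : (R + s * (s + a) / R - 2 * s - a) * R ^ 2 =
       R ^ 3 + s * (s + a) * R - (2 * s + a) * R ^ 2 := by
      field_simp
      ring
    rw [e2]
    have e3 : (D * (starRingEnd ℂ) Q).re =
        (R ^ 2 * X - 2 * s * R ^ 2 + (s ^ 2 - 1) * X) / 2 + (E * (starRingEnd ℂ) Q).re := by
      have : D = E + ((Q - s) ^ 2 - 1) / 2 := by rw [hE, hQ]; ring
      rw [this, hR2, hX]
      simp [pow_two]
      ring
    have e4 : -(‖E‖ * R) ≤ (E * (starRingEnd ℂ) Q).re := by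
      have := (abs_le.1 (Complex.abs_re_le_norm (E * (starRingEnd ℂ) Q))).1
      simpa [hR] using this
    have e5 : ‖E‖ * R ≤ (a * (X - s) - (1 + (R ^ 2 - 2 * s * X + s ^ 2)) / 2) * R := by gcongr
    have e6 : 0 ≤ (R - X) * (-(R ^ 2 + s ^ 2 - 1 - 2 * (s + a) * R)) := by
      apply mul_nonneg
      · linarith
      · nlinarith [mul_nonneg ha0.le hs]
    rw [e3]
    linarith

lemma core_pos {q D : ℂ} {s r : ℝ} (hs : 0 ≤ s) (hr0 : 0 ≤ r) (hr1 : r < 1)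
    (h : (1 - r ^ 2) * ‖D - (q ^ 2 - 1) / 2‖ ≤
      (1 + r ^ 2) * q.re - (1 - r ^ 2) * (1 + ‖q‖ ^ 2) / 2) :
    0 < (q + s).re := by
  have hr2 : 0 < 1 - r ^ 2 := by nlinarith
  have h1 : 0 ≤ (1 - r ^ 2) * ‖D - (q ^ 2 - 1) / 2‖ := by positivity
  have h2 : 0 < (1 - r ^ 2) * (1 + ‖q‖ ^ 2) := by positivity
  have h3 : 0 < (1 + r ^ 2) * q.re := by linarith
  have h4 : 0 < q.re := pos_of_mul_pos_right h3 (by positivity)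
  simp
  linarith

lemma kappa_int {γ : ℝ} (h0 : 0 ≤ γ) : IntervalIntegrable
    (fun t : ℝ => (1 - t ^ γ) / (1 + t ^ γ)) MeasureTheory.volume 0 1 := by
  apply ContinuousOn.intervalIntegrable
  rw [uIcc_of_le zero_le_one]
  have hc : Continuous fun t : ℝ => t ^ γ := Real.continuous_rpow_const h0
  apply ContinuousOn.div (by fun_prop) (by fun_prop)
  intro t ht
  have := Real.rpow_nonneg ht.1 γ
  linarith

lemma kappa_bounds {β : ℝ} (hβ : β ∈ Set.Icc (0 : ℝ) 1) : 0 ≤ kappa β ∧ kappa β ≤ 5 / 12 := by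
  have hγ0 : 0 ≤ 1 - β := by linarith [hβ.2]
  have hγ1 : 1 - β ≤ 1 := by linarith [hβ.1]
  constructor
  · apply intervalIntegral.integral_nonneg zero_le_one
    intro t ht
    have h1 := Real.rpow_nonneg ht.1 (1 - β)
    have h2 := Real.rpow_le_one ht.1 ht.2 hγ0
    apply div_nonneg <;> linarith
  · have h2 : ∫ t in (0 : ℝ)..1, (1 - 3 / 2 * t + t ^ 2 / 2) = 5 / 12 := by
      have : ∀ t ∈ uIcc (0 : ℝ) 1, HasDerivAt (fun t : ℝ => t - 3 / 4 * t ^ 2 + t ^ 3 / 6)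
          (1 - 3 / 2 * t + t ^ 2 / 2) t := by
        intro t _
        have h := ((hasDerivAt_id t).sub (((hasDerivAt_id t).pow 2).const_mul (3 / 4))).add
          (((hasDerivAt_id t).pow 3).div_const 6)
        refine h.congr_deriv ?_
        simp
        ring
      rw [integral_eq_sub_of_hasDerivAt this ((by fun_prop : Continuous _).intervalIntegrable _ _)]
      norm_num
    rw [← h2]
    apply intervalIntegral.integral_mono_on zero_le_one (kappa_int hγ0)
      ((by fun_prop : Continuous _).intervalIntegrable _ _)
    intro t ht
    have h1 : t ≤ t ^ (1 - β) := by
      rcases ht.1.eq_or_lt with h | h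
      · rw [← h]; exact Real.rpow_nonneg le_rfl _
      · have := Real.rpow_le_rpow_of_exponent_ge h ht.2 hγ1
        simpa using this
    have h0 := ht.1
    have h1' := ht.2
    rw [div_le_iff₀ (by linarith)]
    generalize t ^ (1 - β) = u at h1
    nlinarith [mul_nonneg (sub_nonneg.2 h1) (show (0 : ℝ) ≤ 2 - 3 / 2 * t + t ^ 2 / 2 by nlinarith),
      mul_nonneg h0 (sq_nonneg (1 - t)), mul_nonneg (mul_nonneg h0 (sub_nonneg.2 h1')) (sub_nonneg.2 h1')]

lemma re_p {β : ℝ} (hβ : β ∈ Set.Icc (0 : ℝ) 1) {f : ℂ → ℂ} (hf : memAb β f) {z : ℂ}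
    (hz : z ∈ ball (0 : ℂ) 1) : kappa β ≤ (dslope f 0 z).re := by
  obtain ⟨⟨hfd, hf0, hf1⟩, hre⟩ := hf
  have hγ0 : 0 ≤ 1 - β := by linarith [hβ.2]
  set γ := 1 - β with hγ
  set p := dslope f 0 with hp
  have hpd : DifferentiableOn ℂ p (ball 0 1) :=
    (Complex.differentiableOn_dslope (ball_mem_nhds _ one_pos)).2 hfd
  have hpa : ∀ w ∈ ball (0 : ℂ) 1, DifferentiableAt ℂ p w := fun w hw =>
    hpd.differentiableAt (isOpen_ball.mem_nhds hw)
  have hfp : ∀ w, f w = w * p w := by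
    intro w
    have := sub_smul_dslope f 0 w
    simpa [hf0] using this.symm
  have hf' : ∀ w ∈ ball (0 : ℂ) 1, deriv f w = p w + w * deriv p w := by
    intro w hw
    have := (hasDerivAt_id w).mul (hpa w hw).hasDerivAt
    have e : f = id * p := by
      funext w; simp [hfp w]
    rw [e, this.deriv]; simp
  set H : ℂ → ℂ := fun w => p w + γ * (w * deriv p w) with hH
  have hHd : DifferentiableOn ℂ H (ball 0 1) := by
    have : DifferentiableOn ℂ (deriv p) (ball 0 1) := hpd.deriv isOpen_ball
    exact hpd.add ((differentiableOn_id.mul this).const_mul _)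
  have hH0 : H 0 = 1 := by simp [hH, hp, hf1]
  have hHre : ∀ w ∈ ball (0 : ℂ) 1, 0 ≤ (H w).re := by
    intro w hw
    by_cases h : w = 0
    · rw [h, hH0]; simp
    · have h1 := hre w hw h
      rw [hf' w hw, hfp w, mul_div_cancel_left₀ _ h] at h1
      have e : (β : ℂ) * p w + (1 - (β : ℂ)) * (p w + w * deriv p w) = H w := by
        simp only [hH, hγ]; push_cast; ring
      rw [e] at h1
      exact h1.le
  have hz1 : ‖z‖ < 1 := by simpa using hz
  have hcr : Continuous fun t : ℝ => t ^ γ := Real.continuous_rpow_const hγ0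
  have hmem : ∀ t ∈ Icc (0 : ℝ) 1, z * ((t ^ γ : ℝ) : ℂ) ∈ ball (0 : ℂ) 1 := by
    intro t ht
    have h1 := Real.rpow_nonneg ht.1 γ
    have h2 := Real.rpow_le_one ht.1 ht.2 hγ0
    rw [mem_ball_zero_iff, norm_mul, Complex.norm_real, Real.norm_of_nonneg h1]
    nlinarith [norm_nonneg z]
  have hcz : Continuous fun t : ℝ => z * ((t ^ γ : ℝ) : ℂ) := by fun_prop
  have hFc : ContinuousOn (fun t : ℝ => ((t : ℂ) * p (z * ((t ^ γ : ℝ) : ℂ))).re) (uIcc 0 1) := by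
    rw [uIcc_of_le zero_le_one]
    have : ContinuousOn (fun t : ℝ => p (z * ((t ^ γ : ℝ) : ℂ))) (Icc 0 1) :=
      hpd.continuousOn.comp hcz.continuousOn hmem
    exact Complex.continuous_re.comp_continuousOn (Complex.continuous_ofReal.continuousOn.mul this)
  have hHc : ContinuousOn (fun t : ℝ => (H (z * ((t ^ γ : ℝ) : ℂ))).re) (uIcc 0 1) := by
    rw [uIcc_of_le zero_le_one]
    have : ContinuousOn (fun t : ℝ => H (z * ((t ^ γ : ℝ) : ℂ))) (Icc 0 1) :=
      hHd.continuousOn.comp hcz.continuousOn hmem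
    exact Complex.continuous_re.comp_continuousOn this
  have hder : ∀ t ∈ Ioo (min (0 : ℝ) 1) (max 0 1),
      HasDerivWithinAt (fun t : ℝ => ((t : ℂ) * p (z * ((t ^ γ : ℝ) : ℂ))).re)
        ((H (z * ((t ^ γ : ℝ) : ℂ))).re) (Ioi t) t := by
    intro t ht
    rw [min_eq_left zero_le_one, max_eq_right zero_le_one] at ht
    apply HasDerivAt.hasDerivWithinAt
    have h1 : HasDerivAt (fun t : ℝ => t ^ γ) (γ * t ^ (γ - 1)) t :=
      Real.hasDerivAt_rpow_const (Or.inl ht.1.ne')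
    have h2 : HasDerivAt (fun t : ℝ => z * ((t ^ γ : ℝ) : ℂ))
        (z * ((γ * t ^ (γ - 1) : ℝ) : ℂ)) t := h1.ofReal_comp.const_mul z
    have h3 : HasDerivAt (fun t : ℝ => p (z * ((t ^ γ : ℝ) : ℂ)))
        (deriv p (z * ((t ^ γ : ℝ) : ℂ)) * (z * ((γ * t ^ (γ - 1) : ℝ) : ℂ))) t :=
      (hpa _ (hmem t ⟨ht.1.le, ht.2.le⟩)).hasDerivAt.comp t h2
    have h4 : HasDerivAt (fun t : ℝ => (t : ℂ)) 1 t := by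
      simpa using (hasDerivAt_id t).ofReal_comp
    have h5 := h4.mul h3
    have h6 := (Complex.reCLM.hasFDerivAt (x := (t : ℂ) * p (z * ((t ^ γ : ℝ) : ℂ)))).comp_hasDerivAt
      t h5
    refine h6.congr_deriv ?_
    have e : (t ^ γ : ℝ) = t * t ^ (γ - 1) := by
      rw [Real.rpow_sub_one ht.1.ne']; field_simp [ht.1.ne']
    simp only [hH, Complex.reCLM_apply]
    congr 1
    conv_rhs => rw [show z * ((t ^ γ : ℝ) : ℂ) * deriv p (z * ((t ^ γ : ℝ) : ℂ)) =
      z * ((t * t ^ (γ - 1) : ℝ) : ℂ) * deriv p (z * ((t ^ γ : ℝ) : ℂ)) by rw [← e]]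
    push_cast
    ring
  have hint := integral_eq_sub_of_hasDeriv_right hFc hder hHc.intervalIntegrable
  simp at hint
  rw [← hint]
  apply intervalIntegral.integral_mono_on zero_le_one (kappa_int hγ0) hHc.intervalIntegrable
  intro t ht
  have h1 := Real.rpow_nonneg ht.1 γ
  have h2 := re_lower hHd hH0 hHre (hmem t ht)
  refine le_trans ?_ h2
  rw [norm_mul, Complex.norm_real, Real.norm_of_nonneg h1]
  have h3 : ‖z‖ * t ^ γ ≤ t ^ γ := by nlinarith [norm_nonneg z]
  have h4 : 0 ≤ ‖z‖ * t ^ γ := by positivity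
  have h5 := Real.rpow_le_one ht.1 ht.2 hγ0
  rw [div_le_div_iff₀ (by linarith) (by linarith)]
  linarith

lemma main_bound {β : ℝ} (hβ : β ∈ Set.Icc (0 : ℝ) 1) {f : ℂ → ℂ} (hf : memAb β f) {z : ℂ}
    (hz1 : ‖z‖ < 1) (hz0 : z ≠ 0) {s : ℝ} (hs : s = kappa β / (1 - kappa β)) :
    ∃ R : ℝ, 0 < R ∧ s + (1 - ‖z‖) / (1 + ‖z‖) ≤ R ∧
      1 + R + s * (s + (1 + ‖z‖ ^ 2) / (1 - ‖z‖ ^ 2)) / R - 2 * s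
        - (1 + ‖z‖ ^ 2) / (1 - ‖z‖ ^ 2) ≤ (z * deriv f z / f z).re := by
  obtain ⟨hk0, hk1⟩ := kappa_bounds hβ
  have hrp : ∀ w ∈ ball (0 : ℂ) 1, kappa β ≤ (dslope f 0 w).re := fun w hw => re_p hβ hf hw
  obtain ⟨⟨hfd, hf0, hf1⟩, -⟩ := hf
  set k := kappa β with hk
  set p := dslope f 0 with hp
  have hz : z ∈ ball (0 : ℂ) 1 := by simpa using hz1
  have hpd : DifferentiableOn ℂ p (ball 0 1) :=
    (Complex.differentiableOn_dslope (ball_mem_nhds _ one_pos)).2 hfd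
  have hpa := hpd.differentiableAt (isOpen_ball.mem_nhds hz)
  have hfp : ∀ w, f w = w * p w := by
    intro w
    have := sub_smul_dslope f 0 w
    simpa [hf0] using this.symm
  have hf' : deriv f z = p z + z * deriv p z := by
    have := (hasDerivAt_id z).mul hpa.hasDerivAt
    have e : f = id * p := by
      funext w; simp [hfp w]
    rw [e, this.deriv]; simp
  have h1k : (0 : ℝ) < 1 - k := by linarith
  have h1kc : (1 : ℂ) - (k : ℂ) ≠ 0 := by
    have : ((1 - k : ℝ) : ℂ) ≠ 0 := Complex.ofReal_ne_zero.2 h1k.ne'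
    simpa using this
  set q : ℂ → ℂ := fun w => (p w - k) / ((1 - k : ℝ) : ℂ) with hq
  have hqd : DifferentiableOn ℂ q (ball 0 1) := (hpd.sub_const _).div_const _
  have hq0 : q 0 = 1 := by
    simp [hq, hp, hf1, h1kc]
  have hqre : ∀ w ∈ ball (0 : ℂ) 1, 0 ≤ (q w).re := by
    intro w hw
    simp only [hq]
    rw [Complex.div_ofReal_re]
    apply div_nonneg _ h1k.le
    have := hrp w hw
    simpa using this
  have hs0 : 0 ≤ s := by rw [hs]; positivity
  have hc := cara hqd hq0 hqre hz
  obtain ⟨R, hR, hR0, hRb⟩ := core hs0 (norm_nonneg z) hz1 hc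
  refine ⟨R, hR, hR0, ?_⟩
  have hq' : deriv q z = deriv p z / ((1 - k : ℝ) : ℂ) :=
    ((hpa.hasDerivAt.sub_const _).div_const _).deriv
  have hqs : q z + s = p z / ((1 - k : ℝ) : ℂ) := by
    simp only [hq, hs]
    push_cast
    field_simp
    ring
  have hpz : p z ≠ 0 := by
    intro h
    have hre := core_pos hs0 (norm_nonneg z) hz1 hc
    rw [hqs, h] at hre
    simp at hre
  have e : z * deriv f z / f z = 1 + z * deriv q z / (q z + s) := by
    rw [hqs, hq', hf', hfp]
    have : ((1 - k : ℝ) : ℂ) ≠ 0 := by simpa using h1kc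
    field_simp
  rw [e]
  simp only [Complex.add_re, Complex.one_re]
  linarith

lemma G_to_bound {m s a R y : ℝ} (hR : 0 < R)
    (hG : 0 < R ^ 2 - (2 * s + a - 1 + m) * R + s * (s + a))
    (h : 1 + R + s * (s + a) / R - 2 * s - a ≤ y) : m < y := by
  refine lt_of_lt_of_le ?_ h
  have : 1 + R + s * (s + a) / R - 2 * s - a - m =
      (R ^ 2 - (2 * s + a - 1 + m) * R + s * (s + a)) / R := by
    field_simp; ring
  have h2 := div_pos hG hR
  linarith

lemma case_one {m k r : ℝ} (hm0 : 0 ≤ m) (hm1 : m < 1) (hk0 : 0 ≤ k) (hk1 : k ≤ 5 / 12)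
    (hr0 : 0 ≤ r)
    (hr : r < Real.sqrt ((m ^ 2 * (1 - k) - m * (2 - 6 * k) - 4 * k +
            4 * Real.sqrt ((m - 1) * (k - 1) * k)) /
          (m ^ 2 * (1 - k) - m * (4 - 8 * k) - 8 * k + 4))) :
    r < 1 ∧ ∀ R : ℝ, 0 < R ^ 2 - (2 * (k / (1 - k)) + (1 + r ^ 2) / (1 - r ^ 2) - 1 + m) * R
      + k / (1 - k) * (k / (1 - k) + (1 + r ^ 2) / (1 - r ^ 2)) := by
  rw [Real.lt_sqrt hr0] at hr
  set T := Real.sqrt ((m - 1) * (k - 1) * k) with hT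
  have hT0 : 0 ≤ T := Real.sqrt_nonneg _
  have hT2 : T ^ 2 = (m - 1) * (k - 1) * k := by
    apply Real.sq_sqrt
    apply mul_nonneg _ hk0
    nlinarith
  have hD : 0 < m ^ 2 * (1 - k) - m * (4 - 8 * k) - 8 * k + 4 := by
    nlinarith [mul_nonneg hk0 hm0, mul_pos (sub_pos.2 hm1) (sub_pos.2 hm1)]
  rw [lt_div_iff₀ hD] at hr
  have h1k : 0 < 1 - k := by linarith
  have hC : 2 * T < (1 - k) * (2 - m) := by
    apply lt_of_pow_lt_pow_left₀ 2 (by nlinarith)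
    have : (2 * T) ^ 2 = 4 * ((m - 1) * (k - 1) * k) := by rw [mul_pow, hT2]; ring
    rw [this]
    have : ((1 - k) * (2 - m)) ^ 2 - 4 * ((m - 1) * (k - 1) * k) =
      (1 - k) * (m ^ 2 * (1 - k) + 4 * (1 - m) * (1 - 2 * k)) := by ring
    have h2 : 0 < (1 - k) * (m ^ 2 * (1 - k) + 4 * (1 - m) * (1 - 2 * k)) := by
      apply mul_pos h1k
      have := mul_nonneg (sq_nonneg m) h1k.le
      have := mul_pos (sub_pos.2 hm1) (show 0 < 1 - 2 * k by linarith)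
      linarith
    linarith
  have hr1 : r ^ 2 < 1 := by
    by_contra hc
    push Not at hc
    nlinarith
  have hr1' : r < 1 := by nlinarith
  refine ⟨hr1', ?_⟩
  have h1r : 0 < 1 - r ^ 2 := by linarith
  have key : (1 - k) * (m + (2 - m) * r ^ 2) < 2 * T * (1 - r ^ 2) := by
    have h1 : ((1 - k) * (2 - m) - 2 * T) * (r ^ 2 * ((1 - k) * (2 - m) + 2 * T)) <
        ((1 - k) * (2 - m) - 2 * T) * (2 * T - m * (1 - k)) := by
      have e1 : ((1 - k) * (2 - m) - 2 * T) * (r ^ 2 * ((1 - k) * (2 - m) + 2 * T)) =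
        (1 - k) * (r ^ 2 * (m ^ 2 * (1 - k) - m * (4 - 8 * k) - 8 * k + 4)) := by
        linear_combination (-4 * r ^ 2) * hT2
      have e2 : ((1 - k) * (2 - m) - 2 * T) * (2 * T - m * (1 - k)) =
        (1 - k) * (m ^ 2 * (1 - k) - m * (2 - 6 * k) - 4 * k + 4 * T) := by
        linear_combination (-4) * hT2
      rw [e1, e2]
      exact mul_lt_mul_of_pos_left hr h1k
    have := lt_of_mul_lt_mul_left h1 (by linarith)
    linarith
  intro R
  set s := k / (1 - k) with hs
  set a := (1 + r ^ 2) / (1 - r ^ 2) with ha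
  have hse : s * (1 - k) = k := by rw [hs]; field_simp
  have hae : a * (1 - r ^ 2) = 1 + r ^ 2 := by rw [ha]; field_simp
  have ha1 : 1 ≤ a := by rw [ha, le_div_iff₀ h1r]; nlinarith [sq_nonneg r]
  have k2 : (a + m - 1) * (1 - k) < 2 * T := by
    apply lt_of_mul_lt_mul_right _ h1r.le
    have : (a + m - 1) * (1 - k) * (1 - r ^ 2) = (1 - k) * (m + (2 - m) * r ^ 2) := by
      linear_combination (1 - k) * hae
    rw [this]; exact key
  have k3 : (a + m - 1) ^ 2 < 4 * s * (1 - m) := by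
    apply lt_of_mul_lt_mul_right _ (sq_nonneg (1 - k))
    have : 4 * s * (1 - m) * (1 - k) ^ 2 = (2 * T) ^ 2 := by
      rw [mul_pow, hT2]; linear_combination 4 * (1 - m) * (1 - k) * hse
    rw [this, ← mul_pow]
    apply pow_lt_pow_left₀ k2 _ two_ne_zero
    apply mul_nonneg <;> linarith
  nlinarith [sq_nonneg (R - (2 * s + a - 1 + m) / 2)]

set_option maxHeartbeats 1000000 in
lemma case_two {m k r : ℝ} (hm0 : 0 ≤ m) (hm1 : m < 1) (hk0 : 0 ≤ k) (hk1 : k ≤ 5 / 12)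
    (hr0 : 0 ≤ r)
    (hk : k ≤ (2 * m ^ 3 - 6 * m ^ 2 + 9 * m - 6 +
        2 * Real.sqrt ((m - 1) ^ 4 * (m ^ 2 - 2 * m + 4))) /
      (4 * m ^ 3 - 21 * m ^ 2 + 36 * m - 20))
    (hr : r < (2 * k - m * k - 1 +
            Real.sqrt ((k - 1) * (k * (m - 2) ^ 2 - (m - 2) * m - 2))) /
          ((1 - 2 * k) * (1 - m))) :
    r < 1 ∧ ∀ R : ℝ, k / (1 - k) + (1 - r) / (1 + r) ≤ R →
      0 < R ^ 2 - (2 * (k / (1 - k)) + (1 + r ^ 2) / (1 - r ^ 2) - 1 + m) * R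
      + k / (1 - k) * (k / (1 - k) + (1 + r ^ 2) / (1 - r ^ 2)) := by
  have hc0 : 0 < 1 - 2 * k := by linarith
  have hm' : 0 < 1 - m := by linarith
  have h1k : 0 < 1 - k := by linarith
  rw [lt_div_iff₀ (mul_pos hc0 hm')] at hr
  have hB : 0 ≤ 1 + m * k - 2 * k := by nlinarith
  have hr' : r * ((1 - 2 * k) * (1 - m)) + (1 + m * k - 2 * k) <
      Real.sqrt ((k - 1) * (k * (m - 2) ^ 2 - (m - 2) * m - 2)) := by linarith
  rw [Real.lt_sqrt (by positivity)] at hr'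
  have hh : (1 - 2 * k) * (1 - m) * r ^ 2 + 2 * (1 + m * k - 2 * k) * r < 1 - m := by
    apply lt_of_mul_lt_mul_left _ (mul_pos hc0 hm').le
    nlinarith
  set σ := Real.sqrt (m ^ 2 - 2 * m + 4) with hσ
  have hp : 0 ≤ m ^ 2 - 2 * m + 4 := by nlinarith
  have hσ2 : σ ^ 2 = m ^ 2 - 2 * m + 4 := Real.sq_sqrt hp
  have hσ0 : 0 ≤ σ := Real.sqrt_nonneg _
  have hsq : Real.sqrt ((m - 1) ^ 4 * (m ^ 2 - 2 * m + 4)) = (m - 1) ^ 2 * σ := by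
    rw [Real.sqrt_mul (by positivity), show (m - 1) ^ 4 = ((m - 1) ^ 2) ^ 2 by ring,
      Real.sqrt_sq (sq_nonneg _)]
  rw [hsq] at hk
  have hden : 4 * m ^ 3 - 21 * m ^ 2 + 36 * m - 20 < 0 := by
    have : 4 * m ^ 3 - 21 * m ^ 2 + 36 * m - 20 = -((2 - m) ^ 2 * (5 - 4 * m)) := by ring
    rw [this]
    have : 0 < (2 - m) ^ 2 * (5 - 4 * m) := mul_pos (pow_pos (by linarith) 2) (by linarith)
    linarith
  rw [le_div_iff_of_neg hden] at hk
  have hthr : (2 + σ) * r ≤ 2 - m := by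
    by_contra hcon
    push Not at hcon
    have h2s : 0 < 2 + σ := by linarith
    have h2m : 0 < 2 - m := by linarith
    have h1 : (1 - 2 * k) * ((1 - m) * r ^ 2 + (2 - m) * r) < 1 - m - m * r := by linarith
    have h2 : (1 - 2 * k) * ((1 - m) * ((2 + σ) * r) ^ 2 + (2 - m) * (2 + σ) * ((2 + σ) * r)) <
        (1 - m) * (2 + σ) ^ 2 - m * (2 + σ) * ((2 + σ) * r) := by
      have := mul_lt_mul_of_pos_left h1 (pow_pos h2s 2)
      linarith
    have h3 : (1 - 2 * k) * ((1 - m) * (2 - m) ^ 2 + (2 - m) * (2 + σ) * (2 - m)) ≤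
      (1 - 2 * k) * ((1 - m) * ((2 + σ) * r) ^ 2 + (2 - m) * (2 + σ) * ((2 + σ) * r)) := by
      gcongr
    have h4 : m * (2 + σ) * (2 - m) ≤ m * (2 + σ) * ((2 + σ) * r) := by gcongr
    have h5 : (1 - 2 * k) * ((2 - m) ^ 2 * (3 - m + σ)) <
        (1 - m) * (2 + σ) ^ 2 - m * (2 + σ) * (2 - m) := by linarith
    have h6 : 0 < 3 - m - σ := by
      have : σ < 3 - m := by
        rw [hσ, Real.sqrt_lt' (by linarith)]; nlinarith
      linarith
    have h7 := mul_lt_mul_of_pos_left h5 h6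
    have h8 : (3 - m - σ) * ((1 - 2 * k) * ((2 - m) ^ 2 * (3 - m + σ))) =
       (1 - 2 * k) * ((2 - m) ^ 2 * (5 - 4 * m)) := by
      linear_combination (-(1 - 2 * k) * (2 - m) ^ 2) * hσ2
    have h9 : (3 - m - σ) * ((1 - m) * (2 + σ) ^ 2 - m * (2 + σ) * (2 - m)) =
       (2 - m) ^ 2 * (5 - 4 * m) - 2 * (6 - 9 * m + 6 * m ^ 2 - 2 * m ^ 3 - 2 * (1 - m) ^ 2 * σ) := by
      have h10 : σ ^ 3 = σ * (m ^ 2 - 2 * m + 4) := by rw [← hσ2]; ring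
      ring_nf
      ring_nf at h10
      rw [h10, hσ2]
      ring
    rw [h8, h9] at h7
    linarith
  have hr1 : r < 1 := by
    have : 1 < σ := by
      rw [hσ, Real.lt_sqrt (by norm_num)]; nlinarith
    by_contra hc
    push Not at hc
    have : (2 + σ) * 1 ≤ (2 + σ) * r := by gcongr
    linarith
  refine ⟨hr1, ?_⟩
  have hv : 0 ≤ 2 - m - 4 * r + m * r ^ 2 := by
    have e : (2 + σ) * (2 - m - 4 * r + m * r ^ 2) = (2 - m - (2 + σ) * r) * (2 + σ - m * r) := by
      linear_combination r * hσ2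
    have : 0 ≤ (2 - m - (2 + σ) * r) * (2 + σ - m * r) := by
      apply mul_nonneg (by linarith)
      nlinarith
    rw [← e] at this
    exact nonneg_of_mul_nonneg_right this (by linarith)
  intro R hR
  have h1r : 0 < 1 - r ^ 2 := by nlinarith
  have h1pr : 0 < 1 + r := by linarith
  set s := k / (1 - k) with hs
  set a := (1 + r ^ 2) / (1 - r ^ 2) with ha
  set y := (1 - r) / (1 + r) with hy
  have hse : s * (1 - k) = k := by rw [hs]; field_simp
  have hae : a * (1 - r ^ 2) = 1 + r ^ 2 := by rw [ha]; field_simp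
  have hye : y * (1 + r) = 1 - r := by rw [hy]; field_simp
  have hye2 : y * (1 - r ^ 2) = (1 - r) ^ 2 := by linear_combination (1 - r) * hye
  have hvy : a - 1 + m ≤ 2 * y := by
    apply le_of_mul_le_mul_right _ h1r
    have e : (a - 1 + m) * (1 - r ^ 2) = a * (1 - r ^ 2) - (1 - m) * (1 - r ^ 2) := by ring
    have e' : 2 * y * (1 - r ^ 2) = 2 * (y * (1 - r ^ 2)) := by ring
    rw [e, e', hae, hye2]
    linarith
  have hG0 : 0 < y ^ 2 - a * y + (1 - m) * (s + y) := by
    have e1 : (y ^ 2 - a * y) * (1 + r) ^ 2 = - 2 * r := by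
      apply mul_right_cancel₀ h1r.ne'
      have : (y ^ 2 - a * y) * (1 + r) ^ 2 * (1 - r ^ 2) =
        (y * (1 + r)) * (1 + r) * (y * (1 - r ^ 2) - a * (1 - r ^ 2)) := by ring
      rw [this, hye, hye2, hae]; ring
    have e2 : (y ^ 2 - a * y + (1 - m) * (s + y)) * ((1 + r) ^ 2 * (1 - k)) =
      (1 - m) - ((1 - 2 * k) * (1 - m) * r ^ 2 + 2 * (1 + m * k - 2 * k) * r) := by
      linear_combination (1 - k) * e1 + (1 - m) * (1 + r) ^ 2 * hse +
        (1 - m) * (1 - k) * (1 + r) * hye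
    have e3 : 0 < (y ^ 2 - a * y + (1 - m) * (s + y)) * ((1 + r) ^ 2 * (1 - k)) := by
      rw [e2]; linarith
    exact pos_of_mul_pos_left e3 (by positivity)
  have : 0 ≤ (R - (s + y)) * (R + (s + y) - (2 * s + a - 1 + m)) := by
    apply mul_nonneg <;> linarith
  linarith

/-- radius of the Ma–Minda starlike class (with inf Re φ = m) for 𝒜_β:
if f ∈ 𝒜_β then Re(zf'(z)/f(z)) > m for |z| < r, with r given by one of two formulas
according to whether κ(β) ≥ k₀ or κ(β) ≤ k₀.
Here zf'(z)/f(z) denotes the analytic extension with value 1 at z = 0. -/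
theorem radius_Abeta (β : ℝ) (hβ : β ∈ Set.Icc (0 : ℝ) 1) (m : ℝ) (hm0 : 0 ≤ m) (hm1 : m < 1)
    (f : ℂ → ℂ) (hf : memAb β f) :
    ((2 * m ^ 3 - 6 * m ^ 2 + 9 * m - 6 +
        2 * Real.sqrt ((m - 1) ^ 4 * (m ^ 2 - 2 * m + 4))) /
      (4 * m ^ 3 - 21 * m ^ 2 + 36 * m - 20) ≤ kappa β →
      ∀ z : ℂ,
        ‖z‖ < Real.sqrt ((m ^ 2 * (1 - kappa β) - m * (2 - 6 * kappa β) - 4 * kappa β +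
            4 * Real.sqrt ((m - 1) * (kappa β - 1) * kappa β)) /
          (m ^ 2 * (1 - kappa β) - m * (4 - 8 * kappa β) - 8 * kappa β + 4)) →
        m < (if z = 0 then (1 : ℂ) else z * deriv f z / f z).re) ∧
    (kappa β ≤ (2 * m ^ 3 - 6 * m ^ 2 + 9 * m - 6 +
        2 * Real.sqrt ((m - 1) ^ 4 * (m ^ 2 - 2 * m + 4))) /
      (4 * m ^ 3 - 21 * m ^ 2 + 36 * m - 20) →
      ∀ z : ℂ,
        ‖z‖ < (2 * kappa β - m * kappa β - 1 +
            Real.sqrt ((kappa β - 1) * (kappa β * (m - 2) ^ 2 - (m - 2) * m - 2))) /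
          ((1 - 2 * kappa β) * (1 - m)) →
        m < (if z = 0 then (1 : ℂ) else z * deriv f z / f z).re) := by
  have hkb := kappa_bounds hβ
  constructor
  · intro _ z hz
    split_ifs with h0
    · simpa using hm1
    · obtain ⟨hr1, hG⟩ := case_one hm0 hm1 hkb.1 hkb.2 (norm_nonneg z) hz
      obtain ⟨R, hR, _, hb⟩ := main_bound hβ hf hr1 h0 rfl
      exact G_to_bound hR (hG R) hb
  · intro hk z hz
    split_ifs with h0
    · simpa using hm1
    · obtain ⟨hr1, hG⟩ := case_two hm0 hm1 hkb.1 hkb.2 (norm_nonneg z) hk hz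
      obtain ⟨R, hR, hR0, hb⟩ := main_bound hβ hf hr1 h0 rfl
      exact G_to_bound hR (hG R hR0) hb
end
end

section
/- Let f ∈ 𝒢₀, i.e. f ∈ 𝒜 with Re(f(z)/z) > 0 for all z ∈ 𝔻 \ {0}. Then Re(z f'(z)/f(z)) > 1/2 for all z with |z| < √5 − 2 (so f is starlike of order 1/2, and hence belongs to the parabolic starlike radius class considered in the paper, on the disk of radius √5 − 2). -/
open Complex Metric Set

noncomputable section

/-- Schwarz–Pick for functions with positive real part. -/
lemma aux_pick (p : ℂ → ℂ) (hp : DifferentiableOn ℂ p (ball (0 : ℂ) 1))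
    (hpos : ∀ z ∈ ball (0 : ℂ) 1, 0 < (p z).re) (a : ℂ) (ha : ‖a‖ < 1) :
    ‖deriv p a‖ * (1 - ‖a‖ ^ 2) ≤ 2 * (p a).re := by
  have hden : ∀ w ∈ ball (0 : ℂ) 1, 1 + (starRingEnd ℂ) a * w ≠ 0 := by
    intro w hw h0
    rw [mem_ball_zero_iff] at hw
    have h1 : (starRingEnd ℂ) a * w = -1 := by linear_combination h0
    have h2 : ‖a‖ * ‖w‖ = 1 := by
      have := congrArg norm h1
      simpa using this
    nlinarith [norm_nonneg a, norm_nonneg w]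
  have hsub : ∀ w ∈ ball (0 : ℂ) 1,
      (w + a) / (1 + (starRingEnd ℂ) a * w) ∈ ball (0 : ℂ) 1 := by
    intro w hw
    have hd := hden w hw
    rw [mem_ball_zero_iff] at hw ⊢
    rw [norm_div, div_lt_one (norm_pos_iff.mpr hd)]
    apply lt_of_pow_lt_pow_left₀ 2 (norm_nonneg _)
    have e1 : ‖w‖ ^ 2 < 1 := by nlinarith [norm_nonneg w]
    have e2 : ‖a‖ ^ 2 < 1 := by nlinarith [norm_nonneg a]
    rw [Complex.sq_norm, Complex.normSq_apply] at e1 e2 ⊢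
    rw [Complex.sq_norm, Complex.normSq_apply]
    simp only [add_re, add_im, mul_re, mul_im, conj_re, conj_im, one_re, one_im]
    nlinarith [mul_pos (sub_pos.mpr e1) (sub_pos.mpr e2)]
  have ham : a ∈ ball (0 : ℂ) 1 := by simpa using ha
  have hpd : ∀ z ∈ ball (0 : ℂ) 1, p z + (starRingEnd ℂ) (p a) ≠ 0 := by
    intro z hz h0
    have := congrArg Complex.re h0
    simp at this
    linarith [hpos z hz, hpos a ham]
  set h : ℂ → ℂ := fun w =>
    (p ((w + a) / (1 + (starRingEnd ℂ) a * w)) - p a) /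
      (p ((w + a) / (1 + (starRingEnd ℂ) a * w)) + (starRingEnd ℂ) (p a)) with hh
  have hφ : DifferentiableOn ℂ (fun w : ℂ => (w + a) / (1 + (starRingEnd ℂ) a * w))
      (ball (0 : ℂ) 1) := by
    apply DifferentiableOn.div (by fun_prop) (by fun_prop) hden
  have hpφ : DifferentiableOn ℂ (fun w : ℂ => p ((w + a) / (1 + (starRingEnd ℂ) a * w)))
      (ball (0 : ℂ) 1) := hp.comp hφ hsub
  have hhd : DifferentiableOn ℂ h (ball (0 : ℂ) 1) :=
    (hpφ.sub_const _).div (hpφ.add_const _) (fun w hw => hpd _ (hsub w hw))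
  have h0 : h 0 = 0 := by simp [hh]
  have hmaps : MapsTo h (ball (0 : ℂ) 1) (closedBall (h 0) 1) := by
    intro w hw
    rw [h0, mem_closedBall_zero_iff]
    have hb := hsub w hw
    have hd := hpd _ hb
    have q1 := hpos _ hb
    have q2 := hpos _ ham
    simp only [hh]
    rw [norm_div, div_le_one (norm_pos_iff.mpr hd)]
    apply le_of_sq_le_sq _ (norm_nonneg _)
    generalize p ((w + a) / (1 + (starRingEnd ℂ) a * w)) = u at *
    rw [Complex.sq_norm, Complex.normSq_apply, Complex.sq_norm, Complex.normSq_apply]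
    simp only [add_re, add_im, sub_re, sub_im, conj_re, conj_im]
    nlinarith [mul_pos q1 q2]
  have hder := norm_deriv_le_one_of_mapsTo_ball hhd hmaps one_pos
  have hpa : HasDerivAt p (deriv p a) ((0 + a) / (1 + (starRingEnd ℂ) a * 0)) := by
    simpa using (hp.differentiableAt (isOpen_ball.mem_nhds ham)).hasDerivAt
  have hφ0 : HasDerivAt (fun w : ℂ => (w + a) / (1 + (starRingEnd ℂ) a * w))
      (1 - a * (starRingEnd ℂ) a) 0 := by
    have := ((hasDerivAt_id (0 : ℂ)).add_const a).div
      (((hasDerivAt_id (0 : ℂ)).const_mul ((starRingEnd ℂ) a)).const_add 1) (by simp)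
    refine HasDerivAt.congr_deriv this ?_
    simp
  have hc := hpa.comp (0 : ℂ) hφ0
  have hfull := (hc.sub_const (p a)).div (hc.add_const ((starRingEnd ℂ) (p a)))
    (by simpa using hpd a ham)
  have hval : deriv h 0 = deriv p a * (1 - a * (starRingEnd ℂ) a) /
      (p a + (starRingEnd ℂ) (p a)) := by
    have hne := hpd a ham
    have : deriv h 0 = _ := hfull.deriv
    rw [this]
    simp
    field_simp
  rw [hval, Complex.mul_conj, Complex.add_conj, norm_div, norm_mul, ← Complex.sq_norm,
    div_le_one] at hder
  · have e : (1 : ℂ) - ((‖a‖ ^ 2 : ℝ) : ℂ) = ((1 - ‖a‖ ^ 2 : ℝ) : ℂ) := by push_cast; ring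
    have e2 : ‖a‖ ^ 2 < 1 := by nlinarith [norm_nonneg a]
    rw [e, Complex.norm_real, Complex.norm_real, Real.norm_of_nonneg (by linarith),
      Real.norm_of_nonneg (by linarith [hpos a ham])] at hder
    exact hder
  · rw [Complex.norm_real]
    have := hpos a ham
    rw [Real.norm_of_nonneg] <;> linarith

/-- if f ∈ 𝒢₀, i.e. f ∈ 𝒜 with Re(f(z)/z) > 0 on 𝔻 \ {0}, then
Re(zf'(z)/f(z)) > 1/2 for |z| < √5 - 2 (so f is starlike of order 1/2 there).
Here zf'(z)/f(z) denotes the analytic extension with value 1 at z = 0. -/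
theorem G0_starlike_half_radius (f : ℂ → ℂ) (hf : memA f)
    (hre : ∀ z ∈ ball (0 : ℂ) 1, z ≠ 0 → 0 < (f z / z).re) :
    ∀ z : ℂ, ‖z‖ < Real.sqrt 5 - 2 →
      (1 : ℝ) / 2 < (if z = 0 then (1 : ℂ) else z * deriv f z / f z).re := by
  intro z hz
  obtain ⟨hd, hf0, hf1⟩ := hf
  by_cases hz0 : z = 0
  · simp [hz0]; norm_num
  rw [if_neg hz0]
  have h5 : Real.sqrt 5 ^ 2 = 5 := Real.sq_sqrt (by norm_num)
  have h5' : 0 ≤ Real.sqrt 5 := Real.sqrt_nonneg 5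
  have hz1 : ‖z‖ < 1 := by nlinarith
  have hzn := norm_nonneg z
  have hq : ‖z‖ ^ 2 + 4 * ‖z‖ < 1 := by nlinarith
  have hp : DifferentiableOn ℂ (dslope f 0) (ball (0 : ℂ) 1) :=
    (Complex.differentiableOn_dslope (ball_mem_nhds 0 one_pos)).mpr hd
  have hpe : ∀ w : ℂ, w ≠ 0 → dslope f 0 w = f w / w := by
    intro w hw
    rw [dslope_of_ne _ hw, slope_def_field, hf0, sub_zero, sub_zero]
  have hpos : ∀ w ∈ ball (0 : ℂ) 1, 0 < (dslope f 0 w).re := by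
    intro w hw
    by_cases hw0 : w = 0
    · rw [hw0, dslope_same, hf1]; simp
    · rw [hpe w hw0]; exact hre w hw hw0
  have hzm : z ∈ ball (0 : ℂ) 1 := by simpa using hz1
  have key := aux_pick _ hp hpos z hz1
  have hP := hpos z hzm
  have hfz : f z ≠ 0 := by
    intro h
    rw [hpe z hz0, h] at hP
    simp at hP
  have hfd := (hd.differentiableAt (isOpen_ball.mem_nhds hzm)).hasDerivAt
  have hpd := (hp.differentiableAt (isOpen_ball.mem_nhds hzm)).hasDerivAt
  have hfeq : ∀ w : ℂ, w * dslope f 0 w = f w := by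
    intro w
    by_cases hw0 : w = 0
    · simp [hw0, hf0]
    · rw [hpe w hw0]; field_simp
  have hprod := (hasDerivAt_id z).mul hpd
  have hfun : (id * dslope f 0 : ℂ → ℂ) = f := by
    funext w; exact hfeq w
  rw [hfun] at hprod
  have hdf := hfd.unique hprod
  simp only [id, one_mul] at hdf
  have hne : dslope f 0 z ≠ 0 := by
    intro h; rw [h] at hP; simp at hP
  have hexp : z * deriv f z / f z = 1 + z * deriv (dslope f 0) z / dslope f 0 z := by
    rw [hdf, ← hfeq z]
    field_simp
  rw [hexp, add_re, one_re]
  have hb : ‖z * deriv (dslope f 0) z / dslope f 0 z‖ < 1 / 2 := by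
    rw [norm_div, norm_mul, div_lt_iff₀ (norm_pos_iff.mpr hne)]
    have hle : (dslope f 0 z).re ≤ ‖dslope f 0 z‖ := Complex.re_le_norm _
    have hN : 0 < ‖dslope f 0 z‖ := norm_pos_iff.mpr hne
    have hpos1 : 0 < 1 - ‖z‖ ^ 2 := by nlinarith
    have k1 : ‖z‖ * (‖deriv (dslope f 0) z‖ * (1 - ‖z‖ ^ 2)) ≤ ‖z‖ * (2 * ‖dslope f 0 z‖) :=
      mul_le_mul_of_nonneg_left (by linarith) hzn
    have k2 : (4 * ‖z‖) * ‖dslope f 0 z‖ < (1 - ‖z‖ ^ 2) * ‖dslope f 0 z‖ :=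
      mul_lt_mul_of_pos_right (by linarith) hN
    apply lt_of_mul_lt_mul_right _ hpos1.le
    nlinarith
  have := (abs_le.mp (Complex.abs_re_le_norm (z * deriv (dslope f 0) z / dslope f 0 z))).1
  linarith
end
end
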